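/- arXiv:1003.1216 — 11 statements merged into one kernel-verified Lean document; each statement's English description precedes it below -/
import Mathlib

section
/- For every A ∈ (0, f(1)) there exists exactly one stationary radius R > 0, i.e. exactly one R > 0 for which there exists a function ψ ∈ C¹([0,R]) ∩ C²((0,R]) with 0 ≤ ψ(r) ≤ 1 for all r ∈ [0,R], ψ''(r) + ψ'(r)/r = f(ψ(r)) for r ∈ (0,R], ψ'(0) = 0, ψ(R) = 1, and ψ'(R) = A·R/2. -/
open Set

/-- `R > 0` is a *stationary radius* for the parameter `A` (with nutrient consumption
rate `f`): there is a nutrient concentration `ψ ∈ C¹([0,R]) ∩ C²((0,R])`, with values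
in `[0,1]`, solving the radially symmetric problem
`ψ'' + ψ'/r = f(ψ)` on `(0,R]`, `ψ'(0) = 0`, `ψ(R) = 1`, `ψ'(R) = A·R/2`. -/
def IsStationaryRadius (f : ℝ → ℝ) (A R : ℝ) : Prop :=
  0 < R ∧
  ∃ ψ : ℝ → ℝ,
    ContDiffOn ℝ 1 ψ (Icc 0 R) ∧
    ContDiffOn ℝ 2 ψ (Ioc 0 R) ∧
    (∀ r ∈ Icc (0:ℝ) R, 0 ≤ ψ r ∧ ψ r ≤ 1) ∧
    (∀ r ∈ Ioc (0:ℝ) R, deriv (deriv ψ) r + deriv ψ r / r = f (ψ r)) ∧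
    deriv ψ 0 = 0 ∧
    ψ R = 1 ∧
    deriv ψ R = A * R / 2

open BoundedContinuousFunction

theorem inner_cont (g : ℝ → ℝ) (hg : Continuous g) (Ψ : ℝ × ℝ → ℝ) (hΨ : Continuous Ψ) :
    Continuous (fun p : ℝ × ℝ => ∫ τ in (0:ℝ)..1, τ * g (Ψ (p.1, p.2 * τ))) := by
  apply intervalIntegral.continuous_parametric_intervalIntegral_of_continuous'
  fun_prop

theorem inner_cont1 (g : ℝ → ℝ) (hg : Continuous g) (ψ : ℝ → ℝ) (hψ : Continuous ψ) :
    Continuous (fun s : ℝ => ∫ τ in (0:ℝ)..1, τ * g (ψ (s * τ))) := by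
  apply intervalIntegral.continuous_parametric_intervalIntegral_of_continuous'
  fun_prop

theorem outer_cont1 (g : ℝ → ℝ) (hg : Continuous g) (ψ : ℝ → ℝ) (hψ : Continuous ψ) :
    Continuous (fun r : ℝ => ∫ t in (0:ℝ)..1, t * ∫ τ in (0:ℝ)..1, τ * g (ψ (r * t * τ))) := by
  have h := inner_cont1 g hg ψ hψ
  apply intervalIntegral.continuous_parametric_intervalIntegral_of_continuous'
    (f := fun r t => t * ∫ τ in (0:ℝ)..1, τ * g (ψ (r * t * τ)))
  have : Continuous (fun p : ℝ × ℝ => p.2 * (fun s : ℝ => ∫ τ in (0:ℝ)..1, τ * g (ψ (s * τ))) (p.1 * p.2)) := by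
    fun_prop
  exact this

theorem inner_bound (g : ℝ → ℝ) (B : ℝ) (hB : ∀ x, |g x| ≤ B) (ψ : ℝ → ℝ) (s : ℝ) :
    |∫ τ in (0:ℝ)..1, τ * g (ψ (s * τ))| ≤ B := by
  have := intervalIntegral.norm_integral_le_of_norm_le_const (a := (0:ℝ)) (b := 1) (C := B)
    (f := fun τ => τ * g (ψ (s * τ))) (by
      intro x hx
      rw [uIoc_of_le zero_le_one] at hx
      rw [Real.norm_eq_abs, abs_mul, abs_of_pos hx.1]
      have := hB (ψ (s * x))
      have h2 := abs_nonneg (g (ψ (s * x)))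
      nlinarith [hx.2])
  simpa using this

theorem outer_bound (g : ℝ → ℝ) (B : ℝ) (hB : ∀ x, |g x| ≤ B) (ψ : ℝ → ℝ) (r : ℝ) :
    |∫ t in (0:ℝ)..1, t * ∫ τ in (0:ℝ)..1, τ * g (ψ (r * t * τ))| ≤ B := by
  have := intervalIntegral.norm_integral_le_of_norm_le_const (a := (0:ℝ)) (b := 1) (C := B)
    (f := fun t => t * ∫ τ in (0:ℝ)..1, τ * g (ψ (r * t * τ))) (by
      intro x hx
      rw [uIoc_of_le zero_le_one] at hx
      rw [Real.norm_eq_abs, abs_mul, abs_of_pos hx.1]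
      have := inner_bound g B hB ψ (r * x)
      have h2 := abs_nonneg (∫ τ in (0:ℝ)..1, τ * g (ψ (r * x * τ)))
      nlinarith [hx.2])
  simpa using this

theorem exp_int (k r : ℝ) (hk : 0 < k) :
    r ^ 2 * ∫ t in (0:ℝ)..1, t * Real.exp (k * (r * t) ^ 2) = (Real.exp (k * r ^ 2) - 1) / (2 * k) := by
  rw [← intervalIntegral.integral_const_mul]
  have h : ∀ t ∈ uIcc (0:ℝ) 1, HasDerivAt (fun t => Real.exp (k * (r * t) ^ 2) / (2 * k))
      (r ^ 2 * (t * Real.exp (k * (r * t) ^ 2))) t := by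
    intro t _
    have := (((((hasDerivAt_id t).const_mul r).pow 2).const_mul k).exp).div_const (2 * k)
    refine this.congr_deriv ?_
    simp
    field_simp
  rw [intervalIntegral.integral_eq_sub_of_hasDerivAt h]
  · simp; ring
  · apply Continuous.intervalIntegrable; fun_prop

theorem inner_diff (g : ℝ → ℝ) (hg : Continuous g) (L : ℝ) (hL : 0 < L)
    (hLip : ∀ x y, |g x - g y| ≤ L * |x - y|) (ψ χ : ℝ → ℝ) (hψ : Continuous ψ)
    (hχ : Continuous χ) (N : ℝ) (h : ∀ x, |ψ x - χ x| ≤ N * Real.exp (L * x ^ 2)) (s : ℝ) :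
    |(∫ τ in (0:ℝ)..1, τ * g (ψ (s * τ))) - ∫ τ in (0:ℝ)..1, τ * g (χ (s * τ))|
      ≤ L * N * Real.exp (L * s ^ 2) := by
  have hN : 0 ≤ N := by
    have := (abs_nonneg _).trans (h 0)
    simpa using this
  rw [← intervalIntegral.integral_sub (Continuous.intervalIntegrable (by fun_prop) _ _)
    (Continuous.intervalIntegrable (by fun_prop) _ _)]
  have := intervalIntegral.norm_integral_le_of_norm_le_const (a := (0:ℝ)) (b := 1)
    (C := L * N * Real.exp (L * s ^ 2))
    (f := fun τ => τ * g (ψ (s * τ)) - τ * g (χ (s * τ))) (by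
      intro x hx
      rw [uIoc_of_le zero_le_one] at hx
      rw [Real.norm_eq_abs, ← mul_sub, abs_mul, abs_of_pos hx.1]
      have h1 := hLip (ψ (s * x)) (χ (s * x))
      have h2 := h (s * x)
      have h3 : Real.exp (L * (s * x) ^ 2) ≤ Real.exp (L * s ^ 2) := by
        apply Real.exp_le_exp.2
        apply mul_le_mul_of_nonneg_left _ hL.le
        rw [mul_pow]
        have : x ^ 2 ≤ 1 := by nlinarith [hx.1, hx.2]
        nlinarith [sq_nonneg s]
      calc x * |g (ψ (s * x)) - g (χ (s * x))| ≤ 1 * |g (ψ (s * x)) - g (χ (s * x))| :=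
            mul_le_mul_of_nonneg_right hx.2 (abs_nonneg _)
        _ ≤ L * |ψ (s * x) - χ (s * x)| := by linarith
        _ ≤ L * (N * Real.exp (L * (s * x) ^ 2)) := by gcongr
        _ ≤ L * (N * Real.exp (L * s ^ 2)) := by gcongr
        _ = _ := by ring)
  simpa using this

theorem outer_diff (g : ℝ → ℝ) (hg : Continuous g) (L : ℝ) (hL : 0 < L)
    (hLip : ∀ x y, |g x - g y| ≤ L * |x - y|) (ψ χ : ℝ → ℝ) (hψ : Continuous ψ)
    (hχ : Continuous χ) (N : ℝ) (h : ∀ x, |ψ x - χ x| ≤ N * Real.exp (L * x ^ 2)) (r : ℝ) :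
    |r ^ 2 * (∫ t in (0:ℝ)..1, t * ∫ τ in (0:ℝ)..1, τ * g (ψ (r * t * τ))) -
      r ^ 2 * (∫ t in (0:ℝ)..1, t * ∫ τ in (0:ℝ)..1, τ * g (χ (r * t * τ)))|
      ≤ N / 2 * Real.exp (L * r ^ 2) := by
  have hN : 0 ≤ N := by
    have := (abs_nonneg _).trans (h 0)
    simpa using this
  have c1 := inner_cont1 g hg ψ hψ
  have c2 := inner_cont1 g hg χ hχ
  have c1' : Continuous (fun t : ℝ => t * ∫ τ in (0:ℝ)..1, τ * g (ψ (r * t * τ))) :=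
    continuous_id.mul (c1.comp (continuous_const.mul continuous_id))
  have c2' : Continuous (fun t : ℝ => t * ∫ τ in (0:ℝ)..1, τ * g (χ (r * t * τ))) :=
    continuous_id.mul (c2.comp (continuous_const.mul continuous_id))
  rw [← mul_sub, ← intervalIntegral.integral_sub (c1'.intervalIntegrable _ _)
    (c2'.intervalIntegrable _ _), abs_mul, abs_of_nonneg (sq_nonneg r)]
  have key : |∫ t in (0:ℝ)..1, (t * (∫ τ in (0:ℝ)..1, τ * g (ψ (r * t * τ))) -
      t * ∫ τ in (0:ℝ)..1, τ * g (χ (r * t * τ)))| ≤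
      ∫ t in (0:ℝ)..1, L * N * (t * Real.exp (L * (r * t) ^ 2)) := by
    rw [← Real.norm_eq_abs]
    apply intervalIntegral.norm_integral_le_of_norm_le zero_le_one
    · filter_upwards with t ht
      rw [Real.norm_eq_abs, ← mul_sub, abs_mul, abs_of_pos ht.1]
      have := inner_diff g hg L hL hLip ψ χ hψ hχ N h (r * t)
      calc _ ≤ t * (L * N * Real.exp (L * (r * t) ^ 2)) :=
            mul_le_mul_of_nonneg_left this ht.1.le
        _ = _ := by ring
    · apply Continuous.intervalIntegrable; fun_prop
  calc _ ≤ r ^ 2 * ∫ t in (0:ℝ)..1, L * N * (t * Real.exp (L * (r * t) ^ 2)) := by gcongr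
    _ = L * N * (r ^ 2 * ∫ t in (0:ℝ)..1, (t * Real.exp (L * (r * t) ^ 2))) := by
        rw [intervalIntegral.integral_const_mul]; ring
    _ = N / 2 * (Real.exp (L * r ^ 2) - 1) := by rw [exp_int L r hL]; field_simp
    _ ≤ _ := by nlinarith

theorem solution_family (g : ℝ → ℝ) (hg : Continuous g) (L : ℝ) (hL : 0 < L)
    (hLip : ∀ x y, |g x - g y| ≤ L * |x - y|) (B : ℝ) (hB : ∀ x, |g x| ≤ B) :
    ∃ Ψ : ℝ × ℝ → ℝ, Continuous Ψ ∧ (g 0 = 0 → ∀ r, Ψ (0, r) = 0) ∧ ∀ a r, Ψ (a, r) = a + r ^ 2 * ∫ t in (0:ℝ)..1,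
      t * ∫ τ in (0:ℝ)..1, τ * g (Ψ (a, r * t * τ)) := by
  have hB0 : 0 ≤ B := (abs_nonneg _).trans (hB 0)
  let W : (ℝ →ᵇ ℝ) → ℝ → ℝ := fun φ r => Real.exp (L * r ^ 2) * φ r
  have hW : ∀ φ, Continuous (W φ) := fun φ => by
    have := φ.continuous
    fun_prop
  let S : ℝ → (ℝ →ᵇ ℝ) → (ℝ →ᵇ ℝ) := fun a φ =>
    BoundedContinuousFunction.ofNormedAddCommGroup
      (fun r => Real.exp (-(L * r ^ 2)) * (a + r ^ 2 * ∫ t in (0:ℝ)..1,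
        t * ∫ τ in (0:ℝ)..1, τ * g (W φ (r * t * τ))))
      (by
        have := outer_cont1 g hg (W φ) (hW φ)
        fun_prop)
      (|a| + B / L)
      (by
        intro r
        rw [Real.norm_eq_abs, abs_mul, abs_of_pos (Real.exp_pos _), Real.exp_neg, inv_mul_le_iff₀ (Real.exp_pos _)]
        have h1 := outer_bound g B hB (W φ) r
        have h2 := Real.add_one_le_exp (L * r ^ 2)
        have h3 : 0 ≤ L * r ^ 2 := by positivity
        calc _ ≤ |a| + r ^ 2 * B := by
              refine (abs_add_le _ _).trans ?_
              rw [abs_mul, abs_of_nonneg (sq_nonneg r)]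
              gcongr
          _ = |a| + (L * r ^ 2) * (B / L) := by field_simp
          _ ≤ Real.exp (L * r ^ 2) * |a| + Real.exp (L * r ^ 2) * (B / L) := by
              have : 0 ≤ B / L := by positivity
              have := abs_nonneg a
              gcongr
              · nlinarith
              · linarith
          _ = _ := by ring)
  have hS : ∀ a φ r, S a φ r = Real.exp (-(L * r ^ 2)) * (a + r ^ 2 * ∫ t in (0:ℝ)..1,
        t * ∫ τ in (0:ℝ)..1, τ * g (W φ (r * t * τ))) := fun a φ r => rfl
  have hcon : ∀ a, ContractingWith (1/2 : NNReal) (S a) := by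
    intro a
    refine ⟨by rw [div_lt_one] <;> norm_num, LipschitzWith.of_dist_le_mul ?_⟩
    intro φ χ
    rw [BoundedContinuousFunction.dist_le (by positivity)]
    intro r
    have := outer_diff g hg L hL hLip (W φ) (W χ) (hW φ) (hW χ) (dist φ χ) (by
      intro x
      have h1 := BoundedContinuousFunction.dist_coe_le_dist (f := φ) (g := χ) x
      rw [Real.dist_eq] at h1
      simp only [W]
      rw [← mul_sub, abs_mul, abs_of_pos (Real.exp_pos _), mul_comm]
      gcongr) r
    rw [Real.dist_eq, hS, hS, ← mul_sub, abs_mul, abs_of_pos (Real.exp_pos _), Real.exp_neg,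
      inv_mul_le_iff₀ (Real.exp_pos _), add_sub_add_left_eq_sub]
    refine this.trans (le_of_eq ?_)
    push_cast
    ring
  let Φ : ℝ → (ℝ →ᵇ ℝ) := fun a => (hcon a).fixedPoint (S a)
  have hΦ : ∀ a, S a (Φ a) = Φ a := fun a => (hcon a).fixedPoint_isFixedPt
  have hdist : ∀ a b, dist (Φ a) (Φ b) ≤ 2 * dist a b := by
    intro a b
    have := (hcon a).dist_fixedPoint_fixedPoint_of_dist_le' (S b) (hΦ a) (hΦ b) (C := dist a b) (by
      intro z
      rw [BoundedContinuousFunction.dist_le dist_nonneg]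
      intro r
      rw [Real.dist_eq, hS, hS, ← mul_sub, abs_mul, abs_of_pos (Real.exp_pos _),
        add_sub_add_right_eq_sub, ← Real.dist_eq]
      have : Real.exp (-(L * r ^ 2)) ≤ 1 := Real.exp_le_one_iff.2 (by have : 0 ≤ L * r ^ 2 := by positivity
                                                                      linarith)
      exact mul_le_of_le_one_left dist_nonneg this)
    refine this.trans (le_of_eq ?_)
    push_cast
    ring
  have hΦc : Continuous Φ := (LipschitzWith.of_dist_le_mul (K := 2) (by simpa using hdist)).continuous
  refine ⟨fun p => W (Φ p.1) p.2, ?_, ?_, ?_⟩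
  · have : Continuous (fun p : ℝ × ℝ => Φ p.1 p.2) := by
      exact ContinuousEval.continuous_eval.comp ((hΦc.comp continuous_fst).prodMk continuous_snd)
    simp only [W]
    fun_prop
  · intro h0 r
    have h1 : (0 : ℝ →ᵇ ℝ) = Φ 0 := by
      apply (hcon 0).fixedPoint_unique
      show S 0 0 = 0
      ext r
      rw [hS]
      simp [W, h0]
    show Real.exp (L * r ^ 2) * Φ 0 r = _
    rw [← h1]
    simp
  · intro a r
    have h1 : Φ a r = S a (Φ a) r := by rw [hΦ a]
    show Real.exp (L * r ^ 2) * Φ a r = _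
    rw [h1, hS, ← mul_assoc, ← Real.exp_add]
    simp

theorem sol_props (g : ℝ → ℝ) (hg : Continuous g) (ψ : ℝ → ℝ) (hψ : Continuous ψ) (a : ℝ)
    (h : ∀ r, ψ r = a + r ^ 2 * ∫ t in (0:ℝ)..1,
      t * ∫ τ in (0:ℝ)..1, τ * g (ψ (r * t * τ))) (m : ℝ → ℝ)
    (hm : ∀ s, m s = ∫ τ in (0:ℝ)..1, τ * g (ψ (s * τ))) :
    Continuous m ∧ ψ 0 = a ∧ m 0 = g a / 2 ∧ (∀ r, HasDerivAt ψ (r * m r) r) ∧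
      ∀ r, HasDerivAt (fun r => r ^ 2 * m r) (r * g (ψ r)) r := by
  have hmc : Continuous m := by
    have := inner_cont1 g hg ψ hψ
    rwa [← funext hm] at this
  have h0 : ψ 0 = a := by rw [h 0]; simp
  have h1 : ∀ r, ψ r = a + ∫ s in (0:ℝ)..r, s * m s := by
    intro r
    have e := intervalIntegral.mul_integral_comp_mul_left (a := (0:ℝ)) (b := 1)
      (f := fun s => s * m s) (c := r)
    simp only [mul_zero, mul_one] at e
    rw [h r, ← e]
    simp_rw [← hm, mul_assoc r, intervalIntegral.integral_const_mul]
    ring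
  have h2 : ∀ r, r ^ 2 * m r = ∫ s in (0:ℝ)..r, s * g (ψ s) := by
    intro r
    have e := intervalIntegral.mul_integral_comp_mul_left (a := (0:ℝ)) (b := 1)
      (f := fun s => s * g (ψ s)) (c := r)
    simp only [mul_zero, mul_one] at e
    rw [hm r, ← e]
    simp_rw [mul_assoc r, intervalIntegral.integral_const_mul]
    ring
  refine ⟨hmc, h0, ?_, ?_, ?_⟩
  · rw [hm 0]
    simp [h0]
    ring
  · intro r
    have c : Continuous (fun s => s * m s) := by fun_prop
    have := (c.integral_hasStrictDerivAt 0 r).hasDerivAt.const_add a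
    rwa [← funext h1] at this
  · intro r
    have c : Continuous (fun s => s * g (ψ s)) := by fun_prop
    have := (c.integral_hasStrictDerivAt 0 r).hasDerivAt
    rwa [← funext h2] at this

theorem shoot (g : ℝ → ℝ) (hg : Continuous g) (L : ℝ) (hL : 0 < L)
    (hLip : ∀ x y, |g x - g y| ≤ L * |x - y|) (B : ℝ) (hB : ∀ x, g x ≤ B)
    (hg0 : g 0 = 0) (hnn : ∀ x, 0 ≤ g x) (hmono : Monotone g) (hpos : ∀ x, 0 < x → 0 < g x)
    (A : ℝ) (hA0 : 0 < A) (hA1 : A < g 1) :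
    ∃ R > 0, ∃ ψ m : ℝ → ℝ, Continuous m ∧ Continuous ψ ∧ (∀ r, HasDerivAt ψ (r * m r) r) ∧
      (∀ r, HasDerivAt (fun r => r ^ 2 * m r) (r * g (ψ r)) r) ∧
      (∀ r ∈ Icc 0 R, 0 ≤ ψ r ∧ ψ r ≤ 1) ∧ ψ R = 1 ∧ m R = A / 2 := by
  obtain ⟨Ψ, hΨ, hΨ0, hfix⟩ := solution_family g hg L hL hLip B
    (fun x => by rw [abs_of_nonneg (hnn x)]; exact hB x)
  have hΨ0 := hΨ0 hg0
  let m : ℝ × ℝ → ℝ := fun p => ∫ τ in (0:ℝ)..1, τ * g (Ψ (p.1, p.2 * τ))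
  have hm : Continuous m := inner_cont g hg Ψ hΨ
  have hm0 : ∀ p, 0 ≤ m p := by
    intro p
    apply intervalIntegral.integral_nonneg zero_le_one
    intro u hu
    exact mul_nonneg hu.1 (hnn _)
  have hψc : ∀ a, Continuous (fun r => Ψ (a, r)) := fun a => by fun_prop
  have props := fun a => sol_props g hg (fun r => Ψ (a, r)) (hψc a) a (hfix a)
    (fun s => m (a, s)) (fun s => rfl)
  have hd : ∀ a r, HasDerivAt (fun r => Ψ (a, r)) (r * m (a, r)) r := fun a => (props a).2.2.2.1
  have hd2 : ∀ a r, HasDerivAt (fun r => r ^ 2 * m (a, r)) (r * g (Ψ (a, r))) r :=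
    fun a => (props a).2.2.2.2
  have hinit : ∀ a, Ψ (a, 0) = a := fun a => (props a).2.1
  have hminit : ∀ a, m (a, 0) = g a / 2 := fun a => (props a).2.2.1
  have hmon : ∀ a, MonotoneOn (fun r => Ψ (a, r)) (Ici 0) := by
    intro a
    apply monotoneOn_of_deriv_nonneg (convex_Ici 0) (hψc a).continuousOn
    · intro x _
      exact (hd a x).differentiableAt.differentiableWithinAt
    · intro x hx
      rw [interior_Ici] at hx
      rw [(hd a x).deriv]
      exact mul_nonneg (le_of_lt hx) (hm0 _)
  have hge : ∀ a r, 0 ≤ r → a ≤ Ψ (a, r) := by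
    intro a r hr
    have := hmon a (mem_Ici.2 le_rfl) (mem_Ici.2 hr) hr
    simpa [hinit] using this
  have hmlow : ∀ a r, 0 ≤ r → g a / 2 ≤ m (a, r) := by
    intro a r hr
    rcases hr.eq_or_lt with rfl | hr
    · rw [hminit]
    have hD : ∀ r, HasDerivAt (fun r => r ^ 2 * m (a, r) - g a / 2 * r ^ 2)
        (r * g (Ψ (a, r)) - g a / 2 * (2 * r)) r := fun r => by
      have := (hd2 a r).sub ((hasDerivAt_pow 2 r).const_mul (g a / 2))
      refine this.congr_deriv ?_
      simp
    have : MonotoneOn (fun r => r ^ 2 * m (a, r) - g a / 2 * r ^ 2) (Ici 0) := by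
      apply monotoneOn_of_deriv_nonneg (convex_Ici 0)
      · exact fun x _ => (hD x).continuousAt.continuousWithinAt
      · exact fun x _ => (hD x).differentiableAt.differentiableWithinAt
      · intro x hx
        rw [interior_Ici] at hx
        rw [(hD x).deriv]
        have := hmono (hge a x (le_of_lt hx))
        have hx : 0 < x := hx
        nlinarith
    have := this (mem_Ici.2 le_rfl) (mem_Ici.2 hr.le) hr.le
    simp only at this
    have h2 : 0 < r ^ 2 := by positivity
    nlinarith
  have hsm : ∀ a, 0 < a → StrictMonoOn (fun r => Ψ (a, r)) (Ici 0) := by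
    intro a ha
    apply strictMonoOn_of_deriv_pos (convex_Ici 0) (hψc a).continuousOn
    intro x hx
    rw [interior_Ici] at hx
    rw [(hd a x).deriv]
    have := hmlow a x (le_of_lt hx)
    have := hpos a ha
    exact mul_pos hx (by linarith)
  have hlow : ∀ a r, 0 ≤ r → a + g a / 4 * r ^ 2 ≤ Ψ (a, r) := by
    intro a r hr
    have hD : ∀ r, HasDerivAt (fun r => Ψ (a, r) - g a / 4 * r ^ 2)
        (r * m (a, r) - g a / 4 * (2 * r)) r := fun r => by
      have := (hd a r).sub ((hasDerivAt_pow 2 r).const_mul (g a / 4))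
      refine this.congr_deriv ?_
      simp
    have : MonotoneOn (fun r => Ψ (a, r) - g a / 4 * r ^ 2) (Ici 0) := by
      apply monotoneOn_of_deriv_nonneg (convex_Ici 0)
      · exact fun x _ => (hD x).continuousAt.continuousWithinAt
      · exact fun x _ => (hD x).differentiableAt.differentiableWithinAt
      · intro x hx
        rw [interior_Ici] at hx
        rw [(hD x).deriv]
        have := hmlow a x (le_of_lt hx)
        have hx : 0 < x := hx
        nlinarith
    have := this (mem_Ici.2 le_rfl) (mem_Ici.2 hr) hr
    simp only [hinit] at this
    linarith
  have hR : ∀ a, a ∈ Ioc (0:ℝ) 1 → ∃ R, 0 ≤ R ∧ Ψ (a, R) = 1 := by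
    intro a ha
    have hga := hpos a ha.1
    let M := 1 + 4 / g a
    have hM : 0 ≤ M := by positivity
    have h1 : 1 ≤ Ψ (a, M) := by
      refine le_trans ?_ (hlow a M hM)
      have : 1 ≤ M := by simp only [M]; have : 0 < 4 / g a := by positivity
                         linarith
      have h2 : g a / 4 * M ≥ 1 := by
        simp only [M]; field_simp; linarith
      nlinarith [ha.1]
    have := intermediate_value_Icc hM (hψc a).continuousOn
    obtain ⟨R, hR, hR1⟩ := this ⟨by simpa [hinit] using ha.2, h1⟩
    exact ⟨R, hR.1, hR1⟩
  choose! R hR0 hR1 using hR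
  have hRc : ContinuousOn R (Ioc 0 1) := by
    intro a ha
    apply tendsto_order.2
    constructor
    · intro c hc
      by_cases hc0 : c < 0
      · filter_upwards [self_mem_nhdsWithin] with b hb
        exact hc0.trans_le (hR0 b hb)
      · push Not at hc0
        have h1 : Ψ (a, c) < 1 := by
          rw [← hR1 a ha]
          exact hsm a ha.1 (mem_Ici.2 hc0) (mem_Ici.2 (hR0 a ha)) hc
        have h2 : Continuous (fun b => Ψ (b, c)) := by fun_prop
        filter_upwards [self_mem_nhdsWithin, mem_nhdsWithin_of_mem_nhds (h2.continuousAt.eventually_lt_const h1)] with b hb hb2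
        by_contra hcon
        push Not at hcon
        have := hmon b (mem_Ici.2 (hR0 b hb)) (mem_Ici.2 hc0) hcon
        simp only [hR1 b hb] at this
        exact absurd hb2 (not_lt.2 this)
    · intro c hc
      have hc0 : 0 ≤ c := (hR0 a ha).trans hc.le
      have h1 : 1 < Ψ (a, c) := by
        rw [← hR1 a ha]
        exact hsm a ha.1 (mem_Ici.2 (hR0 a ha)) (mem_Ici.2 hc0) hc
      have h2 : Continuous (fun b => Ψ (b, c)) := by fun_prop
      filter_upwards [self_mem_nhdsWithin, mem_nhdsWithin_of_mem_nhds (h2.continuousAt.eventually_const_lt h1)] with b hb hb2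
      by_contra hcon
      push Not at hcon
      have := hmon b (mem_Ici.2 hc0) (mem_Ici.2 (hR0 b hb)) hcon
      simp only [hR1 b hb] at this
      exact absurd hb2 (not_lt.2 this)
  have hen : ∀ a r, 0 ≤ a → 0 ≤ r → (r ^ 2 * m (a, r)) ^ 2 ≤ 2 * B * r ^ 2 * Ψ (a, r) := by
    intro a r ha hr
    have hD : ∀ r, HasDerivAt (fun r => (2 * B * r ^ 2) * Ψ (a, r) - (r ^ 2 * m (a, r)) ^ 2)
        (((2 * B * (2 * r)) * Ψ (a, r) + 2 * B * r ^ 2 * (r * m (a, r))) -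
          2 * (r ^ 2 * m (a, r)) * (r * g (Ψ (a, r)))) r := fun r => by
      have := (((hasDerivAt_pow 2 r).const_mul (2 * B)).mul (hd a r)).sub ((hd2 a r).pow 2)
      refine this.congr_deriv ?_
      simp
    have : MonotoneOn (fun r => (2 * B * r ^ 2) * Ψ (a, r) - (r ^ 2 * m (a, r)) ^ 2) (Ici 0) := by
      apply monotoneOn_of_deriv_nonneg (convex_Ici 0)
      · exact fun x _ => (hD x).continuousAt.continuousWithinAt
      · exact fun x _ => (hD x).differentiableAt.differentiableWithinAt
      · intro x hx
        rw [interior_Ici] at hx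
        rw [(hD x).deriv]
        have hx : 0 < x := hx
        have h1 : 0 ≤ Ψ (a, x) := ha.trans (hge a x hx.le)
        have h2 := hm0 (a, x)
        have h3 : 0 ≤ B - g (Ψ (a, x)) := sub_nonneg.2 (hB _)
        have h4 : 0 ≤ B := (hnn 0).trans (hB 0)
        have : 0 ≤ 4 * B * x * Ψ (a, x) + 2 * x ^ 3 * m (a, x) * (B - g (Ψ (a, x))) := by
          positivity
        linarith
    have := this (mem_Ici.2 le_rfl) (mem_Ici.2 hr) hr
    simp only at this
    norm_num at this
    linarith
  -- small initial value
  have hB0 : 0 < B := (hpos 1 one_pos).trans_le (hB 1)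
  obtain ⟨R₀, hR₀, hR₀'⟩ : ∃ R₀ > 0, 2 * B ≤ (A / 2) ^ 2 * R₀ ^ 2 := by
    refine ⟨1 + 8 * B / A ^ 2, by positivity, ?_⟩
    have h : 0 < 8 * B / A ^ 2 := by positivity
    have h2 : (A / 2) ^ 2 * (8 * B / A ^ 2) = 2 * B := by field_simp; norm_num
    calc 2 * B = (A / 2) ^ 2 * (8 * B / A ^ 2) := h2.symm
      _ ≤ _ := by gcongr; nlinarith
  obtain ⟨a₀, ha₀, ha₀'⟩ : ∃ a₀ ∈ Ioc (0:ℝ) 1, Ψ (a₀, R₀) < 1 := by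
    have h2 : Continuous (fun b => Ψ (b, R₀)) := by fun_prop
    have h3 : Ψ (0, R₀) < 1 := by rw [hΨ0]; exact one_pos
    have h4 := mem_nhdsWithin_of_mem_nhds (t := Ioi 0) (h2.continuousAt.eventually_lt_const h3)
    have h5 : Ioc (0:ℝ) 1 ∈ nhdsWithin (0:ℝ) (Ioi 0) := Ioc_mem_nhdsGT one_pos
    obtain ⟨x, hx⟩ := Filter.nonempty_of_mem (Filter.inter_mem h4 h5)
    exact ⟨x, hx.2, hx.1⟩
  have hRa : R₀ < R a₀ := by
    by_contra hcon
    push Not at hcon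
    have := hmon a₀ (mem_Ici.2 (hR0 a₀ ha₀)) (mem_Ici.2 hR₀.le) hcon
    simp only [hR1 a₀ ha₀] at this
    linarith
  have hlo : m (a₀, R a₀) ≤ A / 2 := by
    have h1 := hen a₀ (R a₀) ha₀.1.le (hR0 a₀ ha₀)
    rw [hR1 a₀ ha₀, mul_one] at h1
    have hp : 0 < R a₀ := hR₀.trans hRa
    have h2 : R a₀ ^ 2 * m (a₀, R a₀) ^ 2 ≤ 2 * B := by
      have : 0 < R a₀ ^ 2 := by positivity
      nlinarith
    have h3 : (A / 2) ^ 2 * R₀ ^ 2 ≤ (A / 2) ^ 2 * R a₀ ^ 2 := by gcongr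
    have h4 : m (a₀, R a₀) ^ 2 ≤ (A / 2) ^ 2 := by
      have : 0 < R a₀ ^ 2 := by positivity
      nlinarith
    exact le_of_sq_le_sq h4 (by positivity)
  have hFc : ContinuousOn (fun a => m (a, R a)) (Icc a₀ 1) := by
    have : ContinuousOn R (Icc a₀ 1) := hRc.mono (fun x hx => ⟨ha₀.1.trans_le hx.1, hx.2⟩)
    exact hm.comp_continuousOn (continuousOn_id.prodMk this)
  have hi : A / 2 < m (1, R 1) := by
    have := hmlow 1 (R 1) (hR0 1 ⟨one_pos, le_rfl⟩)
    linarith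
  obtain ⟨a, ha, haA⟩ := intermediate_value_Icc ha₀.2 hFc ⟨hlo, hi.le⟩
  simp only at haA
  have ha' : a ∈ Ioc (0:ℝ) 1 := ⟨ha₀.1.trans_le ha.1, ha.2⟩
  have hRpos : 0 < R a := by
    rcases (hR0 a ha').eq_or_lt with h | h
    · exfalso
      have h1 := hR1 a ha'
      rw [← h, hinit] at h1
      rw [h1] at haA
      linarith
    · exact h
  refine ⟨R a, hRpos, fun r => Ψ (a, r), fun r => m (a, r), by fun_prop, hψc a, hd a, hd2 a, ?_,
    hR1 a ha', haA⟩
  intro r hr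
  refine ⟨ha'.1.le.trans (hge a r hr.1), ?_⟩
  rw [← hR1 a ha']
  exact hmon a (mem_Ici.2 hr.1) (mem_Ici.2 hRpos.le) hr.2

structure ScaledSol (f : ℝ → ℝ) (A R : ℝ) (w P : ℝ → ℝ) : Prop where
  hR : 0 < R
  cw : ContinuousOn w (Icc 0 1)
  cP : ContinuousOn P (Icc 0 1)
  rng : ∀ t ∈ Icc (0:ℝ) 1, 0 ≤ w t
  w1 : w 1 = 1
  P0 : P 0 = 0
  P1 : P 1 = A / 2
  dw : ∀ t ∈ Ioo (0:ℝ) 1, HasDerivAt w (R ^ 2 * P t / t) t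
  dP : ∀ t ∈ Ioo (0:ℝ) 1, HasDerivAt P (t * f (w t)) t

theorem scaled_of_stationary (f : ℝ → ℝ) (A R : ℝ) (hA : 0 < A) (h : IsStationaryRadius f A R) :
    ∃ w P, ScaledSol f A R w P := by
  obtain ⟨hR, ψ, h1, h2, hr, hode, -, hψR, hdR⟩ := h
  have hmaps : MapsTo (fun t : ℝ => R * t) (Icc 0 1) (Icc 0 R) := by
    intro t ht
    exact ⟨mul_nonneg hR.le ht.1, mul_le_of_le_one_right hR.le ht.2⟩
  have hmaps2 : MapsTo (fun t : ℝ => R * t) (Ioo 0 1) (Ioo 0 R) := by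
    intro t ht
    exact ⟨mul_pos hR ht.1, mul_lt_of_lt_one_right hR ht.2⟩
  have hc : ContinuousOn (derivWithin ψ (Icc 0 R)) (Icc 0 R) :=
    h1.continuousOn_derivWithin (uniqueDiffOn_Icc hR) le_rfl
  have hin : ∀ r ∈ Ioo 0 R, derivWithin ψ (Icc 0 R) r = deriv ψ r := fun r hr =>
    derivWithin_of_mem_nhds (Icc_mem_nhds hr.1 hr.2)
  have hd1 : ∀ r ∈ Ioo 0 R, HasDerivAt ψ (deriv ψ r) r := fun r hr =>
    ((h1.contDiffAt (Icc_mem_nhds hr.1 hr.2)).differentiableAt (by norm_num)).hasDerivAt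
  have h2' : ContDiffOn ℝ (1 + 1) ψ (Ioo 0 R) := by
    have := h2.mono Ioo_subset_Ioc_self
    norm_num
    exact this
  have hd2 : ∀ r ∈ Ioo 0 R, HasDerivAt (deriv ψ) (deriv (deriv ψ) r) r := fun r hr =>
    ((((contDiffOn_succ_iff_deriv_of_isOpen isOpen_Ioo).1 h2').2.2.contDiffAt
      (Ioo_mem_nhds hr.1 hr.2)).differentiableAt (by norm_num)).hasDerivAt
  have hlin : ∀ t : ℝ, HasDerivAt (fun t : ℝ => R * t) R t := fun t => by
    simpa using (hasDerivAt_id t).const_mul R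
  refine ⟨fun t => ψ (R * t), fun t => t * derivWithin ψ (Icc 0 R) (R * t) / R, hR, ?_, ?_, ?_, ?_,
    ?_, ?_, ?_, ?_⟩
  · exact h1.continuousOn.comp (by fun_prop) hmaps
  · have : ContinuousOn (fun t => derivWithin ψ (Icc 0 R) (R * t)) (Icc 0 1) :=
      hc.comp (by fun_prop) hmaps
    fun_prop
  · exact fun t ht => (hr _ (hmaps ht)).1
  · simpa using hψR
  · simp
  · have hne : deriv ψ R ≠ 0 := by rw [hdR]; positivity
    have := (differentiableAt_of_deriv_ne_zero hne).derivWithin (uniqueDiffOn_Icc hR R ⟨hR.le, le_rfl⟩)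
    simp only [mul_one, this, hdR]
    field_simp
  · intro t ht
    have hm := hmaps2 ht
    have := (hd1 _ hm).comp t (hlin t)
    refine this.congr_deriv ?_
    simp only [hin _ hm]
    have := ht.1.ne'
    field_simp
  · intro t ht
    have hm := hmaps2 ht
    have h3 := (((hasDerivAt_id t).mul ((hd2 _ hm).comp t (hlin t))).div_const R)
    have h4 : HasDerivAt (fun t => t * deriv ψ (R * t) / R) (t * f (ψ (R * t))) t := by
      refine h3.congr_deriv ?_
      have h5 := hode _ ⟨hm.1, hm.2.le⟩
      rw [← h5]
      simp
      have := ht.1.ne'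
      field_simp
      ring
    refine h4.congr_of_eventuallyEq ?_
    filter_upwards [Ioo_mem_nhds ht.1 ht.2] with s hs
    rw [hin _ (hmaps2 hs)]

theorem scaled_unique (f : ℝ → ℝ) (hf0 : f 0 = 0) (hf : StrictMonoOn f (Ici 0)) (A R₁ R₂ : ℝ)
    (hA : 0 < A) (w₁ P₁ w₂ P₂ : ℝ → ℝ)
    (h₁ : ScaledSol f A R₁ w₁ P₁) (h₂ : ScaledSol f A R₂ w₂ P₂) (hlt : R₁ < R₂) : False := by
  have hsq : R₁ ^ 2 < R₂ ^ 2 := by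
    have := h₁.hR
    gcongr
  have hle : ∀ t ∈ Icc (0:ℝ) 1, w₂ t ≤ w₁ t := by
    have cd : ContinuousOn (fun t => w₂ t - w₁ t) (Icc 0 1) := h₂.cw.sub h₁.cw
    obtain ⟨t₀, ht₀, hmax⟩ := isCompact_Icc.exists_isMaxOn (nonempty_Icc.2 zero_le_one) cd
    by_contra hcon
    push Not at hcon
    obtain ⟨s, hs, hs'⟩ := hcon
    have hpos : 0 < w₂ t₀ - w₁ t₀ := by
      have := hmax hs
      simp only [mem_ofPred_eq] at this
      linarith
    have ht1 : t₀ < 1 := by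
      rcases ht₀.2.eq_or_lt with h | h
      · rw [h, h₁.w1, h₂.w1] at hpos; simp at hpos
      · exact h
    have hdd : ∀ t ∈ Ioo (0:ℝ) 1, HasDerivAt (fun t => w₂ t - w₁ t)
        ((R₂ ^ 2 * P₂ t - R₁ ^ 2 * P₁ t) / t) t := fun t ht => by
      refine ((h₂.dw t ht).sub (h₁.dw t ht)).congr_deriv ?_
      ring
    have hdQ : ∀ t ∈ Ioo (0:ℝ) 1, HasDerivAt (fun t => R₂ ^ 2 * P₂ t - R₁ ^ 2 * P₁ t)
        (R₂ ^ 2 * (t * f (w₂ t)) - R₁ ^ 2 * (t * f (w₁ t))) t := fun t ht =>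
      ((h₂.dP t ht).const_mul _).sub ((h₁.dP t ht).const_mul _)
    have cQ : ContinuousOn (fun t => R₂ ^ 2 * P₂ t - R₁ ^ 2 * P₁ t) (Icc 0 1) := by
      have := h₁.cP
      have := h₂.cP
      fun_prop
    have hQ0 : R₂ ^ 2 * P₂ t₀ - R₁ ^ 2 * P₁ t₀ = 0 := by
      rcases ht₀.1.eq_or_lt with h | h
      · rw [← h, h₁.P0, h₂.P0]; simp
      · have hl := hmax.isLocalMax (Icc_mem_nhds h ht1)
        have := hl.hasDerivAt_eq_zero (hdd t₀ ⟨h, ht1⟩)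
        rcases div_eq_zero_iff.1 this with h' | h'
        · exact h'
        · exact absurd h' h.ne'
    obtain ⟨c, hc, hc'⟩ : ∃ c ∈ Ioo t₀ 1, ∀ t ∈ Icc t₀ c, 0 < w₂ t - w₁ t := by
      have h3 : ContinuousWithinAt (fun t => w₂ t - w₁ t) (Ici t₀) t₀ := by
        refine (cd t₀ ht₀).mono_of_mem_nhdsWithin ?_
        exact Filter.mem_of_superset (Icc_mem_nhdsGE ht1) (Icc_subset_Icc_left ht₀.1)
      have h4 := h3.eventually_const_lt hpos
      obtain ⟨u, hu, hu'⟩ := (mem_nhdsGE_iff_exists_Icc_subset (a := t₀)).1 h4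
      have hu : t₀ < u := hu
      refine ⟨min u ((t₀ + 1) / 2), ⟨lt_min hu (by linarith), (min_le_right _ _).trans_lt (by linarith)⟩, ?_⟩
      intro t ht
      exact hu' ⟨ht.1, ht.2.trans (min_le_left _ _)⟩
    have hsub : Icc t₀ c ⊆ Icc 0 1 := Icc_subset_Icc ht₀.1 hc.2.le
    have hsub2 : Ioo t₀ c ⊆ Ioo 0 1 := Ioo_subset_Ioo ht₀.1 hc.2.le
    have mQ : StrictMonoOn (fun t => R₂ ^ 2 * P₂ t - R₁ ^ 2 * P₁ t) (Icc t₀ c) := by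
      apply strictMonoOn_of_deriv_pos (convex_Icc _ _) (cQ.mono hsub)
      intro t ht
      rw [interior_Icc] at ht
      rw [(hdQ t (hsub2 ht)).deriv]
      have h5 := hc' t (Ioo_subset_Icc_self ht)
      have h6 := h₁.rng t (hsub (Ioo_subset_Icc_self ht))
      have h7 : f (w₁ t) < f (w₂ t) := hf (mem_Ici.2 h6) (mem_Ici.2 (by linarith)) (by linarith)
      have h8 : 0 ≤ f (w₁ t) := by
        rw [← hf0]; exact hf.monotoneOn (mem_Ici.2 le_rfl) (mem_Ici.2 h6) h6
      have h9 : 0 < t := (hsub2 ht).1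
      have h10 : R₁ ^ 2 * f (w₁ t) < R₂ ^ 2 * f (w₂ t) := by
        nlinarith [sq_nonneg R₁, sq_nonneg R₂]
      nlinarith
    have md : StrictMonoOn (fun t => w₂ t - w₁ t) (Icc t₀ c) := by
      apply strictMonoOn_of_deriv_pos (convex_Icc _ _) (cd.mono hsub)
      intro t ht
      rw [interior_Icc] at ht
      rw [(hdd t (hsub2 ht)).deriv]
      have := mQ ⟨le_rfl, hc.1.le⟩ (Ioo_subset_Icc_self ht) ht.1
      simp only [hQ0] at this
      exact div_pos this (hsub2 ht).1
    have h11 := md ⟨le_rfl, hc.1.le⟩ ⟨hc.1.le, le_rfl⟩ hc.1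
    have h12 := hmax (hsub ⟨hc.1.le, le_rfl⟩)
    simp only [mem_ofPred_eq] at h11 h12
    linarith
  have hdD : ∀ t ∈ Ioo (0:ℝ) 1, HasDerivAt (fun t => P₁ t - P₂ t)
      (t * f (w₁ t) - t * f (w₂ t)) t := fun t ht => (h₁.dP t ht).sub (h₂.dP t ht)
  have mD : MonotoneOn (fun t => P₁ t - P₂ t) (Icc 0 1) := by
    apply monotoneOn_of_deriv_nonneg (convex_Icc _ _) (h₁.cP.sub h₂.cP)
    · rw [interior_Icc]
      exact fun t ht => (hdD t ht).differentiableAt.differentiableWithinAt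
    · intro t ht
      rw [interior_Icc] at ht
      rw [show deriv (P₁ - P₂) t = _ from (hdD t ht).deriv]
      have ht' := Ioo_subset_Icc_self ht
      have := hf.monotoneOn (mem_Ici.2 (h₂.rng t ht')) (mem_Ici.2 (h₁.rng t ht')) (hle t ht')
      have h9 : 0 < t := ht.1
      nlinarith
  have hP : ∀ t ∈ Icc (0:ℝ) 1, P₁ t - P₂ t = 0 := by
    intro t ht
    have a1 := mD ⟨le_rfl, zero_le_one⟩ ht ht.1
    have a2 := mD ht ⟨zero_le_one, le_rfl⟩ ht.2
    simp only [h₁.P0, h₂.P0, h₁.P1, h₂.P1, sub_self] at a1 a2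
    exact le_antisymm a2 a1
  have hw : ∀ t ∈ Ioo (0:ℝ) 1, w₁ t = w₂ t := by
    intro t ht
    have ht' := Ioo_subset_Icc_self ht
    have h3 : HasDerivAt (fun t => P₁ t - P₂ t) 0 t := by
      refine (hasDerivAt_const t (0:ℝ)).congr_of_eventuallyEq ?_
      filter_upwards [Ioo_mem_nhds ht.1 ht.2] with s hs
      exact hP s (Ioo_subset_Icc_self hs)
    have h4 := (hdD t ht).unique h3
    rw [← mul_sub] at h4
    have h5 : f (w₁ t) = f (w₂ t) := by
      rcases mul_eq_zero.1 h4 with h | h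
      · exact absurd h ht.1.ne'
      · linarith
    exact hf.injOn (mem_Ici.2 (h₁.rng t ht')) (mem_Ici.2 (h₂.rng t ht')) h5
  have hz : ∀ t ∈ Ioo (0:ℝ) 1, P₁ t = 0 := by
    intro t ht
    have h3 : HasDerivAt w₁ (R₂ ^ 2 * P₂ t / t) t := by
      refine (h₂.dw t ht).congr_of_eventuallyEq ?_
      filter_upwards [Ioo_mem_nhds ht.1 ht.2] with s hs
      exact hw s hs
    have h4 := (h₁.dw t ht).unique h3
    have h5 := hP t (Ioo_subset_Icc_self ht)
    have h6 : P₂ t = P₁ t := by linarith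
    have h7 := ht.1.ne'
    rw [h6] at h4
    field_simp at h4
    have h8 : (R₂ ^ 2 - R₁ ^ 2) * P₁ t = 0 := by linarith
    rcases mul_eq_zero.1 h8 with h | h
    · linarith
    · exact h
  obtain ⟨c, hc, hc'⟩ := exists_hasDerivAt_eq_slope P₁ (fun t => t * f (w₁ t)) zero_lt_one h₁.cP h₁.dP
  have h3 : HasDerivAt P₁ 0 c := by
    refine (hasDerivAt_const c (0:ℝ)).congr_of_eventuallyEq ?_
    filter_upwards [Ioo_mem_nhds hc.1 hc.2] with s hs
    exact hz s hs
  have h4 := (h₁.dP c hc).unique h3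
  simp only [h₁.P0, h₁.P1] at hc'
  rw [h4] at hc'
  linarith

theorem exists_stationary (f : ℝ → ℝ) (hf : ContDiff ℝ (⊤ : ℕ∞) f) (hf0 : f 0 = 0)
    (hmono : StrictMonoOn f (Ici 0)) (A : ℝ) (hA : A ∈ Ioo 0 (f 1)) :
    ∃ R : ℝ, IsStationaryRadius f A R := by
  have hdiff : Differentiable ℝ f := hf.differentiable (by simp)
  have hdc : Continuous (deriv f) := hf.continuous_deriv (by simp)
  obtain ⟨C, hC⟩ := (isCompact_Icc (a := (0:ℝ)) (b := 1)).exists_bound_of_continuousOn hdc.continuousOn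
  have hcl : ∀ x : ℝ, max 0 (min x 1) ∈ Icc (0:ℝ) 1 := fun x =>
    ⟨le_max_left _ _, max_le zero_le_one (min_le_right _ _)⟩
  have hclm : Monotone (fun x : ℝ => max 0 (min x 1)) := fun x y h => by
    simp only
    gcongr
  have hcl1 : ∀ x y : ℝ, |max 0 (min x 1) - max 0 (min y 1)| ≤ |x - y| := by
    intro x y
    grind
  have hf1 : ∀ x y : ℝ, x ∈ Icc (0:ℝ) 1 → y ∈ Icc (0:ℝ) 1 → |f x - f y| ≤ (|C| + 1) * |x - y| := by
    intro x y hx hy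
    exact Convex.norm_image_sub_le_of_norm_deriv_le (fun z _ => hdiff z)
      (fun z hz => (hC z hz).trans (by have := le_abs_self C; linarith)) (convex_Icc 0 1) hy hx
  have hmem : ∀ x, x ∈ Icc (0:ℝ) 1 → max 0 (min x 1) = x := fun x hx => by
    rw [min_eq_left hx.2, max_eq_right hx.1]
  obtain ⟨R, hR, ψ, m, hm, hψ, hd, hd2, hrng, hψR, hmR⟩ :=
    shoot (fun x => f (max 0 (min x 1)))
    (by have := hf.continuous; fun_prop) (|C| + 1) (by positivity)
    (fun x y => (hf1 _ _ (hcl x) (hcl y)).trans (by have := hcl1 x y; gcongr)) (f 1)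
    (fun x => hmono.monotoneOn (mem_Ici.2 (hcl x).1) (mem_Ici.2 zero_le_one) (hcl x).2)
    (by simpa using hf0)
    (fun x => by
      refine hf0.symm.le.trans ?_
      exact hmono.monotoneOn (mem_Ici.2 le_rfl) (mem_Ici.2 (hcl x).1) (hcl x).1)
    (fun x y h => hmono.monotoneOn (mem_Ici.2 (hcl x).1) (mem_Ici.2 (hcl y).1) (hclm h))
    (fun x hx => by
      refine hf0.symm.le.trans_lt ?_
      exact hmono (mem_Ici.2 le_rfl) (mem_Ici.2 (hcl x).1) (lt_max_of_lt_right (lt_min hx one_pos)))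
    A hA.1 (by simpa using hA.2)
  have hder : deriv ψ = fun r => r * m r := funext fun r => (hd r).deriv
  have hdd : ∀ r, 0 < r → HasDerivAt (fun r => r * m r) (f (max 0 (min (ψ r) 1)) - m r) r := by
    intro r hr
    have h1 := (hd2 r).div (hasDerivAt_id r) hr.ne'
    have h2 : HasDerivAt (fun r => r * m r)
        ((r * f (max 0 (min (ψ r) 1)) * id r - r ^ 2 * m r * 1) / id r ^ 2) r := by
      refine h1.congr_of_eventuallyEq ?_
      filter_upwards [Ioi_mem_nhds hr] with s hs
      have hs : s ≠ 0 := (show 0 < s from hs).ne'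
      simp
      field_simp
    refine h2.congr_deriv ?_
    simp
    field_simp
  have hdψ : Differentiable ℝ ψ := fun r => (hd r).differentiableAt
  have hC1 : ContDiff ℝ 1 ψ := by
    rw [contDiff_one_iff_deriv]
    refine ⟨hdψ, ?_⟩
    rw [hder]; fun_prop
  have hC2 : ContDiffOn ℝ (1 + 1) ψ (Ioi 0) := by
    rw [contDiffOn_succ_iff_deriv_of_isOpen isOpen_Ioi]
    refine ⟨hdψ.differentiableOn, by simp, ?_⟩
    rw [hder]
    have : ContDiffOn ℝ (0 + 1) (fun r => r * m r) (Ioi 0) := by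
      rw [contDiffOn_succ_iff_deriv_of_isOpen isOpen_Ioi]
      refine ⟨fun r hr => (hdd r hr).differentiableAt.differentiableWithinAt, by simp, ?_⟩
      rw [contDiffOn_zero]
      have hfc := hf.continuous
      have : Continuous (fun r => f (max 0 (min (ψ r) 1)) - m r) := by fun_prop
      exact this.continuousOn.congr (fun r hr => (hdd r hr).deriv)
    simpa using this
  refine ⟨R, hR, ψ, hC1.contDiffOn, ?_, hrng, ?_, ?_, hψR, ?_⟩
  · have := hC2.mono (t := Ioc 0 R) (fun x hx => hx.1)
    norm_num at this
    exact this
  · intro r hr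
    rw [hder, (hdd r hr.1).deriv, hmem _ (hrng r ⟨hr.1.le, hr.2⟩)]
    have := hr.1.ne'
    field_simp
    ring
  · rw [hder]; simp
  · rw [hder]; simp only [hmR]; ring

/-- For every `A ∈ (0, f 1)` there is exactly one stationary radius `R > 0`. -/
theorem exists_unique_stationary_radius
    (f : ℝ → ℝ) (hf : ContDiff ℝ (⊤ : ℕ∞) f) (hf0 : f 0 = 0)
    (hf' : ∀ x : ℝ, 0 ≤ x → 0 < deriv f x)
    (A : ℝ) (hA : A ∈ Ioo 0 (f 1)) :
    ∃! R : ℝ, IsStationaryRadius f A R := by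
  have hmono : StrictMonoOn f (Ici 0) := by
    apply strictMonoOn_of_deriv_pos (convex_Ici 0) hf.continuous.continuousOn
    intro x hx
    rw [interior_Ici] at hx
    exact hf' x (le_of_lt hx)
  obtain ⟨R, hR⟩ := exists_stationary f hf hf0 hmono A hA
  refine ⟨R, hR, ?_⟩
  intro R' hR'
  obtain ⟨w, P, h⟩ := scaled_of_stationary f A R hA.1 hR
  obtain ⟨w', P', h'⟩ := scaled_of_stationary f A R' hA.1 hR'
  rcases lt_trichotomy R' R with hlt | heq | hlt
  · exact (scaled_unique f hf0 hmono A R' R hA.1 w' P' w P h' h hlt).elim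
  · exact heq
  · exact (scaled_unique f hf0 hmono A R R' hA.1 w P w' P' h h' hlt).elim
end

section
/- The stationary radius is strictly decreasing with respect to A: if 0 < A₁ < A₂ < f(1) and R₁, R₂ > 0 are stationary radii for A₁ and A₂ respectively, then R₂ < R₁. -/
open Set

lemma IsStationaryRadius.rescale {f : ℝ → ℝ} {A R : ℝ} (hA : 0 < A)
    (h : IsStationaryRadius f A R) :
    ∃ u q : ℝ → ℝ, ContinuousOn u (Icc 0 1) ∧ ContinuousOn q (Icc 0 1) ∧
      q 0 = 0 ∧ q 1 = A / 2 ∧ u 1 = 1 ∧ (∀ t ∈ Icc (0:ℝ) 1, 0 ≤ u t) ∧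
      (∀ t ∈ Ioo (0:ℝ) 1, HasDerivAt u (R ^ 2 * q t / t) t) ∧
      (∀ t ∈ Ioo (0:ℝ) 1, HasDerivAt q (t * f (u t)) t) := by
  obtain ⟨hR, ψ, h1, h2, hb, hode, -, hψR, hdR⟩ := h
  have hmap : MapsTo (fun t : ℝ => R * t) (Icc 0 1) (Icc 0 R) := by
    intro t ht
    exact ⟨mul_nonneg hR.le ht.1, by nlinarith [ht.2]⟩
  have hcm : ContinuousOn (fun t : ℝ => R * t) (Icc 0 1) := by fun_prop
  have hv : ContinuousOn (derivWithin ψ (Icc 0 R)) (Icc 0 R) :=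
    h1.continuousOn_derivWithin (uniqueDiffOn_Icc hR) le_rfl
  have hmapo : ∀ t ∈ Ioo (0:ℝ) 1, R * t ∈ Ioo 0 R := by
    intro t ht
    exact ⟨mul_pos hR ht.1, by nlinarith [ht.2]⟩
  have hveq : ∀ r ∈ Ioo (0:ℝ) R, derivWithin ψ (Icc 0 R) r = deriv ψ r := fun r hr =>
    derivWithin_of_mem_nhds (Icc_mem_nhds hr.1 hr.2)
  have hlin : ∀ t : ℝ, HasDerivAt (fun t : ℝ => R * t) R t := fun t => by
    simpa using (hasDerivAt_id t).const_mul R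
  refine ⟨fun t => ψ (R * t), fun t => t * derivWithin ψ (Icc 0 R) (R * t) / R,
    h1.continuousOn.comp hcm hmap, ?_, by simp, ?_, by simpa using hψR,
    fun t ht => (hb _ (hmap ht)).1, ?_, ?_⟩
  · exact (continuousOn_id.mul (hv.comp hcm hmap)).div_const R
  · have hd : DifferentiableAt ℝ ψ R := by
      apply differentiableAt_of_deriv_ne_zero
      rw [hdR]; positivity
    have : derivWithin ψ (Icc 0 R) R = deriv ψ R :=
      hd.derivWithin (uniqueDiffOn_Icc hR R ⟨hR.le, le_rfl⟩)
    simp only [mul_one, one_mul, this, hdR]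
    field_simp
  · intro t ht
    have hr := hmapo t ht
    have hd : HasDerivAt ψ (deriv ψ (R * t)) (R * t) :=
      ((h1.differentiableOn one_ne_zero).differentiableAt (Icc_mem_nhds hr.1 hr.2)).hasDerivAt
    have := HasDerivAt.comp t hd (hlin t)
    refine this.congr_deriv ?_
    have ht0 := ht.1.ne'
    simp only [hveq _ hr]
    field_simp
  · intro t ht
    have hr := hmapo t ht
    have h2' : ContDiffOn ℝ 2 ψ (Ioo 0 R) := h2.mono Ioo_subset_Ioc_self
    have hdd : ContDiffOn ℝ 1 (deriv ψ) (Ioo 0 R) :=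
      h2'.deriv_of_isOpen isOpen_Ioo (by norm_num)
    have hd : HasDerivAt (deriv ψ) (deriv (deriv ψ) (R * t)) (R * t) :=
      ((hdd.differentiableOn one_ne_zero).differentiableAt (Ioo_mem_nhds hr.1 hr.2)).hasDerivAt
    have hd' : HasDerivAt (derivWithin ψ (Icc 0 R)) (deriv (deriv ψ) (R * t)) (R * t) := by
      refine hd.congr_of_eventuallyEq ?_
      filter_upwards [Ioo_mem_nhds hr.1 hr.2] with r hr using hveq r hr
    have := ((hasDerivAt_id t).mul (HasDerivAt.comp t hd' (hlin t))).div_const R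
    refine this.congr_deriv ?_
    have ht0 := ht.1.ne'
    have ho := hode _ (Ioo_subset_Ioc_self hr)
    simp only [← ho, Function.comp, hveq _ hr, id]
    field_simp
    ring

/-- The stationary radius is strictly decreasing with respect to `A`. -/
theorem stationary_radius_strict_anti
    (f : ℝ → ℝ) (hf : ContDiff ℝ (⊤ : ℕ∞) f) (hf0 : f 0 = 0)
    (hf' : ∀ x : ℝ, 0 ≤ x → 0 < deriv f x)
    (A₁ A₂ R₁ R₂ : ℝ)
    (hA₁ : 0 < A₁) (hA₁₂ : A₁ < A₂) (hA₂ : A₂ < f 1)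
    (h₁ : IsStationaryRadius f A₁ R₁) (h₂ : IsStationaryRadius f A₂ R₂) :
    R₂ < R₁ := by
  have hmono : StrictMonoOn f (Ici 0) := by
    apply strictMonoOn_of_deriv_pos (convex_Ici 0) hf.continuous.continuousOn
    intro x hx
    rw [interior_Ici] at hx
    exact hf' x (le_of_lt hx)
  have hfnn : ∀ x, 0 ≤ x → 0 ≤ f x := fun x hx => by
    rw [← hf0]; exact hmono.monotoneOn (mem_Ici.2 le_rfl) hx hx
  have hR₁ := h₁.1
  obtain ⟨u, q, huc, hqc, hq0, hq1, hu1, hun, hud, hqd⟩ := h₁.rescale hA₁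
  obtain ⟨v, p, hvc, hpc, hp0, hp1, hv1, hvn, hvd, hpd⟩ := h₂.rescale (hA₁.trans hA₁₂)
  by_contra! hR
  have hRsq : R₁ ^ 2 ≤ R₂ ^ 2 := by gcongr
  -- comparison `v ≤ u`
  have key : ∀ t ∈ Icc (0:ℝ) 1, v t ≤ u t := by
    by_contra! hcon
    obtain ⟨s, hs, hlt⟩ := hcon
    have hwc : ContinuousOn (fun t => v t - u t) (Icc 0 1) := hvc.sub huc
    obtain ⟨a, ha, hmax⟩ := isCompact_Icc.exists_isMaxOn ⟨s, hs⟩ hwc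
    have hwa : 0 < v a - u a := by
      have : v s - u s ≤ v a - u a := hmax hs
      linarith
    have hza : R₂ ^ 2 * p a - R₁ ^ 2 * q a = 0 := by
      rcases eq_or_lt_of_le ha.1 with h0 | h0
      · rw [← h0, hp0, hq0]; ring
      · have ha1 : a < 1 := by
          refine lt_of_le_of_ne ha.2 ?_
          rintro rfl
          rw [hu1, hv1] at hwa
          linarith
        have hd := (hvd a ⟨h0, ha1⟩).sub (hud a ⟨h0, ha1⟩)
        have hz := (hmax.isLocalMax (Icc_mem_nhds h0 ha1)).hasDerivAt_eq_zero hd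
        field_simp at hz
        linarith
    have hsub1 : Icc a 1 ⊆ Icc 0 1 := Icc_subset_Icc_left ha.1
    have hK : IsCompact (Icc a 1 ∩ (fun t => v t - u t) ⁻¹' Iic 0) :=
      isCompact_Icc.of_isClosed_subset
        ((hwc.mono hsub1).preimage_isClosed_of_isClosed isClosed_Icc isClosed_Iic)
        inter_subset_left
    obtain ⟨b, hbK, hbmin⟩ := hK.exists_isLeast ⟨1, ⟨ha.2, le_rfl⟩, by simp [hu1, hv1]⟩
    have hb0 : v b - u b ≤ 0 := hbK.2
    have hab : a ≤ b := hbK.1.1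
    have hpos : ∀ t ∈ Ioo a b, u t < v t := by
      intro t ht
      by_contra! hc
      have := hbmin ⟨⟨ht.1.le, ht.2.le.trans hbK.1.2⟩, show v t - u t ≤ 0 by linarith⟩
      exact absurd ht.2 (not_lt.2 this)
    have hsub : Icc a b ⊆ Icc 0 1 := Icc_subset_Icc ha.1 hbK.1.2
    have hsubo : Ioo a b ⊆ Ioo 0 1 := Ioo_subset_Ioo ha.1 hbK.1.2
    have hzm : MonotoneOn (fun t => R₂ ^ 2 * p t - R₁ ^ 2 * q t) (Icc a b) := by
      apply monotoneOn_of_hasDerivWithinAt_nonneg (convex_Icc a b)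
        (f' := fun t => R₂ ^ 2 * (t * f (v t)) - R₁ ^ 2 * (t * f (u t)))
      · exact (((hpc.const_mul _).sub (hqc.const_mul _)).mono hsub)
      · intro t ht
        rw [interior_Icc] at ht
        exact (((hpd t (hsubo ht)).const_mul _).sub
          ((hqd t (hsubo ht)).const_mul _)).hasDerivWithinAt
      · intro t ht
        rw [interior_Icc] at ht
        have ht' := hsubo ht
        have hut := hun t (Ioo_subset_Icc_self ht')
        have hvt := hvn t (Ioo_subset_Icc_self ht')
        have hff : f (u t) ≤ f (v t) := hmono.monotoneOn hut hvt (hpos t ht).le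
        have := hfnn _ hut
        have ht0 := ht'.1
        have : R₁ ^ 2 * (t * f (u t)) ≤ R₂ ^ 2 * (t * f (v t)) := by gcongr
        linarith
    have hwm : MonotoneOn (fun t => v t - u t) (Icc a b) := by
      apply monotoneOn_of_hasDerivWithinAt_nonneg (convex_Icc a b)
        (f' := fun t => R₂ ^ 2 * p t / t - R₁ ^ 2 * q t / t)
      · exact hwc.mono hsub
      · intro t ht
        rw [interior_Icc] at ht
        exact ((hvd t (hsubo ht)).sub (hud t (hsubo ht))).hasDerivWithinAt
      · intro t ht
        rw [interior_Icc] at ht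
        have hz := hzm (left_mem_Icc.2 hab) (Ioo_subset_Icc_self ht) ht.1.le
        simp only [hza] at hz
        rw [← sub_div]
        exact div_nonneg hz (hsubo ht).1.le
    have := hwm (left_mem_Icc.2 hab) (right_mem_Icc.2 hab) hab
    simp only at this
    linarith
  have hm : MonotoneOn (fun t => q t - p t) (Icc 0 1) := by
    apply monotoneOn_of_hasDerivWithinAt_nonneg (convex_Icc 0 1)
      (f' := fun t => t * f (u t) - t * f (v t))
    · exact hqc.sub hpc
    · intro t ht
      rw [interior_Icc] at ht
      exact ((hqd t ht).sub (hpd t ht)).hasDerivWithinAt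
    · intro t ht
      rw [interior_Icc] at ht
      have ht' := Ioo_subset_Icc_self ht
      have hff : f (v t) ≤ f (u t) := hmono.monotoneOn (hvn t ht') (hun t ht') (key t ht')
      have := mul_le_mul_of_nonneg_left hff ht.1.le
      linarith
  have := hm (left_mem_Icc.2 zero_le_one) (right_mem_Icc.2 zero_le_one) zero_le_one
  simp only [hq0, hp0, hq1, hp1] at this
  linarith
end

section
/- For each integer k ≥ 0 there exists a unique continuous function u : [0,1] → ℝ satisfying the integral equation u(r) = 1 + ∫₀^r (R²/s^{2k+1}) (∫₀^s τ^{2k+1} f'(v₀(τ)) u(τ) dτ) ds for all r ∈ [0,1]; moreover u is smooth on [0,1], satisfies u(0) = 1, u'(0) = 0, and solves the singular initial value problem u''(r) + ((2k+1)/r) u'(r) = R² f'(v₀(r)) u(r) for r ∈ (0,1]. -/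
open Set intervalIntegral

/-- The weighted average `∫₀¹ xⁿ P(s x) dx`. -/
noncomputable def avg (n : ℕ) (P : ℝ → ℝ) (s : ℝ) : ℝ :=
  ∫ x in (0:ℝ)..1, x ^ n * P (s * x)

lemma avg_continuous (n : ℕ) {P : ℝ → ℝ} (hP : Continuous P) : Continuous (avg n P) := by
  unfold avg
  apply intervalIntegral.continuous_parametric_intervalIntegral_of_continuous'
  simp only [Function.uncurry_def]
  fun_prop

lemma mul_avg (n : ℕ) (P : ℝ → ℝ) (s : ℝ) :
    s ^ (n + 1) * avg n P s = ∫ τ in (0:ℝ)..s, τ ^ n * P τ := by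
  have h := intervalIntegral.mul_integral_comp_mul_left (a := 0) (b := 1)
    (f := fun τ : ℝ => τ ^ n * P τ) (c := s)
  simp only [mul_zero, mul_one] at h
  rw [← h, avg, pow_succ', mul_assoc, ← intervalIntegral.integral_const_mul]
  congr 1
  apply intervalIntegral.integral_congr
  intro x _
  simp only [mul_pow]
  ring

lemma div_avg (n : ℕ) (hn : n ≠ 0) (P : ℝ → ℝ) (c s : ℝ) :
    (c / s ^ n) * (∫ τ in (0:ℝ)..s, τ ^ n * P τ) = c * s * avg n P s := by
  rw [← mul_avg]
  rcases eq_or_ne s 0 with rfl | hs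
  · simp [hn]
  · field_simp
    ring

lemma avg_congr (n : ℕ) {P P' : ℝ → ℝ} (h : EqOn P P' (Icc 0 1)) :
    EqOn (avg n P) (avg n P') (Icc 0 1) := by
  intro s hs
  apply intervalIntegral.integral_congr
  intro x hx
  rw [uIcc_of_le zero_le_one] at hx
  simp only
  rw [h ⟨mul_nonneg hs.1 hx.1, mul_le_one₀ hs.2 hx.1 hx.2⟩]

lemma avg_hasDerivAt (n : ℕ) {P P' : ℝ → ℝ} (hP : ∀ x, HasDerivAt P (P' x) x)
    (hP' : Continuous P') (s : ℝ) : HasDerivAt (avg n P) (avg (n + 1) P' s) s := by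
  have hPc : Continuous P := continuous_iff_continuousAt.2 fun x => (hP x).continuousAt
  obtain ⟨C, hC⟩ := ((isCompact_closedBall s 1).prod
    (isCompact_Icc (a := (0:ℝ)) (b := 1))).exists_bound_of_continuousOn
    (f := fun p : ℝ × ℝ => p.2 ^ (n + 1) * P' (p.1 * p.2)) (by fun_prop)
  refine (intervalIntegral.hasDerivAt_integral_of_dominated_loc_of_deriv_le
    (F := fun s x => x ^ n * P (s * x)) (F' := fun s x => x ^ (n + 1) * P' (s * x))
    (bound := fun _ => C) (Metric.closedBall_mem_nhds s one_pos) ?_ ?_ ?_ ?_ ?_ ?_).2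
  · exact Filter.Eventually.of_forall fun x => Continuous.aestronglyMeasurable (by fun_prop)
  · exact Continuous.intervalIntegrable (by fun_prop) _ _
  · exact Continuous.aestronglyMeasurable (by fun_prop)
  · refine Filter.Eventually.of_forall fun t ht x hx => ?_
    rw [uIoc_of_le zero_le_one] at ht
    exact hC (x, t) ⟨hx, ht.1.le, ht.2⟩
  · exact intervalIntegrable_const
  · refine Filter.Eventually.of_forall fun t _ x _ => ?_
    have h1 : HasDerivAt (fun x : ℝ => x * t) t x := by
      simpa using (hasDerivAt_id x).mul_const t
    have := ((hP (x * t)).comp x h1).const_mul (t ^ n)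
    rw [show t ^ (n + 1) * P' (x * t) = t ^ n * (P' (x * t) * t) by ring]
    exact this

lemma contDiff_succ_of_hasDerivAt {m : ℕ} {F G : ℝ → ℝ} (h : ∀ x, HasDerivAt F (G x) x)
    (hG : ContDiff ℝ m G) : ContDiff ℝ ((m + 1 : ℕ) : WithTop ℕ∞) F := by
  push_cast
  rw [contDiff_succ_iff_deriv]
  refine ⟨fun x => (h x).differentiableAt, by simp, ?_⟩
  rwa [show deriv F = G from funext fun x => (h x).deriv]

lemma avg_contDiff (m : ℕ) : ∀ (n : ℕ) {P : ℝ → ℝ}, ContDiff ℝ m P → ContDiff ℝ m (avg n P) := by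
  induction m with
  | zero =>
    intro n P hP
    simp only [Nat.cast_zero, contDiff_zero] at hP ⊢
    exact avg_continuous n hP
  | succ m ih =>
    intro n P hP
    push_cast at hP
    rw [contDiff_succ_iff_deriv] at hP
    exact contDiff_succ_of_hasDerivAt
      (avg_hasDerivAt n (fun x => (hP.1 x).hasDerivAt) hP.2.2.continuous) (ih (n + 1) hP.2.2)

lemma exists_contDiff_extension (m : ℕ) : ∀ {g : ℝ → ℝ}, ContDiffOn ℝ m g (Icc 0 1) →
    ∃ G : ℝ → ℝ, ContDiff ℝ m G ∧ EqOn G g (Icc 0 1) := by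
  induction m with
  | zero =>
    intro g hg
    simp only [Nat.cast_zero, contDiffOn_zero, contDiff_zero] at hg ⊢
    refine ⟨IccExtend zero_le_one ((Icc 0 1).domRestrict g), ?_, ?_⟩
    · exact hg.domRestrict.Icc_extend'
    · intro x hx
      rw [IccExtend_of_mem _ _ hx]; rfl
  | succ m ih =>
    intro g hg
    push_cast at hg
    rw [contDiffOn_succ_iff_derivWithin (uniqueDiffOn_Icc zero_lt_one)] at hg
    obtain ⟨G, hG, hGe⟩ := ih hg.2.2
    have hd : ∀ x, HasDerivAt (fun x => g 0 + ∫ t in (0:ℝ)..x, G t) (G x) x := fun x =>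
      (hG.continuous.integral_hasStrictDerivAt 0 x).hasDerivAt.const_add _
    refine ⟨_, contDiff_succ_of_hasDerivAt hd hG, ?_⟩
    intro x hx
    have : ∫ t in (0:ℝ)..x, G t = g x - g 0 := by
      apply intervalIntegral.integral_eq_sub_of_hasDerivAt_of_le hx.1
      · exact hg.1.continuousOn.mono (Icc_subset_Icc le_rfl hx.2)
      · intro t ht
        have ht' : t ∈ Ioo (0:ℝ) 1 := ⟨ht.1, ht.2.trans_le hx.2⟩
        rw [hGe (Ioo_subset_Icc_self ht')]
        exact (hg.1 t (Ioo_subset_Icc_self ht')).hasDerivWithinAt.hasDerivAt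
          (Icc_mem_nhds ht'.1 ht'.2)
      · exact hG.continuous.intervalIntegrable _ _
    simp [this]

/-- The integral operator in regularised form. -/
noncomputable def intOp (c : ℝ) (n : ℕ) (P : ℝ → ℝ) (r : ℝ) : ℝ :=
  1 + ∫ s in (0:ℝ)..r, c * s * avg n P s

lemma intOp_hasDerivAt (c : ℝ) (n : ℕ) {P : ℝ → ℝ} (hP : Continuous P) (r : ℝ) :
    HasDerivAt (intOp c n P) (c * r * avg n P r) r := by
  have := avg_continuous n hP
  exact ((show Continuous fun s => c * s * avg n P s by fun_prop).integral_hasStrictDerivAt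
    0 r).hasDerivAt.const_add _

lemma intOp_continuous (c : ℝ) (n : ℕ) {P : ℝ → ℝ} (hP : Continuous P) :
    Continuous (intOp c n P) :=
  continuous_iff_continuousAt.2 fun x => (intOp_hasDerivAt c n hP x).continuousAt

lemma intOp_congr (c : ℝ) (n : ℕ) {P P' : ℝ → ℝ} (h : EqOn P P' (Icc 0 1)) :
    EqOn (intOp c n P) (intOp c n P') (Icc 0 1) := by
  intro r hr
  unfold intOp
  congr 1
  apply intervalIntegral.integral_congr
  intro s hs
  rw [uIcc_of_le hr.1] at hs
  simp only
  rw [avg_congr n h ⟨hs.1, hs.2.trans hr.2⟩]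

lemma intOp_contDiff (c : ℝ) (n m : ℕ) {P : ℝ → ℝ} (hP : ContDiff ℝ m P) :
    ContDiff ℝ ((m + 1 : ℕ) : WithTop ℕ∞) (intOp c n P) := by
  refine contDiff_succ_of_hasDerivAt (intOp_hasDerivAt c n hP.continuous) ?_
  have := avg_contDiff m n hP
  fun_prop

lemma intOp_ode (c : ℝ) (n : ℕ) {P : ℝ → ℝ} (hP : Continuous P) {r : ℝ} (hr : r ≠ 0) :
    deriv (deriv (intOp c n P)) r + (n / r) * deriv (intOp c n P) r = c * P r := by
  have hd : deriv (intOp c n P) = fun r => c * r * avg n P r :=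
    funext fun r => (intOp_hasDerivAt c n hP r).deriv
  have hI : HasDerivAt (fun s => ∫ τ in (0:ℝ)..s, τ ^ n * P τ) (r ^ n * P r) r :=
    ((show Continuous fun τ => τ ^ n * P τ by fun_prop).integral_hasStrictDerivAt 0 r).hasDerivAt
  have h2 := (hI.div (hasDerivAt_pow n r) (pow_ne_zero n hr)).const_mul c
  have he : (fun r => c * r * avg n P r) =ᶠ[nhds r]
      fun s => c * ((∫ τ in (0:ℝ)..s, τ ^ n * P τ) / s ^ n) := by
    filter_upwards [isOpen_ne.mem_nhds hr] with s hs
    have hs : s ≠ 0 := hs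
    rw [← mul_avg]
    field_simp
    ring
  have h3 := (h2.congr_of_eventuallyEq he).deriv
  rw [hd, h3, ← mul_avg]
  rcases n with _ | n
  · field_simp
    simp
  · simp only [Nat.add_sub_cancel]
    field_simp
    ring

/-- Regularity bootstrapping. -/
lemma bootstrap (c : ℝ) (n : ℕ) {q u : ℝ → ℝ} (hq : ContDiffOn ℝ (⊤ : ℕ∞) q (Icc 0 1))
    (hu : ContinuousOn u (Icc 0 1)) (h : EqOn u (intOp c n fun t => q t * u t) (Icc 0 1)) :
    ContDiffOn ℝ (⊤ : ℕ∞) u (Icc 0 1) := by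
  refine contDiffOn_infty.2 fun m => ?_
  induction m with
  | zero => simpa using hu
  | succ m ih =>
    obtain ⟨G, hG, hGe⟩ := exists_contDiff_extension m ((contDiffOn_infty.1 hq m).mul ih)
    refine (intOp_contDiff c n m hG).contDiffOn.congr fun x hx => ?_
    rw [h hx]
    exact intOp_congr c n (fun y hy => (hGe hy).symm) hx

lemma avg_sub_le (n : ℕ) {P P' : ℝ → ℝ} (hP : Continuous P) (hP' : Continuous P') {s C : ℝ}
    (h : ∀ x ∈ Icc (0:ℝ) 1, |P (s * x) - P' (s * x)| ≤ C) :
    |avg n P s - avg n P' s| ≤ C := by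
  unfold avg
  rw [← intervalIntegral.integral_sub
    (Continuous.intervalIntegrable (by fun_prop) _ _)
    (Continuous.intervalIntegrable (by fun_prop) _ _)]
  have := intervalIntegral.norm_integral_le_of_norm_le_const (a := (0:ℝ)) (b := 1) (C := C)
    (f := fun x => x ^ n * P (s * x) - x ^ n * P' (s * x)) ?_
  · simpa using this
  · intro x hx
    rw [uIoc_of_le zero_le_one] at hx
    have hx' : x ∈ Icc (0:ℝ) 1 := ⟨hx.1.le, hx.2⟩
    rw [← mul_sub, Real.norm_eq_abs, abs_mul, abs_of_nonneg (pow_nonneg hx'.1 n)]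
    have h1 := pow_le_one₀ (n := n) hx'.1 hx'.2
    have h2 := h x hx'
    nlinarith [abs_nonneg (P (s * x) - P' (s * x)), pow_nonneg hx'.1 n]

/-- Key contraction estimate in the exponentially weighted norm. -/
lemma intOp_sub_le (c : ℝ) (n : ℕ) (hc : 0 ≤ c) {P P' : ℝ → ℝ} (hP : Continuous P)
    (hP' : Continuous P') {B l : ℝ} (hB : 0 ≤ B) (hl : 0 < l)
    (h : ∀ t ∈ Icc (0:ℝ) 1, c * |P t - P' t| ≤ B * Real.exp (l * t)) {r : ℝ}
    (hr : r ∈ Icc (0:ℝ) 1) :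
    |intOp c n P r - intOp c n P' r| ≤ B / l * Real.exp (l * r) := by
  have c1 := avg_continuous n hP
  have c2 := avg_continuous n hP'
  unfold intOp
  rw [add_sub_add_left_eq_sub, ← intervalIntegral.integral_sub
    (Continuous.intervalIntegrable (by fun_prop) _ _)
    (Continuous.intervalIntegrable (by fun_prop) _ _)]
  have hE : ∫ s in (0:ℝ)..r, B * Real.exp (l * s) = B / l * (Real.exp (l * r) - 1) := by
    have : ∀ x ∈ uIcc 0 r, HasDerivAt (fun x => B / l * Real.exp (l * x))
        (B * Real.exp (l * x)) x := by
      intro x _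
      have h1 : HasDerivAt (fun x : ℝ => l * x) l x := by
        simpa using (hasDerivAt_id x).const_mul l
      have := (h1.exp).const_mul (B / l)
      rw [show B * Real.exp (l * x) = B / l * (Real.exp (l * x) * l) by field_simp]
      exact this
    rw [intervalIntegral.integral_eq_sub_of_hasDerivAt this
      (Continuous.intervalIntegrable (by fun_prop) _ _)]
    simp
    ring
  have := intervalIntegral.norm_integral_le_of_norm_le (a := (0:ℝ)) (b := r)
    (μ := MeasureTheory.volume)
    (f := fun s => c * s * avg n P s - c * s * avg n P' s)
    (g := fun s => B * Real.exp (l * s)) hr.1 ?_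
    (Continuous.intervalIntegrable (by fun_prop) _ _)
  · rw [hE, Real.norm_eq_abs] at this
    refine this.trans ?_
    have : 0 ≤ B / l := by positivity
    nlinarith
  · refine Filter.Eventually.of_forall fun s hs => ?_
    have hs1 : s ≤ 1 := hs.2.trans hr.2
    rcases hc.eq_or_lt with rfl | hc
    · simp; positivity
    have key : |avg n P s - avg n P' s| ≤ B * Real.exp (l * s) / c := by
      apply avg_sub_le n hP hP'
      intro x hx
      rw [le_div_iff₀ hc, mul_comm]
      refine (h (s * x) ⟨mul_nonneg hs.1.le hx.1, mul_le_one₀ hs1 hx.1 hx.2⟩).trans ?_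
      have : l * (s * x) ≤ l * s := by
        have := mul_le_of_le_one_right hs.1.le hx.2
        gcongr
      gcongr
    rw [le_div_iff₀ hc] at key
    rw [← mul_sub, Real.norm_eq_abs, abs_mul, abs_mul, abs_of_pos hc, abs_of_pos hs.1]
    have h3 : 0 ≤ c * |avg n P s - avg n P' s| := by positivity
    nlinarith

/-- Existence and uniqueness for the regularised equation. -/
lemma exists_unique_intOp (c : ℝ) (n : ℕ) (hc : 0 ≤ c) {q : ℝ → ℝ}
    (hq : ContinuousOn q (Icc 0 1)) :
    ∃ u : ℝ → ℝ, (ContinuousOn u (Icc 0 1) ∧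
      EqOn u (intOp c n fun t => q t * u t) (Icc 0 1)) ∧
      ∀ v : ℝ → ℝ, ContinuousOn v (Icc 0 1) →
        EqOn v (intOp c n fun t => q t * v t) (Icc 0 1) → EqOn v u (Icc 0 1) := by
  obtain ⟨qe, hqe, hqq⟩ := exists_contDiff_extension 0 (g := q) (by simpa using hq)
  have hqe : Continuous qe := hqe.continuous
  obtain ⟨M, hM⟩ := isCompact_Icc.exists_bound_of_continuousOn (s := Icc (0:ℝ) 1)
    hqe.continuousOn
  have hM0 : 0 ≤ M := (norm_nonneg _).trans (hM 0 ⟨le_rfl, zero_le_one⟩)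
  set B : ℝ := c * M + 1 with hBdef
  have hB : 0 < B := by positivity
  let pr : ℝ → Icc (0:ℝ) 1 := projIcc 0 1 zero_le_one
  have hpr : Continuous pr := continuous_projIcc
  have hpr' : ∀ t (ht : t ∈ Icc (0:ℝ) 1), pr t = ⟨t, ht⟩ := fun t ht => projIcc_of_mem _ ht
  let P : C(Icc (0:ℝ) 1, ℝ) → ℝ → ℝ := fun w t =>
    qe t * (Real.exp (2 * B * t) * w (pr t))
  have hP : ∀ w, Continuous (P w) := fun w => by
    have := w.continuous
    fun_prop
  let Φ : C(Icc (0:ℝ) 1, ℝ) → C(Icc (0:ℝ) 1, ℝ) := fun w =>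
    ⟨fun r => Real.exp (-(2 * B * r)) * intOp c n (P w) r, by
      have := intOp_continuous c n (hP w)
      fun_prop⟩
  have hΦ : ContractingWith (1 / 2) Φ := by
    refine ⟨by rw [← NNReal.coe_lt_coe]; norm_num, LipschitzWith.of_dist_le_mul fun w w' => ?_⟩
    rw [ContinuousMap.dist_le (by positivity)]
    intro r
    have key := intOp_sub_le c n hc (hP w) (hP w') (B := B * dist w w') (l := 2 * B)
      (by positivity) (by positivity) (fun t ht => ?_) r.2
    · change |Real.exp (-(2 * B * r)) * intOp c n (P w) r
        - Real.exp (-(2 * B * r)) * intOp c n (P w') r| ≤ _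
      rw [← mul_sub, abs_mul, abs_of_pos (Real.exp_pos _), Real.exp_neg,
        inv_mul_le_iff₀ (Real.exp_pos _)]
      refine key.trans (le_of_eq ?_)
      push_cast
      field_simp
    · have h1 : |w (pr t) - w' (pr t)| ≤ dist w w' := by
        rw [← Real.dist_eq]; exact ContinuousMap.dist_apply_le_dist (pr t)
      have h2 : |qe t| ≤ M := hM t ht
      simp only [P]
      rw [← mul_sub, ← mul_sub, abs_mul, abs_mul, abs_of_pos (Real.exp_pos _)]
      calc c * (|qe t| * (Real.exp (2 * B * t) * |w (pr t) - w' (pr t)|))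
          ≤ c * (M * (Real.exp (2 * B * t) * dist w w')) := by gcongr
        _ = (c * M) * dist w w' * Real.exp (2 * B * t) := by ring
        _ ≤ B * dist w w' * Real.exp (2 * B * t) := by
          gcongr
          linarith
  let w := ContractingWith.fixedPoint Φ hΦ
  have hw : Φ w = w := hΦ.fixedPoint_isFixedPt
  have hwc := w.continuous
  refine ⟨fun t => Real.exp (2 * B * t) * w (pr t), ⟨?_, ?_⟩, ?_⟩
  · exact Continuous.continuousOn (by fun_prop)
  · intro r hr
    have h1 : w ⟨r, hr⟩ = Real.exp (-(2 * B * r)) * intOp c n (P w) r := by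
      conv_lhs => rw [← hw]
      rfl
    have h2 : intOp c n (fun t => q t * (Real.exp (2 * B * t) * w (pr t))) r
        = intOp c n (P w) r := by
      refine intOp_congr c n (fun t ht => ?_) hr
      simp only [P]
      rw [hqq ht]
    simp only
    rw [h2, hpr' r hr, h1, ← mul_assoc, ← Real.exp_add]
    simp
  · intro v hv hve
    let z : C(Icc (0:ℝ) 1, ℝ) := ⟨fun r => Real.exp (-(2 * B * r)) * v r, by
      have := hv.domRestrict
      have h' : Continuous fun r : Icc (0:ℝ) 1 => v r := this
      exact Continuous.mul (by fun_prop) h'⟩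
    have hz : Φ z = z := by
      ext r
      change Real.exp (-(2 * B * r)) * intOp c n (P z) r = Real.exp (-(2 * B * r)) * v r
      congr 1
      rw [hve r.2]
      refine intOp_congr c n (fun t ht => ?_) r.2
      change qe t * (Real.exp (2 * B * t) * (Real.exp (-(2 * B * (pr t))) * v (pr t))) = _
      rw [hpr' t ht, hqq ht, ← mul_assoc (Real.exp _), ← Real.exp_add]
      simp
    have hzw : z = w := hΦ.fixedPoint_unique hz
    intro r hr
    simp only
    rw [← hzw, hpr' r hr]
    change v r = Real.exp (2 * B * r) * (Real.exp (-(2 * B * r)) * v r)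
    rw [← mul_assoc, ← Real.exp_add]
    simp

/-- For each `k ≥ 0` the integral equation
`u(r) = 1 + ∫₀^r (R²/s^{2k+1}) (∫₀^s τ^{2k+1} f'(v₀(τ)) u(τ) dτ) ds`
has a unique continuous solution `u` on `[0,1]`; moreover this solution is smooth on
`[0,1]`, satisfies `u(0) = 1`, `u'(0) = 0`, and solves the singular initial value problem
`u'' + ((2k+1)/r) u' = R² f'(v₀) u` on `(0,1]`. -/
theorem exists_unique_solution_integral_equation
    (R : ℝ) (hR : 0 < R)
    (f : ℝ → ℝ) (hf : ContDiff ℝ (⊤ : ℕ∞) f) (hf0 : f 0 = 0)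
    (hf' : ∀ x : ℝ, 0 ≤ x → 0 < deriv f x)
    (v₀ : ℝ → ℝ) (hv₀ : ContDiffOn ℝ (⊤ : ℕ∞) v₀ (Icc 0 1))
    (hv₀b : ∀ r ∈ Icc (0:ℝ) 1, 0 ≤ v₀ r ∧ v₀ r ≤ 1)
    (k : ℕ) :
    ∃ u : ℝ → ℝ,
      (ContinuousOn u (Icc 0 1) ∧
        ∀ r ∈ Icc (0:ℝ) 1,
          u r = 1 + ∫ s in (0:ℝ)..r,
            (R ^ 2 / s ^ (2 * k + 1)) *
              ∫ τ in (0:ℝ)..s, τ ^ (2 * k + 1) * deriv f (v₀ τ) * u τ) ∧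
      (∀ v : ℝ → ℝ,
        (ContinuousOn v (Icc 0 1) ∧
          ∀ r ∈ Icc (0:ℝ) 1,
            v r = 1 + ∫ s in (0:ℝ)..r,
              (R ^ 2 / s ^ (2 * k + 1)) *
                ∫ τ in (0:ℝ)..s, τ ^ (2 * k + 1) * deriv f (v₀ τ) * v τ) →
          EqOn v u (Icc 0 1)) ∧
      ContDiffOn ℝ (⊤ : ℕ∞) u (Icc 0 1) ∧
      u 0 = 1 ∧
      deriv u 0 = 0 ∧
      ∀ r ∈ Ioc (0:ℝ) 1,
        deriv (deriv u) r + ((2 * (k:ℝ) + 1) / r) * deriv u r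
          = R ^ 2 * deriv f (v₀ r) * u r := by
  have hderiv : ContDiff ℝ (⊤ : ℕ∞) (deriv f) := (contDiff_infty_iff_deriv.1 hf).2
  have hq : ContDiffOn ℝ (⊤ : ℕ∞) (fun t => deriv f (v₀ t)) (Icc 0 1) :=
    hderiv.comp_contDiffOn hv₀
  -- the integral equation in regularised form
  have hrw : ∀ (w : ℝ → ℝ) (r : ℝ), (1 + ∫ s in (0:ℝ)..r, (R ^ 2 / s ^ (2 * k + 1)) *
      ∫ τ in (0:ℝ)..s, τ ^ (2 * k + 1) * deriv f (v₀ τ) * w τ)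
      = intOp (R ^ 2) (2 * k + 1) (fun t => deriv f (v₀ t) * w t) r := by
    intro w r
    unfold intOp
    congr 2
    funext s
    rw [← div_avg _ (Nat.succ_ne_zero _)]
    simp only [mul_assoc]
  simp only [hrw]
  obtain ⟨u, ⟨huc, hue⟩, huniq⟩ := exists_unique_intOp (R ^ 2) (2 * k + 1) (sq_nonneg R)
    hq.continuousOn
  -- extend `u` beyond `[0,1]`
  obtain ⟨G, hG, hGe⟩ := exists_contDiff_extension 0
    (g := fun t => deriv f (v₀ t) * u t) (by
      rw [Nat.cast_zero, contDiffOn_zero]; exact hq.continuousOn.mul huc)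
  have hG : Continuous G := hG.continuous
  have hU : EqOn (intOp (R ^ 2) (2 * k + 1) G) u (Icc 0 1) := fun r hr => by
    rw [hue hr]
    exact intOp_congr _ _ hGe hr
  have hUe : EqOn (intOp (R ^ 2) (2 * k + 1) G) (intOp (R ^ 2) (2 * k + 1)
      (fun t => deriv f (v₀ t) * intOp (R ^ 2) (2 * k + 1) G t)) (Icc 0 1) := by
    refine intOp_congr _ _ fun t ht => ?_
    rw [hGe ht, hU ht]
  have hUc := (intOp_continuous (R ^ 2) (2 * k + 1) hG).continuousOn (s := Icc 0 1)
  refine ⟨intOp (R ^ 2) (2 * k + 1) G, ⟨hUc, hUe⟩, ?_, bootstrap _ _ hq hUc hUe, ?_, ?_, ?_⟩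
  · rintro v ⟨hv, hve⟩ r hr
    rw [hU hr]
    exact huniq v hv hve hr
  · simp [intOp]
  · rw [(intOp_hasDerivAt _ _ hG 0).deriv]
    simp
  · intro r hr
    have h := intOp_ode (R ^ 2) (2 * k + 1) hG hr.1.ne'
    have hr' : r ∈ Icc (0:ℝ) 1 := ⟨hr.1.le, hr.2⟩
    push_cast at h
    rw [h, hGe hr', hU hr']
    ring
end

section
/- For every integer k ≥ 0, the function u_k is strictly increasing on [0,1]; in particular u_k(r) ≥ 1 for all r ∈ [0,1] and u_k'(r) > 0 for all r ∈ (0,1]. -/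
open Set intervalIntegral

/-- Each `u_k` is strictly increasing on `[0,1]`; in particular `u_k ≥ 1` on `[0,1]`
and `u_k' > 0` on `(0,1]`. -/
theorem u_k_strictMonoOn
    (R : ℝ) (hR : 0 < R)
    (f : ℝ → ℝ) (hf : ContDiff ℝ (⊤ : ℕ∞) f) (hf0 : f 0 = 0)
    (hf' : ∀ x : ℝ, 0 ≤ x → 0 < deriv f x)
    (v₀ : ℝ → ℝ) (hv₀ : ContDiffOn ℝ (⊤ : ℕ∞) v₀ (Icc 0 1))
    (hv₀b : ∀ r ∈ Icc (0:ℝ) 1, 0 ≤ v₀ r ∧ v₀ r ≤ 1)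
    (u : ℕ → ℝ → ℝ)
    (hu_cont : ∀ k : ℕ, ContinuousOn (u k) (Icc 0 1))
    (hu_eq : ∀ k : ℕ, ∀ r ∈ Icc (0:ℝ) 1,
      u k r = 1 + ∫ s in (0:ℝ)..r, (R ^ 2 / s ^ (2 * k + 1)) *
        ∫ τ in (0:ℝ)..s, τ ^ (2 * k + 1) * deriv f (v₀ τ) * u k τ)
    (hu_uniq : ∀ k : ℕ, ∀ w : ℝ → ℝ,
      (ContinuousOn w (Icc 0 1) ∧ ∀ r ∈ Icc (0:ℝ) 1,
        w r = 1 + ∫ s in (0:ℝ)..r, (R ^ 2 / s ^ (2 * k + 1)) *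
          ∫ τ in (0:ℝ)..s, τ ^ (2 * k + 1) * deriv f (v₀ τ) * w τ) →
        EqOn w (u k) (Icc 0 1))
    (hu_smooth : ∀ k : ℕ, ContDiffOn ℝ (⊤ : ℕ∞) (u k) (Icc 0 1))
    (hu_ode : ∀ k : ℕ, ∀ r ∈ Ioc (0:ℝ) 1,
      deriv (deriv (u k)) r + ((2 * (k:ℝ) + 1) / r) * deriv (u k) r
        = R ^ 2 * deriv f (v₀ r) * u k r)
    (hu_zero : ∀ k : ℕ, u k 0 = 1) (hu_dzero : ∀ k : ℕ, deriv (u k) 0 = 0)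
    (hu_done : ∀ k : ℕ, deriv (u k) 1
      = R ^ 2 * ∫ τ in (0:ℝ)..1, τ ^ (2 * k + 1) * deriv f (v₀ τ) * u k τ)
    (k : ℕ) :
    StrictMonoOn (u k) (Icc 0 1) ∧
    (∀ r ∈ Icc (0:ℝ) 1, 1 ≤ u k r) ∧
    (∀ r ∈ Ioc (0:ℝ) 1, 0 < deriv (u k) r) := by
  have hc : ContinuousOn (fun τ : ℝ => τ ^ (2 * k + 1) * deriv f (v₀ τ) * u k τ) (Icc 0 1) := by
    have h1 : Continuous (deriv f) := hf.continuous_deriv (by exact_mod_cast le_top)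
    have h2 : ContinuousOn (fun τ : ℝ => deriv f (v₀ τ)) (Icc 0 1) :=
      h1.comp_continuousOn hv₀.continuousOn
    exact ((continuous_pow _).continuousOn.mul h2).mul (hu_cont k)
  have hfp : ∀ r ∈ Icc (0:ℝ) 1, 0 < deriv f (v₀ r) := fun r hr => hf' _ (hv₀b r hr).1
  -- if u is nonnegative on [0,r) then u r ≥ 1
  have key : ∀ r ∈ Icc (0:ℝ) 1, (∀ s ∈ Ico 0 r, 0 ≤ u k s) → 1 ≤ u k r := by
    intro r hr h
    rw [hu_eq k r hr]
    have : 0 ≤ ∫ s in (0:ℝ)..r, (R ^ 2 / s ^ (2 * k + 1)) *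
        ∫ τ in (0:ℝ)..s, τ ^ (2 * k + 1) * deriv f (v₀ τ) * u k τ := by
      rw [integral_of_le hr.1, MeasureTheory.integral_Ioc_eq_integral_Ioo]
      refine MeasureTheory.setIntegral_nonneg measurableSet_Ioo ?_
      intro s hs
      refine mul_nonneg (div_nonneg (sq_nonneg _) (pow_nonneg hs.1.le _)) ?_
      refine integral_nonneg hs.1.le ?_
      intro t ht
      refine mul_nonneg (mul_nonneg (pow_nonneg ht.1 _) ?_) ?_
      · exact (hfp t ⟨ht.1, by linarith [ht.2, hs.2, hr.2]⟩).le
      · exact h t ⟨ht.1, by linarith [ht.2, hs.2]⟩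
    linarith
  have hpos : ∀ r ∈ Icc (0:ℝ) 1, 0 < u k r := by
    by_contra! hcon
    obtain ⟨r, hr, hur⟩ := hcon
    have hcl : IsCompact (Icc (0:ℝ) 1 ∩ u k ⁻¹' Iic 0) :=
      isCompact_Icc.of_isClosed_subset
        ((hu_cont k).preimage_isClosed_of_isClosed isClosed_Icc isClosed_Iic) inter_subset_left
    obtain ⟨m, hm, hmin⟩ := hcl.exists_isLeast ⟨r, hr, hur⟩
    have h1 := key m hm.1 (by
      intro s hs
      by_contra! hneg
      have := hmin ⟨⟨hs.1, hs.2.le.trans hm.1.2⟩, hneg.le⟩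
      exact absurd hs.2 (not_lt.mpr this))
    have h2 : u k m ≤ 0 := hm.2
    linarith
  have hge : ∀ r ∈ Icc (0:ℝ) 1, 1 ≤ u k r := fun r hr =>
    key r hr (fun s hs => (hpos s ⟨hs.1, hs.2.le.trans hr.2⟩).le)
  have hd1 : 0 < deriv (u k) 1 := by
    rw [hu_done k]
    refine mul_pos (by positivity) ?_
    refine intervalIntegral_pos_of_pos_on ?_ ?_ one_pos
    · exact ContinuousOn.intervalIntegrable (by rwa [uIcc_of_le zero_le_one])
    · intro x hx
      exact mul_pos (mul_pos (pow_pos hx.1 _) (hfp x ⟨hx.1.le, hx.2.le⟩))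
        (hpos x ⟨hx.1.le, hx.2.le⟩)
  have hdw : ∀ r ∈ Ioo (0:ℝ) 1, derivWithin (u k) (Icc 0 1) r = deriv (u k) r := fun r hr =>
    derivWithin_of_mem_nhds (Icc_mem_nhds hr.1 hr.2)
  have hdc : ContinuousOn (derivWithin (u k) (Icc 0 1)) (Icc 0 1) :=
    (hu_smooth k).continuousOn_derivWithin (uniqueDiffOn_Icc one_pos) (by exact_mod_cast le_top)
  have hdd : ∀ r ∈ Ioo (0:ℝ) 1, DifferentiableAt ℝ (deriv (u k)) r := by
    intro r hr
    have h1 : ContDiffOn ℝ 2 (u k) (Ioo 0 1) :=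
      ((hu_smooth k).mono Ioo_subset_Icc_self).of_le
        (WithTop.coe_le_coe.mpr (le_top : (2 : ℕ∞) ≤ ⊤))
    have h2 : ContDiffOn ℝ 1 (deriv (u k)) (Ioo 0 1) :=
      h1.deriv_of_isOpen isOpen_Ioo (by norm_num)
    exact (h2.differentiableOn (by norm_num)).differentiableAt (Ioo_mem_nhds hr.1 hr.2)
  have hW : StrictMonoOn (fun r : ℝ => r ^ (2 * k + 1) * derivWithin (u k) (Icc 0 1) r)
      (Icc 0 1) := by
    refine strictMonoOn_of_deriv_pos (convex_Icc 0 1)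
      ((continuous_pow _).continuousOn.mul hdc) ?_
    intro r hr
    rw [interior_Icc] at hr
    have he : (fun r : ℝ => r ^ (2 * k + 1) * derivWithin (u k) (Icc 0 1) r)
        =ᶠ[nhds r] fun r : ℝ => r ^ (2 * k + 1) * deriv (u k) r := by
      filter_upwards [Ioo_mem_nhds hr.1 hr.2] with x hx
      rw [hdw x hx]
    rw [he.deriv_eq]
    have hD := (hasDerivAt_pow (2 * k + 1) r).mul (hdd r hr).hasDerivAt
    have hD' := hD.deriv
    have hode := hu_ode k r ⟨hr.1, hr.2.le⟩
    have hrI : r ∈ Icc (0:ℝ) 1 := ⟨hr.1.le, hr.2.le⟩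
    have hr0 : r ≠ 0 := hr.1.ne'
    have : deriv (fun r : ℝ => r ^ (2 * k + 1) * deriv (u k) r) r
        = r ^ (2 * k + 1) * (R ^ 2 * deriv f (v₀ r) * u k r) := by
      refine hD'.trans ?_
      rw [← hode]
      push_cast
      have hn : 2 * k + 1 - 1 = 2 * k := by omega
      try rw [hn]
      field_simp
      ring
    rw [this]
    exact mul_pos (pow_pos hr.1 _) (mul_pos (mul_pos (by positivity) (hfp r hrI)) (hpos r hrI))
  have hdpos : ∀ r ∈ Ioo (0:ℝ) 1, 0 < deriv (u k) r := by
    intro r hr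
    have h := hW (left_mem_Icc.mpr zero_le_one) ⟨hr.1.le, hr.2.le⟩ hr.1
    simp only [hdw r hr] at h
    rw [zero_pow (by omega), zero_mul] at h
    exact (pos_iff_pos_of_mul_pos h).mp (pow_pos hr.1 _)
  refine ⟨?_, hge, ?_⟩
  · refine strictMonoOn_of_deriv_pos (convex_Icc 0 1) (hu_cont k) ?_
    intro r hr
    rw [interior_Icc] at hr
    exact hdpos r hr
  · intro r hr
    rcases hr.2.eq_or_lt with h | h
    · rw [h]; exact hd1
    · exact hdpos r ⟨hr.1, h⟩
end

section
/- For every integer k ≥ 0, u_{k+1}(t) ≤ u_k(t) for all t ∈ [0,1]; in particular u_{k+1}(1) ≤ u_k(1). -/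
open Set intervalIntegral

lemma pos_of_step (w : ℝ → ℝ) (hw : ContinuousOn w (Icc 0 1)) (h0 : 0 < w 0)
    (h : ∀ r ∈ Icc (0:ℝ) 1, (∀ s ∈ Icc (0:ℝ) r, 0 ≤ w s) → 0 < w r) :
    ∀ r ∈ Icc (0:ℝ) 1, 0 < w r := by
  by_contra! hc
  obtain ⟨r, hr, hwr⟩ := hc
  have hcl : IsCompact (Icc (0:ℝ) 1 ∩ w ⁻¹' (Iic 0)) :=
    isCompact_Icc.of_isClosed_subset (hw.preimage_isClosed_of_isClosed isClosed_Icc isClosed_Iic)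
      inter_subset_left
  obtain ⟨t, ⟨ht, hwt⟩, hmin⟩ := hcl.exists_isLeast ⟨r, hr, hwr⟩
  have hlt : ∀ s ∈ Icc (0:ℝ) 1, s < t → 0 < w s := by
    intro s hs hst
    by_contra! hn
    exact absurd (hmin ⟨hs, hn⟩) (not_le.2 hst)
  have hwt' : w t ≤ 0 := hwt
  have h0t : 0 ≤ w t := by
    by_contra! hneg
    obtain ⟨c, hc, hc0⟩ := intermediate_value_Icc' ht.1
      (hw.mono (Icc_subset_Icc le_rfl ht.2)) (show (0:ℝ) ∈ Icc (w t) (w 0) from ⟨hneg.le, h0.le⟩)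
    rcases hc.2.lt_or_eq with h1 | h1
    · have := hlt c ⟨hc.1, hc.2.trans ht.2⟩ h1
      linarith
    · rw [h1] at hc0
      linarith
  have := h t ht (by
    intro s hs
    rcases hs.2.lt_or_eq with h1 | h1
    · exact (hlt s ⟨hs.1, hs.2.trans ht.2⟩ h1).le
    · rw [h1]; exact h0t)
  linarith

lemma inner_integrable (R : ℝ) (n : ℕ) (a : ℝ → ℝ) (ha : ContinuousOn a (Icc 0 1))
    (w : ℝ → ℝ) (hw : ContinuousOn w (Icc 0 1)) (r : ℝ) (hr : r ∈ Icc (0:ℝ) 1) :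
    IntervalIntegrable (fun s => (R ^ 2 / s ^ n) * ∫ τ in (0:ℝ)..s, τ ^ n * a τ * w τ)
      MeasureTheory.volume 0 r := by
  have hg : ContinuousOn (fun τ : ℝ => τ ^ n * a τ * w τ) (Icc 0 1) :=
    ((continuous_pow n).continuousOn.mul ha).mul hw
  obtain ⟨M, hM⟩ := isCompact_Icc.exists_bound_of_continuousOn (ha.mul hw)
  have hM0 : 0 ≤ M := (norm_nonneg _).trans (hM 0 ⟨le_rfl, zero_le_one⟩)
  have hsub : Ioc (0:ℝ) r ⊆ Icc 0 1 := fun x hx => ⟨hx.1.le, hx.2.trans hr.2⟩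
  rw [intervalIntegrable_iff_integrableOn_Ioc_of_le hr.1]
  refine MeasureTheory.IntegrableOn.of_bound (C := R ^ 2 * M) ?_ ?_ ?_
  · simp
  · apply ContinuousOn.aestronglyMeasurable _ measurableSet_Ioc
    apply ContinuousOn.mul
    · apply ContinuousOn.div continuousOn_const (continuous_pow n).continuousOn
      intro x hx
      exact pow_ne_zero _ hx.1.ne'
    · have := intervalIntegral.continuousOn_primitive_interval
        (μ := MeasureTheory.volume) (a := (0:ℝ)) (b := 1)
        (f := fun τ : ℝ => τ ^ n * a τ * w τ)
        (by rw [uIcc_of_le zero_le_one]; exact hg.integrableOn_Icc)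
      rw [uIcc_of_le zero_le_one] at this
      exact this.mono hsub
  · filter_upwards [MeasureTheory.ae_restrict_mem measurableSet_Ioc] with s hs
    have hs1 : s ≤ 1 := hs.2.trans hr.2
    have hsp : 0 < s ^ n := pow_pos hs.1 n
    have hb : ‖∫ τ in (0:ℝ)..s, τ ^ n * a τ * w τ‖ ≤ (s ^ n * M) * |s - 0| := by
      apply intervalIntegral.norm_integral_le_of_norm_le_const
      intro τ hτ
      rw [uIoc_of_le hs.1.le] at hτ
      rw [mul_assoc, norm_mul]
      apply mul_le_mul _ (hM τ ⟨hτ.1.le, hτ.2.trans hs1⟩) (norm_nonneg _) hsp.le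
      rw [norm_pow, Real.norm_of_nonneg hτ.1.le]
      exact pow_le_pow_left₀ hτ.1.le hτ.2 n
    rw [sub_zero, abs_of_pos hs.1] at hb
    rw [norm_mul, Real.norm_of_nonneg (by positivity)]
    calc R ^ 2 / s ^ n * ‖∫ τ in (0:ℝ)..s, τ ^ n * a τ * w τ‖
        ≤ R ^ 2 / s ^ n * (s ^ n * M * s) := by gcongr
      _ = R ^ 2 * M * s := by field_simp
      _ ≤ R ^ 2 * M := mul_le_of_le_one_right (by positivity) hs1

/-- The sequence `(u_k)` is pointwise nonincreasing in `k` on `[0,1]`;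
in particular `u_{k+1}(1) ≤ u_k(1)`. -/
theorem u_succ_le_u
    (R : ℝ) (hR : 0 < R)
    (f : ℝ → ℝ) (hf : ContDiff ℝ (⊤ : ℕ∞) f) (hf0 : f 0 = 0)
    (hf' : ∀ x : ℝ, 0 ≤ x → 0 < deriv f x)
    (v₀ : ℝ → ℝ) (hv₀ : ContDiffOn ℝ (⊤ : ℕ∞) v₀ (Icc 0 1))
    (hv₀b : ∀ r ∈ Icc (0:ℝ) 1, 0 ≤ v₀ r ∧ v₀ r ≤ 1)
    (u : ℕ → ℝ → ℝ)
    (hu_cont : ∀ k : ℕ, ContinuousOn (u k) (Icc 0 1))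
    (hu_eq : ∀ k : ℕ, ∀ r ∈ Icc (0:ℝ) 1,
      u k r = 1 + ∫ s in (0:ℝ)..r, (R ^ 2 / s ^ (2 * k + 1)) *
        ∫ τ in (0:ℝ)..s, τ ^ (2 * k + 1) * deriv f (v₀ τ) * u k τ)
    (hu_uniq : ∀ k : ℕ, ∀ w : ℝ → ℝ,
      (ContinuousOn w (Icc 0 1) ∧ ∀ r ∈ Icc (0:ℝ) 1,
        w r = 1 + ∫ s in (0:ℝ)..r, (R ^ 2 / s ^ (2 * k + 1)) *
          ∫ τ in (0:ℝ)..s, τ ^ (2 * k + 1) * deriv f (v₀ τ) * w τ) →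
        EqOn w (u k) (Icc 0 1))
    (hu_smooth : ∀ k : ℕ, ContDiffOn ℝ (⊤ : ℕ∞) (u k) (Icc 0 1))
    (hu_ode : ∀ k : ℕ, ∀ r ∈ Ioc (0:ℝ) 1,
      deriv (deriv (u k)) r + ((2 * (k:ℝ) + 1) / r) * deriv (u k) r
        = R ^ 2 * deriv f (v₀ r) * u k r)
    (hu_zero : ∀ k : ℕ, u k 0 = 1) (hu_dzero : ∀ k : ℕ, deriv (u k) 0 = 0)
    (hu_done : ∀ k : ℕ, deriv (u k) 1
      = R ^ 2 * ∫ τ in (0:ℝ)..1, τ ^ (2 * k + 1) * deriv f (v₀ τ) * u k τ)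
    (k : ℕ) :
    (∀ t ∈ Icc (0:ℝ) 1, u (k + 1) t ≤ u k t) ∧ u (k + 1) 1 ≤ u k 1 := by
  set a : ℝ → ℝ := fun τ => deriv f (v₀ τ) with ha_def
  have ha : ContinuousOn a (Icc 0 1) :=
    (hf.continuous_deriv (by simp)).comp_continuousOn hv₀.continuousOn
  have ha0 : ∀ τ ∈ Icc (0:ℝ) 1, 0 ≤ a τ := fun τ hτ => (hf' _ (hv₀b τ hτ).1).le
  have hpos : ∀ k : ℕ, ∀ r ∈ Icc (0:ℝ) 1, 0 < u k r := by
    intro k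
    apply pos_of_step _ (hu_cont k) (by rw [hu_zero]; norm_num)
    intro r hr h
    rw [hu_eq k r hr]
    have : 0 ≤ ∫ s in (0:ℝ)..r, (R ^ 2 / s ^ (2 * k + 1)) *
        ∫ τ in (0:ℝ)..s, τ ^ (2 * k + 1) * deriv f (v₀ τ) * u k τ := by
      apply intervalIntegral.integral_nonneg hr.1
      intro s hs
      apply mul_nonneg (div_nonneg (sq_nonneg R) (pow_nonneg hs.1 _))
      apply intervalIntegral.integral_nonneg hs.1
      intro τ hτ
      exact mul_nonneg (mul_nonneg (pow_nonneg hτ.1 _)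
        (ha0 τ ⟨hτ.1, hτ.2.trans (hs.2.trans hr.2)⟩)) (h τ ⟨hτ.1, hτ.2.trans hs.2⟩)
    linarith
  have key : ∀ ε : ℝ, 0 < ε → ∀ r ∈ Icc (0:ℝ) 1, 0 < (1 + ε) * u k r - u (k + 1) r := by
    intro ε hε
    apply pos_of_step (fun r => (1 + ε) * u k r - u (k + 1) r)
      ((continuousOn_const.mul (hu_cont k)).sub (hu_cont (k + 1)))
    · simp only [hu_zero]; linarith
    intro r hr h
    have hint : ∀ k : ℕ, IntervalIntegrable (fun s => (R ^ 2 / s ^ (2 * k + 1)) *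
        ∫ τ in (0:ℝ)..s, τ ^ (2 * k + 1) * a τ * u k τ) MeasureTheory.volume 0 r := fun k =>
      inner_integrable R (2 * k + 1) a ha (u k) (hu_cont k) r hr
    have hle : (∫ s in (0:ℝ)..r, (R ^ 2 / s ^ (2 * (k + 1) + 1)) *
        ∫ τ in (0:ℝ)..s, τ ^ (2 * (k + 1) + 1) * a τ * u (k + 1) τ) ≤
        ∫ s in (0:ℝ)..r, (1 + ε) * ((R ^ 2 / s ^ (2 * k + 1)) *
        ∫ τ in (0:ℝ)..s, τ ^ (2 * k + 1) * a τ * u k τ) := by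
      apply intervalIntegral.integral_mono_on_of_le_Ioo hr.1 (hint (k + 1))
        ((hint k).const_mul _)
      intro s hs
      have hs0 : 0 < s := hs.1
      have hs1 : s ≤ 1 := hs.2.le.trans hr.2
      have hci : ∀ (n k : ℕ), IntervalIntegrable (fun τ : ℝ => τ ^ n * a τ * u k τ)
          MeasureTheory.volume 0 s := by
        intro n k
        apply ContinuousOn.intervalIntegrable
        rw [uIcc_of_le hs0.le]
        exact (((continuous_pow n).continuousOn.mul ha).mul (hu_cont k)).mono
          (Icc_subset_Icc le_rfl hs1)
      have hin : (∫ τ in (0:ℝ)..s, τ ^ (2 * (k + 1) + 1) * a τ * u (k + 1) τ) ≤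
          ∫ τ in (0:ℝ)..s, (s ^ 2 * (1 + ε)) * (τ ^ (2 * k + 1) * a τ * u k τ) := by
        apply intervalIntegral.integral_mono_on hs0.le (hci _ _) ((hci _ _).const_mul _)
        intro τ hτ
        have hτ1 : τ ∈ Icc (0:ℝ) 1 := ⟨hτ.1, hτ.2.trans hs1⟩
        have h1 : u (k + 1) τ ≤ (1 + ε) * u k τ := by
          have := h τ ⟨hτ.1, hτ.2.trans hs.2.le⟩
          linarith
        have h2 : τ ^ 2 ≤ s ^ 2 := pow_le_pow_left₀ hτ.1 hτ.2 2
        have h3 : 0 ≤ τ ^ (2 * k + 1) * a τ := mul_nonneg (pow_nonneg hτ.1 _) (ha0 τ hτ1)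
        calc τ ^ (2 * (k + 1) + 1) * a τ * u (k + 1) τ
            = (τ ^ (2 * k + 1) * a τ) * (τ ^ 2 * u (k + 1) τ) := by ring
          _ ≤ (τ ^ (2 * k + 1) * a τ) * (s ^ 2 * ((1 + ε) * u k τ)) :=
            mul_le_mul_of_nonneg_left
              (mul_le_mul h2 h1 (hpos _ _ hτ1).le (sq_nonneg s)) h3
          _ = _ := by ring
      rw [intervalIntegral.integral_const_mul] at hin
      calc _ ≤ (R ^ 2 / s ^ (2 * (k + 1) + 1)) * ((s ^ 2 * (1 + ε)) *
            ∫ τ in (0:ℝ)..s, τ ^ (2 * k + 1) * a τ * u k τ) :=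
            mul_le_mul_of_nonneg_left hin (by positivity)
        _ = _ := by
          have : s ^ (2 * (k + 1) + 1) = s ^ (2 * k + 1) * s ^ 2 := by ring
          rw [this]
          field_simp
    rw [intervalIntegral.integral_const_mul] at hle
    have e1 := hu_eq k r hr
    have e2 := hu_eq (k + 1) r hr
    simp only [ha_def] at hle
    rw [e1, e2]
    linarith
  have main : ∀ t ∈ Icc (0:ℝ) 1, u (k + 1) t ≤ u k t := by
    intro t ht
    by_contra! hlt
    have hp := hpos k t ht
    have := key ((u (k + 1) t - u k t) / u k t) (div_pos (by linarith) hp) t ht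
    rw [add_mul, div_mul_cancel₀ _ hp.ne'] at this
    linarith
  exact ⟨main, main 1 ⟨zero_le_one, le_rfl⟩⟩
end

section
/- For every integer k ≥ 0, the difference function v := u_{k+1} − u_k is nonincreasing on [0,1]; equivalently, for every t ∈ [0,1] the minimum of v over [0,t] is attained at t, i.e. v(t) = min_{s ∈ [0,t]} v(s). -/
open Set intervalIntegral


lemma aux_mono (T : ℝ) (g g' : ℝ → ℝ) (hc : ContinuousOn g (Icc 0 T))
    (hd : ∀ x ∈ Ioo (0:ℝ) T, HasDerivAt g (g' x) x)
    (h : ∀ x ∈ Ioo (0:ℝ) T, 0 ≤ g' x) : MonotoneOn g (Icc 0 T) := by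
  apply monotoneOn_of_deriv_nonneg (convex_Icc 0 T) hc
  · rw [interior_Icc]
    exact fun x hx => (hd x hx).differentiableAt.differentiableWithinAt
  · rw [interior_Icc]
    intro x hx
    rw [(hd x hx).deriv]
    exact h x hx

lemma aux_anti (T : ℝ) (g g' : ℝ → ℝ) (hc : ContinuousOn g (Icc 0 T))
    (hd : ∀ x ∈ Ioo (0:ℝ) T, HasDerivAt g (g' x) x)
    (h : ∀ x ∈ Ioo (0:ℝ) T, g' x ≤ 0) : AntitoneOn g (Icc 0 T) := by
  apply antitoneOn_of_deriv_nonpos (convex_Icc 0 T) hc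
  · rw [interior_Icc]
    exact fun x hx => (hd x hx).differentiableAt.differentiableWithinAt
  · rw [interior_Icc]
    intro x hx
    rw [(hd x hx).deriv]
    exact h x hx

/-- Derivative of `r ^ (n+1) * g r`. -/
lemma aux_pow (n : ℕ) (g : ℝ → ℝ) (e x : ℝ) (hx : 0 < x) (hg : HasDerivAt g e x) :
    HasDerivAt (fun r => r ^ (n + 1) * g r) (x ^ (n + 1) * (e + (n + 1) / x * g x)) x := by
  have h := (hasDerivAt_pow (n + 1) x).mul hg
  refine h.congr_deriv ?_
  rw [Nat.add_sub_cancel]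
  push_cast
  field_simp
  ring

/-- On an initial interval where `y ≥ 0`, the derivative is nonnegative. -/
lemma aux_deriv_nonneg (n : ℕ) (T : ℝ) (y D E q : ℝ → ℝ)
    (hDc : ContinuousOn D (Icc 0 T))
    (hD : ∀ x ∈ Ioo (0:ℝ) T, HasDerivAt D (E x) x)
    (ode : ∀ x ∈ Ioo (0:ℝ) T, E x + (n + 1) / x * D x = q x * y x)
    (hq : ∀ x ∈ Ioo (0:ℝ) T, 0 < q x)
    (hy : ∀ x ∈ Ioo (0:ℝ) T, 0 ≤ y x) : ∀ x ∈ Ioo (0:ℝ) T, 0 ≤ D x := by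
  intro x hx
  have hm := aux_mono T (fun r => r ^ (n + 1) * D r)
    (fun x => x ^ (n + 1) * (E x + (n + 1) / x * D x))
    ((continuousOn_id.pow _).mul hDc)
    (fun x hx => aux_pow n D (E x) x hx.1 (hD x hx))
    (fun x hx => by
      simp only [ode x hx]
      exact mul_nonneg (pow_nonneg hx.1.le _) (mul_nonneg (hq x hx).le (hy x hx)))
  have h := hm (left_mem_Icc.2 (hx.1.trans hx.2).le) (Ioo_subset_Icc_self hx) hx.1.le
  simp only [ne_eq, Nat.succ_ne_zero, not_false_eq_true, zero_pow, zero_mul] at h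
  exact nonneg_of_mul_nonneg_right h (pow_pos hx.1 _)

lemma aux_pos (n : ℕ) (y D E q : ℝ → ℝ)
    (hyc : ContinuousOn y (Icc 0 1)) (hy0 : y 0 = 1)
    (hDc : ContinuousOn D (Icc 0 1))
    (hy : ∀ x ∈ Ioo (0:ℝ) 1, HasDerivAt y (D x) x)
    (hD : ∀ x ∈ Ioo (0:ℝ) 1, HasDerivAt D (E x) x)
    (ode : ∀ x ∈ Ioo (0:ℝ) 1, E x + (n + 1) / x * D x = q x * y x)
    (hq : ∀ x ∈ Ioo (0:ℝ) 1, 0 < q x) : ∀ x ∈ Icc (0:ℝ) 1, 0 < y x := by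
  by_contra! hcon
  obtain ⟨t, ht, hyt⟩ := hcon
  have hcl : IsClosed (Icc (0:ℝ) 1 ∩ y ⁻¹' Iic 0) :=
    hyc.preimage_isClosed_of_isClosed isClosed_Icc isClosed_Iic
  have hcomp : IsCompact (Icc (0:ℝ) 1 ∩ y ⁻¹' Iic 0) :=
    isCompact_Icc.of_isClosed_subset hcl inter_subset_left
  obtain ⟨T, ⟨hT, hyT⟩, hleast⟩ := hcomp.exists_isLeast ⟨t, ht, hyt⟩
  have hyT' : y T ≤ 0 := hyT
  have hsub : ∀ x ∈ Ioo (0:ℝ) T, x ∈ Ioo (0:ℝ) 1 := fun x hx => ⟨hx.1, hx.2.trans_le hT.2⟩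
  have hsubI : Icc (0:ℝ) T ⊆ Icc 0 1 := Icc_subset_Icc_right hT.2
  have hpos : ∀ x ∈ Ioo (0:ℝ) T, 0 ≤ y x := by
    intro x hx
    by_contra! hlt
    exact absurd (hleast ⟨Ioo_subset_Icc_self (hsub x hx), hlt.le⟩) (not_le.2 hx.2)
  have hDn := aux_deriv_nonneg n T y D E q (hDc.mono hsubI) (fun x hx => hD x (hsub x hx))
    (fun x hx => ode x (hsub x hx)) (fun x hx => hq x (hsub x hx)) hpos
  have hm := aux_mono T y D (hyc.mono hsubI) (fun x hx => hy x (hsub x hx)) hDn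
  have := hm (left_mem_Icc.2 hT.1) (right_mem_Icc.2 hT.1) hT.1
  linarith

lemma aux_main (n : ℕ) (q y D E z F G : ℝ → ℝ)
    (hyc : ContinuousOn y (Icc 0 1)) (hy0 : y 0 = 1)
    (hDc : ContinuousOn D (Icc 0 1))
    (hy : ∀ x ∈ Ioo (0:ℝ) 1, HasDerivAt y (D x) x)
    (hD : ∀ x ∈ Ioo (0:ℝ) 1, HasDerivAt D (E x) x)
    (ode : ∀ x ∈ Ioo (0:ℝ) 1, E x + (n + 1) / x * D x = q x * y x)
    (hzc : ContinuousOn z (Icc 0 1)) (hz0 : z 0 = 1)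
    (hFc : ContinuousOn F (Icc 0 1))
    (hz : ∀ x ∈ Ioo (0:ℝ) 1, HasDerivAt z (F x) x)
    (hF : ∀ x ∈ Ioo (0:ℝ) 1, HasDerivAt F (G x) x)
    (odez : ∀ x ∈ Ioo (0:ℝ) 1, G x + ((n + 2 : ℕ) + 1) / x * F x = q x * z x)
    (hq : ∀ x ∈ Ioo (0:ℝ) 1, 0 < q x) :
    AntitoneOn (fun t => z t - y t) (Icc 0 1) := by
  have ypos := aux_pos n y D E q hyc hy0 hDc hy hD ode hq
  have zpos := aux_pos (n + 2) z F G q hzc hz0 hFc hz hF odez hq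
  have hDn := aux_deriv_nonneg n 1 y D E q hDc hD ode hq
    (fun x hx => (ypos x (Ioo_subset_Icc_self hx)).le)
  -- the equation for the difference
  have odev : ∀ x ∈ Ioo (0:ℝ) 1, (G x - E x) + ((n + 2 : ℕ) + 1) / x * (F x - D x)
      = q x * (z x - y x) - 2 / x * D x := by
    intro x hx
    have h1 := ode x hx
    have h2 := odez x hx
    push_cast at h2 ⊢
    have : ((n:ℝ) + 2 + 1) / x = (n + 1) / x + 2 / x := by ring
    rw [this] at h2 ⊢
    linear_combination h2 - h1
  -- Wronskian
  have hW := aux_anti 1 (fun r => r ^ (n + 2 + 1) * ((F r - D r) * z r - (z r - y r) * F r))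
    (fun x => x ^ (n + 2 + 1) * (-(2 / x * D x * z x)))
    ((continuousOn_id.pow _).mul (((hFc.sub hDc).mul hzc).sub ((hzc.sub hyc).mul hFc)))
    (by
      intro x hx
      have h := aux_pow (n + 2) (fun r => (F r - D r) * z r - (z r - y r) * F r) _ x hx.1
        ((((hF x hx).sub (hD x hx)).mul (hz x hx)).sub
          (((hz x hx).sub (hy x hx)).mul (hF x hx)))
      convert h using 1
      congr 1
      simp only [Pi.sub_apply]
      have h1 := odev x hx
      have h2 := odez x hx
      linear_combination (-z x) * h1 + (z x - y x) * h2)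
    (by
      intro x hx
      have h1 := hDn x hx
      have h2 := zpos x (Ioo_subset_Icc_self hx)
      have h3 := hx.1
      have : 0 ≤ x ^ (n + 2 + 1) * (2 / x * D x * z x) := by positivity
      linarith)
  have hW' : ∀ x ∈ Ioo (0:ℝ) 1, (F x - D x) * z x - (z x - y x) * F x ≤ 0 := by
    intro x hx
    have h := hW (left_mem_Icc.2 zero_le_one) (Ioo_subset_Icc_self hx) hx.1.le
    simp only [ne_eq, Nat.succ_ne_zero, not_false_eq_true, zero_pow, zero_mul] at h
    exact nonpos_of_mul_nonpos_right h (pow_pos hx.1 _)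
  have hQ := aux_anti 1 (fun r => (z r - y r) / z r)
    (fun x => ((F x - D x) * z x - (z x - y x) * F x) / z x ^ 2)
    ((hzc.sub hyc).div hzc (fun x hx => (zpos x hx).ne'))
    (fun x hx => ((hz x hx).sub (hy x hx)).div (hz x hx)
      (zpos x (Ioo_subset_Icc_self hx)).ne')
    (fun x hx => div_nonpos_of_nonpos_of_nonneg (hW' x hx) (sq_nonneg _))
  have hv : ∀ x ∈ Ioo (0:ℝ) 1, z x - y x ≤ 0 := by
    intro x hx
    have h := hQ (left_mem_Icc.2 zero_le_one) (Ioo_subset_Icc_self hx) hx.1.le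
    simp only [hy0, hz0, sub_self, zero_div] at h
    have h2 := zpos x (Ioo_subset_Icc_self hx)
    rw [div_le_iff₀ h2] at h
    linarith
  have hP := aux_anti 1 (fun r => r ^ (n + 2 + 1) * (F r - D r))
    (fun x => x ^ (n + 2 + 1) * ((G x - E x) + ((n + 2 : ℕ) + 1) / x * (F x - D x)))
    ((continuousOn_id.pow _).mul (hFc.sub hDc))
    (fun x hx => aux_pow (n + 2) (fun r => F r - D r) _ x hx.1 ((hF x hx).sub (hD x hx)))
    (by
      intro x hx
      simp only [odev x hx]
      have h1 := hDn x hx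
      have h3 := hx.1
      have h4 : 0 ≤ 2 / x * D x := by positivity
      have h5 := mul_nonpos_of_nonneg_of_nonpos (hq x hx).le (hv x hx)
      exact mul_nonpos_of_nonneg_of_nonpos (pow_nonneg h3.le _) (by linarith))
  refine aux_anti 1 _ (fun x => F x - D x) (hzc.sub hyc)
    (fun x hx => (hz x hx).sub (hy x hx)) ?_
  intro x hx
  have h := hP (left_mem_Icc.2 zero_le_one) (Ioo_subset_Icc_self hx) hx.1.le
  simp only [ne_eq, Nat.succ_ne_zero, not_false_eq_true, zero_pow, zero_mul] at h
  exact nonpos_of_mul_nonpos_right h (pow_pos hx.1 _)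

/-- A smooth function on `[0,1]` has a continuous extension of its derivative, which is
differentiable inside. -/
lemma aux_smooth (y : ℝ → ℝ) (h : ContDiffOn ℝ (⊤ : ℕ∞) y (Icc 0 1)) :
    ContinuousOn (derivWithin y (Icc 0 1)) (Icc 0 1) ∧
    (∀ x ∈ Ioo (0:ℝ) 1, derivWithin y (Icc 0 1) x = deriv y x) ∧
    (∀ x ∈ Ioo (0:ℝ) 1, HasDerivAt y (derivWithin y (Icc 0 1) x) x) ∧
    (∀ x ∈ Ioo (0:ℝ) 1, HasDerivAt (derivWithin y (Icc 0 1)) (deriv (deriv y) x) x) := by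
  have hc := h.continuousOn_derivWithin (uniqueDiffOn_Icc zero_lt_one) (by simp)
  have he : ∀ x ∈ Ioo (0:ℝ) 1, derivWithin y (Icc 0 1) x = deriv y x :=
    fun x hx => derivWithin_of_mem_nhds (Icc_mem_nhds hx.1 hx.2)
  refine ⟨hc, he, ?_, ?_⟩
  · intro x hx
    rw [he x hx]
    exact ((h.differentiableOn (by simp)).differentiableAt
      (Icc_mem_nhds hx.1 hx.2)).hasDerivAt
  · intro x hx
    have h2 : ContDiffOn ℝ 1 (derivWithin y (Icc 0 1)) (Icc 0 1) :=
      h.derivWithin (uniqueDiffOn_Icc zero_lt_one) (by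
        rw [one_add_one_eq_two]; exact WithTop.coe_le_coe.2 (le_top : (2 : ℕ∞) ≤ ⊤))
    have h3 := ((h2.differentiableOn (by simp)).differentiableAt
      (Icc_mem_nhds hx.1 hx.2)).hasDerivAt
    have h4 : derivWithin y (Icc 0 1) =ᶠ[nhds x] deriv y :=
      Filter.eventually_of_mem (isOpen_Ioo.mem_nhds hx) he
    rwa [h4.deriv_eq] at h3

/-- The difference `v := u_{k+1} − u_k` is nonincreasing on `[0,1]`; equivalently,
for every `t ∈ [0,1]` the minimum of `v` over `[0,t]` is attained at `t`. -/
theorem u_succ_sub_u_antitoneOn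
    (R : ℝ) (hR : 0 < R)
    (f : ℝ → ℝ) (hf : ContDiff ℝ (⊤ : ℕ∞) f) (hf0 : f 0 = 0)
    (hf' : ∀ x : ℝ, 0 ≤ x → 0 < deriv f x)
    (v₀ : ℝ → ℝ) (hv₀ : ContDiffOn ℝ (⊤ : ℕ∞) v₀ (Icc 0 1))
    (hv₀b : ∀ r ∈ Icc (0:ℝ) 1, 0 ≤ v₀ r ∧ v₀ r ≤ 1)
    (u : ℕ → ℝ → ℝ)
    (hu_cont : ∀ k : ℕ, ContinuousOn (u k) (Icc 0 1))
    (hu_eq : ∀ k : ℕ, ∀ r ∈ Icc (0:ℝ) 1,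
      u k r = 1 + ∫ s in (0:ℝ)..r, (R ^ 2 / s ^ (2 * k + 1)) *
        ∫ τ in (0:ℝ)..s, τ ^ (2 * k + 1) * deriv f (v₀ τ) * u k τ)
    (hu_uniq : ∀ k : ℕ, ∀ w : ℝ → ℝ,
      (ContinuousOn w (Icc 0 1) ∧ ∀ r ∈ Icc (0:ℝ) 1,
        w r = 1 + ∫ s in (0:ℝ)..r, (R ^ 2 / s ^ (2 * k + 1)) *
          ∫ τ in (0:ℝ)..s, τ ^ (2 * k + 1) * deriv f (v₀ τ) * w τ) →
        EqOn w (u k) (Icc 0 1))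
    (hu_smooth : ∀ k : ℕ, ContDiffOn ℝ (⊤ : ℕ∞) (u k) (Icc 0 1))
    (hu_ode : ∀ k : ℕ, ∀ r ∈ Ioc (0:ℝ) 1,
      deriv (deriv (u k)) r + ((2 * (k:ℝ) + 1) / r) * deriv (u k) r
        = R ^ 2 * deriv f (v₀ r) * u k r)
    (hu_zero : ∀ k : ℕ, u k 0 = 1) (hu_dzero : ∀ k : ℕ, deriv (u k) 0 = 0)
    (hu_done : ∀ k : ℕ, deriv (u k) 1
      = R ^ 2 * ∫ τ in (0:ℝ)..1, τ ^ (2 * k + 1) * deriv f (v₀ τ) * u k τ)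
    (k : ℕ) :
    AntitoneOn (fun t => u (k + 1) t - u k t) (Icc 0 1) ∧
    (∀ t ∈ Icc (0:ℝ) 1, ∀ s ∈ Icc (0:ℝ) t,
      u (k + 1) t - u k t ≤ u (k + 1) s - u k s) := by
  have key : AntitoneOn (fun t => u (k + 1) t - u k t) (Icc 0 1) := by
    obtain ⟨a1, a2, a3, a4⟩ := aux_smooth _ (hu_smooth k)
    obtain ⟨b1, b2, b3, b4⟩ := aux_smooth _ (hu_smooth (k + 1))
    refine aux_main (2 * k) (fun r => R ^ 2 * deriv f (v₀ r)) (u k) _ _ (u (k + 1)) _ _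
      (hu_cont k) (hu_zero k) a1 a3 a4 ?_ (hu_cont (k + 1)) (hu_zero (k + 1)) b1 b3 b4 ?_ ?_
    · intro x hx
      have h := hu_ode k x (Ioo_subset_Ioc_self hx)
      rw [a2 x hx, ← h]
      push_cast
      ring
    · intro x hx
      have h := hu_ode (k + 1) x (Ioo_subset_Ioc_self hx)
      rw [b2 x hx, ← h]
      push_cast
      ring
    · intro x hx
      exact mul_pos (pow_pos hR 2) (hf' _ (hv₀b x (Ioo_subset_Icc_self hx)).1)
  refine ⟨key, fun t ht s hs => ?_⟩
  exact key ⟨hs.1, hs.2.trans ht.2⟩ ht hs.2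
end

section
/- For every integer k ≥ 0, the limit lim_{t→0⁺} u_k'(t)/t exists and equals R² f'(v₀(0)) / (2k+2). Consequently, for every k ≥ 0, lim_{t→0⁺} (u_{k+1}'(t) − u_k'(t))/t = R² f'(v₀(0)) (1/(2k+4) − 1/(2k+2)) = −R² f'(v₀(0)) · 2/((2k+4)(2k+2)) < 0. -/
open Set Filter intervalIntegral

/-- A function smooth on `[0,1]` that satisfies the singular radial ODE on `(0,1)` has
`u'(t)/t → h(0)/(2k+2)`. -/
theorem radial_limit (k : ℕ) (w h : ℝ → ℝ) (hw : ContDiffOn ℝ (⊤ : ℕ∞) w (Icc 0 1))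
    (hh : ContinuousOn h (Icc 0 1))
    (hode : ∀ r ∈ Ioc (0:ℝ) 1,
      deriv (deriv w) r + ((2 * (k:ℝ) + 1) / r) * deriv w r = h r) :
    Tendsto (fun t => deriv w t / t) (nhdsWithin 0 (Ioi 0))
        (nhds (h 0 / (2 * (k:ℝ) + 2))) := by
  have hU : UniqueDiffOn ℝ (Icc (0:ℝ) 1) := uniqueDiffOn_Icc zero_lt_one
  have h0 : (0:ℝ) ∈ Icc (0:ℝ) 1 := by simp
  set g := derivWithin w (Icc 0 1) with hg
  have hgs : ContDiffOn ℝ 1 g (Icc 0 1) := by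
    refine hw.derivWithin hU ?_
    have h2 : (((2:ℕ∞) : WithTop ℕ∞)) ≤ ((⊤ : ℕ∞) : WithTop ℕ∞) := WithTop.coe_le_coe.2 le_top
    have h3 : (1:WithTop ℕ∞) + 1 = ((2:ℕ∞) : WithTop ℕ∞) := by
      rw [one_add_one_eq_two]
      rfl
    exact h3.le.trans h2
  set q := derivWithin g (Icc 0 1) with hq
  have hqc : ContinuousOn q (Icc 0 1) := hgs.continuousOn_derivWithin hU le_rfl
  have hle : nhdsWithin (0:ℝ) (Ioi 0) ≤ nhdsWithin 0 (Icc 0 1) := by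
    rw [← nhdsWithin_Ioc_eq_nhdsGT (zero_lt_one' ℝ)]
    exact nhdsWithin_mono _ Ioc_subset_Icc_self
  have hev : ∀ᶠ t in nhdsWithin (0:ℝ) (Ioi 0), t ∈ Ioo (0:ℝ) 1 :=
    Ioo_mem_nhdsGT zero_lt_one
  have e1 : ∀ t ∈ Ioo (0:ℝ) 1, deriv w t = g t := fun t ht =>
    (derivWithin_of_mem_nhds (Icc_mem_nhds ht.1 ht.2)).symm
  have e2 : ∀ t ∈ Ioo (0:ℝ) 1, deriv (deriv w) t = q t := by
    intro t ht
    have : deriv w =ᶠ[nhds t] g := by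
      filter_upwards [Ioo_mem_nhds ht.1 ht.2] with s hs using e1 s hs
    rw [this.deriv_eq]
    exact (derivWithin_of_mem_nhds (Icc_mem_nhds ht.1 ht.2)).symm
  have tg : Tendsto g (nhdsWithin 0 (Ioi 0)) (nhds (g 0)) :=
    (hgs.continuousOn 0 h0).tendsto.mono_left hle
  have tq : Tendsto q (nhdsWithin 0 (Ioi 0)) (nhds (q 0)) := (hqc 0 h0).tendsto.mono_left hle
  have th : Tendsto h (nhdsWithin 0 (Ioi 0)) (nhds (h 0)) := (hh 0 h0).tendsto.mono_left hle
  have ti : Tendsto (fun t : ℝ => t) (nhdsWithin 0 (Ioi 0)) (nhds 0) :=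
    tendsto_id.mono_left nhdsWithin_le_nhds
  have hk : (0:ℝ) ≤ k := Nat.cast_nonneg k
  have g0 : g 0 = 0 := by
    have t1 : Tendsto (fun t => t * (h t - q t)) (nhdsWithin 0 (Ioi 0))
        (nhds ((2 * (k:ℝ) + 1) * g 0)) := by
      refine (tg.const_mul (2 * (k:ℝ) + 1)).congr' ?_
      filter_upwards [hev] with t ht
      have := hode t ⟨ht.1, ht.2.le⟩
      rw [e1 t ht, e2 t ht] at this
      have ht0 : t ≠ 0 := ht.1.ne'
      rw [← this]
      field_simp
      ring
    have := tendsto_nhds_unique t1 (ti.mul (th.sub tq))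
    rw [zero_mul] at this
    rcases mul_eq_zero.1 this with h | h
    · linarith
    · exact h
  have tgt : Tendsto (fun t => g t / t) (nhdsWithin 0 (Ioi 0)) (nhds (q 0)) := by
    have hd : HasDerivWithinAt g (q 0) (Icc 0 1) 0 :=
      ((hgs.differentiableOn one_ne_zero) 0 h0).hasDerivWithinAt
    have hd' : HasDerivWithinAt g (q 0) (Ioc 0 1) 0 := hd.mono Ioc_subset_Icc_self
    rw [hasDerivWithinAt_iff_tendsto_slope' (by simp),
      nhdsWithin_Ioc_eq_nhdsGT (zero_lt_one' ℝ)] at hd'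
    refine hd'.congr fun t => ?_
    simp [slope_def_field, g0]
  have key : q 0 + (2 * (k:ℝ) + 1) * q 0 = h 0 := by
    refine tendsto_nhds_unique ((tq.add (tgt.const_mul (2 * (k:ℝ) + 1))).congr' ?_) th
    filter_upwards [hev] with t ht
    have := hode t ⟨ht.1, ht.2.le⟩
    rw [e1 t ht, e2 t ht] at this
    rw [← this]
    ring
  have hq0 : h 0 / (2 * (k:ℝ) + 2) = q 0 := by
    rw [← key]
    field_simp
    ring
  rw [hq0]
  refine tgt.congr' ?_
  filter_upwards [hev] with t ht
  rw [e1 t ht]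

/-- For every `k ≥ 0`, `lim_{t→0⁺} u_k'(t)/t = R² f'(v₀(0))/(2k+2)`; consequently
`lim_{t→0⁺} (u_{k+1}'(t) − u_k'(t))/t = R² f'(v₀(0)) (1/(2k+4) − 1/(2k+2))`, and this
limit equals `−R² f'(v₀(0))·2/((2k+4)(2k+2))`, which is negative. -/
theorem tendsto_deriv_u_div_self
    (R : ℝ) (hR : 0 < R)
    (f : ℝ → ℝ) (hf : ContDiff ℝ (⊤ : ℕ∞) f) (hf0 : f 0 = 0)
    (hf' : ∀ x : ℝ, 0 ≤ x → 0 < deriv f x)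
    (v₀ : ℝ → ℝ) (hv₀ : ContDiffOn ℝ (⊤ : ℕ∞) v₀ (Icc 0 1))
    (hv₀b : ∀ r ∈ Icc (0:ℝ) 1, 0 ≤ v₀ r ∧ v₀ r ≤ 1)
    (u : ℕ → ℝ → ℝ)
    (hu_cont : ∀ k : ℕ, ContinuousOn (u k) (Icc 0 1))
    (hu_eq : ∀ k : ℕ, ∀ r ∈ Icc (0:ℝ) 1,
      u k r = 1 + ∫ s in (0:ℝ)..r, (R ^ 2 / s ^ (2 * k + 1)) *
        ∫ τ in (0:ℝ)..s, τ ^ (2 * k + 1) * deriv f (v₀ τ) * u k τ)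
    (hu_uniq : ∀ k : ℕ, ∀ w : ℝ → ℝ,
      (ContinuousOn w (Icc 0 1) ∧ ∀ r ∈ Icc (0:ℝ) 1,
        w r = 1 + ∫ s in (0:ℝ)..r, (R ^ 2 / s ^ (2 * k + 1)) *
          ∫ τ in (0:ℝ)..s, τ ^ (2 * k + 1) * deriv f (v₀ τ) * w τ) →
        EqOn w (u k) (Icc 0 1))
    (hu_smooth : ∀ k : ℕ, ContDiffOn ℝ (⊤ : ℕ∞) (u k) (Icc 0 1))
    (hu_ode : ∀ k : ℕ, ∀ r ∈ Ioc (0:ℝ) 1,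
      deriv (deriv (u k)) r + ((2 * (k:ℝ) + 1) / r) * deriv (u k) r
        = R ^ 2 * deriv f (v₀ r) * u k r)
    (hu_zero : ∀ k : ℕ, u k 0 = 1) (hu_dzero : ∀ k : ℕ, deriv (u k) 0 = 0)
    (hu_done : ∀ k : ℕ, deriv (u k) 1
      = R ^ 2 * ∫ τ in (0:ℝ)..1, τ ^ (2 * k + 1) * deriv f (v₀ τ) * u k τ)
    :
    (∀ k : ℕ,
      Tendsto (fun t => deriv (u k) t / t) (nhdsWithin 0 (Ioi 0))
        (nhds (R ^ 2 * deriv f (v₀ 0) / (2 * (k:ℝ) + 2)))) ∧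
    (∀ k : ℕ,
      Tendsto (fun t => (deriv (u (k + 1)) t - deriv (u k) t) / t)
        (nhdsWithin 0 (Ioi 0))
        (nhds (R ^ 2 * deriv f (v₀ 0) *
          (1 / (2 * (k:ℝ) + 4) - 1 / (2 * (k:ℝ) + 2)))) ∧
      R ^ 2 * deriv f (v₀ 0) * (1 / (2 * (k:ℝ) + 4) - 1 / (2 * (k:ℝ) + 2))
        = -(R ^ 2 * deriv f (v₀ 0) * 2 / ((2 * (k:ℝ) + 4) * (2 * (k:ℝ) + 2))) ∧
      R ^ 2 * deriv f (v₀ 0) * (1 / (2 * (k:ℝ) + 4) - 1 / (2 * (k:ℝ) + 2)) < 0) := by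
  have h0 : (0:ℝ) ∈ Icc (0:ℝ) 1 := by simp
  have main : ∀ k : ℕ,
      Tendsto (fun t => deriv (u k) t / t) (nhdsWithin 0 (Ioi 0))
        (nhds (R ^ 2 * deriv f (v₀ 0) / (2 * (k:ℝ) + 2))) := by
    intro k
    have hc : Continuous (deriv f) := hf.continuous_deriv (by exact_mod_cast le_top)
    have := radial_limit k (u k) (fun r => R ^ 2 * deriv f (v₀ r) * u k r) (hu_smooth k)
      ((continuousOn_const.mul (hc.comp_continuousOn hv₀.continuousOn)).mul (hu_cont k))
      (hu_ode k)
    simpa [hu_zero k] using this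
  refine ⟨main, fun k => ?_⟩
  have hk : (0:ℝ) ≤ k := Nat.cast_nonneg k
  have heq : R ^ 2 * deriv f (v₀ 0) * (1 / (2 * (k:ℝ) + 4) - 1 / (2 * (k:ℝ) + 2))
        = -(R ^ 2 * deriv f (v₀ 0) * 2 / ((2 * (k:ℝ) + 4) * (2 * (k:ℝ) + 2))) := by
    field_simp
    ring
  refine ⟨?_, heq, ?_⟩
  · have t := (main (k + 1)).sub (main k)
    have e : R ^ 2 * deriv f (v₀ 0) / (2 * ((k + 1 : ℕ):ℝ) + 2)
        - R ^ 2 * deriv f (v₀ 0) / (2 * (k:ℝ) + 2)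
        = R ^ 2 * deriv f (v₀ 0) * (1 / (2 * (k:ℝ) + 4) - 1 / (2 * (k:ℝ) + 2)) := by
      push_cast
      rw [show 2 * ((k:ℝ) + 1) + 2 = 2 * (k:ℝ) + 4 by ring]
      ring
    rw [e] at t
    exact t.congr fun x => (sub_div _ _ _).symm
  · rw [heq]
    have := hf' (v₀ 0) (hv₀b 0 h0).1
    rw [neg_lt_zero]
    positivity
end

section
/- The sequence of quotients u_k'(1)/u_k(1) tends to 0 as k → ∞. -/
open Set Filter intervalIntegral

/-- The quotients `u_k'(1)/u_k(1)` tend to `0` as `k → ∞`. -/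
theorem tendsto_deriv_u_one_div_u_one
    (R : ℝ) (hR : 0 < R)
    (f : ℝ → ℝ) (hf : ContDiff ℝ (⊤ : ℕ∞) f) (hf0 : f 0 = 0)
    (hf' : ∀ x : ℝ, 0 ≤ x → 0 < deriv f x)
    (v₀ : ℝ → ℝ) (hv₀ : ContDiffOn ℝ (⊤ : ℕ∞) v₀ (Icc 0 1))
    (hv₀b : ∀ r ∈ Icc (0:ℝ) 1, 0 ≤ v₀ r ∧ v₀ r ≤ 1)
    (u : ℕ → ℝ → ℝ)
    (hu_cont : ∀ k : ℕ, ContinuousOn (u k) (Icc 0 1))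
    (hu_eq : ∀ k : ℕ, ∀ r ∈ Icc (0:ℝ) 1,
      u k r = 1 + ∫ s in (0:ℝ)..r, (R ^ 2 / s ^ (2 * k + 1)) *
        ∫ τ in (0:ℝ)..s, τ ^ (2 * k + 1) * deriv f (v₀ τ) * u k τ)
    (hu_uniq : ∀ k : ℕ, ∀ w : ℝ → ℝ,
      (ContinuousOn w (Icc 0 1) ∧ ∀ r ∈ Icc (0:ℝ) 1,
        w r = 1 + ∫ s in (0:ℝ)..r, (R ^ 2 / s ^ (2 * k + 1)) *
          ∫ τ in (0:ℝ)..s, τ ^ (2 * k + 1) * deriv f (v₀ τ) * w τ) →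
        EqOn w (u k) (Icc 0 1))
    (hu_smooth : ∀ k : ℕ, ContDiffOn ℝ (⊤ : ℕ∞) (u k) (Icc 0 1))
    (hu_ode : ∀ k : ℕ, ∀ r ∈ Ioc (0:ℝ) 1,
      deriv (deriv (u k)) r + ((2 * (k:ℝ) + 1) / r) * deriv (u k) r
        = R ^ 2 * deriv f (v₀ r) * u k r)
    (hu_zero : ∀ k : ℕ, u k 0 = 1) (hu_dzero : ∀ k : ℕ, deriv (u k) 0 = 0)
    (hu_done : ∀ k : ℕ, deriv (u k) 1
      = R ^ 2 * ∫ τ in (0:ℝ)..1, τ ^ (2 * k + 1) * deriv f (v₀ τ) * u k τ)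
    :
    Tendsto (fun k : ℕ => deriv (u k) 1 / u k 1) atTop (nhds 0) := by
  -- bound on the coefficient
  have hqc : ContinuousOn (fun r => deriv f (v₀ r)) (Icc 0 1) :=
    (hf.continuous_deriv (by simp)).comp_continuousOn hv₀.continuousOn
  obtain ⟨M, hM⟩ := isCompact_Icc.exists_bound_of_continuousOn hqc
  have hM0 : 0 ≤ M := (norm_nonneg _).trans (hM 0 (by simp))
  -- inner integral bound
  have inner : ∀ k : ℕ, ∀ m : ℝ, (∀ r ∈ Icc (0:ℝ) 1, |u k r| ≤ m) → ∀ s ∈ Icc (0:ℝ) 1,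
      |∫ τ in (0:ℝ)..s, τ ^ (2 * k + 1) * deriv f (v₀ τ) * u k τ|
        ≤ M * m * (s ^ (2 * k + 2) / (2 * k + 2)) := by
    intro k m hm s hs
    have h := intervalIntegral.norm_integral_le_of_norm_le
      (f := fun τ => τ ^ (2 * k + 1) * deriv f (v₀ τ) * u k τ)
      (g := fun τ : ℝ => M * m * τ ^ (2 * k + 1)) (μ := MeasureTheory.volume) hs.1
      (Eventually.of_forall (fun t ht => by
        have ht' : t ∈ Icc (0:ℝ) 1 := ⟨ht.1.le, ht.2.trans hs.2⟩
        have h1 := hM t ht'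
        have h2 := hm t ht'
        have h3 : 0 ≤ t ^ (2 * k + 1) := pow_nonneg ht'.1 _
        rw [Real.norm_eq_abs] at h1
        rw [Real.norm_eq_abs, abs_mul, abs_mul, abs_of_nonneg h3]
        have h4 := mul_le_mul h1 h2 (abs_nonneg _) hM0
        calc _ = t ^ (2 * k + 1) * (|deriv f (v₀ t)| * |u k t|) := by ring
          _ ≤ t ^ (2 * k + 1) * (M * m) := mul_le_mul_of_nonneg_left h4 h3
          _ = _ := by ring))
      (Continuous.intervalIntegrable (by fun_prop) _ _)
    rw [Real.norm_eq_abs, intervalIntegral.integral_const_mul, integral_pow] at h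
    refine h.trans (le_of_eq ?_)
    push_cast
    rw [zero_pow (by omega)]
    ring
  set c : ℕ → ℝ := fun k => R ^ 2 * M / (2 * k + 2) with hc
  have hc0 : ∀ k, 0 ≤ c k := fun k => by simp only [hc]; positivity
  have hclim : Tendsto c atTop (nhds 0) := by
    apply Tendsto.div_atTop tendsto_const_nhds
    apply tendsto_atTop_add_const_right
    exact tendsto_natCast_atTop_atTop.const_mul_atTop (by norm_num)
  have main : ∀ᶠ k in atTop, ‖deriv (u k) 1 / u k 1‖ ≤ 2 * c k := by
    filter_upwards [hclim.eventually (gt_mem_nhds (show (0:ℝ) < 1/4 by norm_num))] with k hk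
    obtain ⟨x, hx, hmax⟩ := isCompact_Icc.exists_isMaxOn (nonempty_Icc.2 zero_le_one)
      (hu_cont k).abs
    set m := |u k x| with hmdef
    have hm : ∀ r ∈ Icc (0:ℝ) 1, |u k r| ≤ m := fun r hr => hmax hr
    have hm0 : 0 ≤ m := abs_nonneg _
    have key : ∀ r ∈ Icc (0:ℝ) 1, |u k r - 1| ≤ c k * m := by
      intro r hr
      rw [hu_eq k r hr, add_sub_cancel_left]
      have h := intervalIntegral.norm_integral_le_of_norm_le_const (a := 0) (b := r) (C := c k * m)
        (f := fun s => (R ^ 2 / s ^ (2 * k + 1)) *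
          ∫ τ in (0:ℝ)..s, τ ^ (2 * k + 1) * deriv f (v₀ τ) * u k τ) (by
          intro s hs
          rw [uIoc_of_le hr.1] at hs
          have hs0 : 0 < s := hs.1
          have hs1 : s ≤ 1 := hs.2.trans hr.2
          have h1 := inner k m hm s ⟨hs0.le, hs1⟩
          have h2 : 0 ≤ R ^ 2 / s ^ (2 * k + 1) := by positivity
          rw [Real.norm_eq_abs, abs_mul, abs_of_nonneg h2]
          calc _ ≤ R ^ 2 / s ^ (2 * k + 1) * (M * m * (s ^ (2 * k + 2) / (2 * k + 2))) :=
                mul_le_mul_of_nonneg_left h1 h2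
            _ = c k * m * s := by
                simp only [hc]
                field_simp
                ring
            _ ≤ c k * m * 1 := mul_le_mul_of_nonneg_left hs1 (mul_nonneg (hc0 k) hm0)
            _ = _ := mul_one _)
      rw [Real.norm_eq_abs] at h
      refine h.trans ?_
      rw [sub_zero, abs_of_nonneg hr.1]
      exact mul_le_of_le_one_right (mul_nonneg (hc0 k) hm0) hr.2
    have hcm : c k * m ≤ 1 / 4 * m := mul_le_mul_of_nonneg_right hk.le hm0
    have hm43 : m ≤ 4 / 3 := by
      have h1 := key x hx
      have h2 := abs_sub_abs_le_abs_sub (u k x) 1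
      rw [abs_one] at h2
      linarith
    have hu1 : 2 / 3 ≤ u k 1 := by
      have h1 := (abs_le.1 (key 1 (by simp))).1
      linarith
    have hd : |deriv (u k) 1| ≤ c k * m := by
      rw [hu_done k, abs_mul, abs_of_nonneg (sq_nonneg R)]
      refine (mul_le_mul_of_nonneg_left (inner k m hm 1 (by simp)) (sq_nonneg R)).trans
        (le_of_eq ?_)
      simp only [hc, one_pow]
      ring
    rw [Real.norm_eq_abs, abs_div, abs_of_pos (show 0 < u k 1 by linarith),
      div_le_iff₀ (by linarith)]
    nlinarith [hc0 k, mul_le_mul_of_nonneg_left hm43 (hc0 k), mul_le_mul_of_nonneg_left hu1 (hc0 k)]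
  exact squeeze_zero_norm' main (by simpa using hclim.const_mul 2)
end

section
/- The sequence k·(u_k'(1) − u_{k+1}'(1)) tends to 0 as k → ∞. -/
open Set Filter intervalIntegral

/-- The sequence `k·(u_k'(1) − u_{k+1}'(1))` tends to `0` as `k → ∞`. -/
theorem tendsto_mul_deriv_u_one_sub
    (R : ℝ) (hR : 0 < R)
    (f : ℝ → ℝ) (hf : ContDiff ℝ (⊤ : ℕ∞) f) (hf0 : f 0 = 0)
    (hf' : ∀ x : ℝ, 0 ≤ x → 0 < deriv f x)
    (v₀ : ℝ → ℝ) (hv₀ : ContDiffOn ℝ (⊤ : ℕ∞) v₀ (Icc 0 1))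
    (hv₀b : ∀ r ∈ Icc (0:ℝ) 1, 0 ≤ v₀ r ∧ v₀ r ≤ 1)
    (u : ℕ → ℝ → ℝ)
    (hu_cont : ∀ k : ℕ, ContinuousOn (u k) (Icc 0 1))
    (hu_eq : ∀ k : ℕ, ∀ r ∈ Icc (0:ℝ) 1,
      u k r = 1 + ∫ s in (0:ℝ)..r, (R ^ 2 / s ^ (2 * k + 1)) *
        ∫ τ in (0:ℝ)..s, τ ^ (2 * k + 1) * deriv f (v₀ τ) * u k τ)
    (hu_uniq : ∀ k : ℕ, ∀ w : ℝ → ℝ,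
      (ContinuousOn w (Icc 0 1) ∧ ∀ r ∈ Icc (0:ℝ) 1,
        w r = 1 + ∫ s in (0:ℝ)..r, (R ^ 2 / s ^ (2 * k + 1)) *
          ∫ τ in (0:ℝ)..s, τ ^ (2 * k + 1) * deriv f (v₀ τ) * w τ) →
        EqOn w (u k) (Icc 0 1))
    (hu_smooth : ∀ k : ℕ, ContDiffOn ℝ (⊤ : ℕ∞) (u k) (Icc 0 1))
    (hu_ode : ∀ k : ℕ, ∀ r ∈ Ioc (0:ℝ) 1,
      deriv (deriv (u k)) r + ((2 * (k:ℝ) + 1) / r) * deriv (u k) r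
        = R ^ 2 * deriv f (v₀ r) * u k r)
    (hu_zero : ∀ k : ℕ, u k 0 = 1) (hu_dzero : ∀ k : ℕ, deriv (u k) 0 = 0)
    (hu_done : ∀ k : ℕ, deriv (u k) 1
      = R ^ 2 * ∫ τ in (0:ℝ)..1, τ ^ (2 * k + 1) * deriv f (v₀ τ) * u k τ)
    :
    Tendsto (fun k : ℕ => (k:ℝ) * (deriv (u k) 1 - deriv (u (k + 1)) 1))
      atTop (nhds 0) := by
  have hfc : Continuous (deriv f) := hf.continuous_deriv (by simp)
  obtain ⟨M₀, hM₀⟩ := (isCompact_Icc (a := (0:ℝ)) (b := 1)).exists_bound_of_continuousOn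
    hfc.continuousOn
  obtain ⟨M, hM0, hM⟩ : ∃ M : ℝ, 0 ≤ M ∧ ∀ τ ∈ Icc (0:ℝ) 1, |deriv f (v₀ τ)| ≤ M := by
    refine ⟨max M₀ 0, le_max_right _ _, fun τ hτ => ?_⟩
    have := hM₀ (v₀ τ) (hv₀b τ hτ)
    rw [Real.norm_eq_abs] at this
    exact this.trans (le_max_left _ _)
  have hgc : ContinuousOn (fun τ => deriv f (v₀ τ)) (Icc 0 1) :=
    hfc.comp_continuousOn hv₀.continuousOn
  set A : ℝ := R ^ 2 * M with hA
  have hA0 : 0 ≤ A := by positivity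
  -- a priori estimate
  have key : ∀ k : ℕ, ∀ C : ℝ, 0 ≤ C → (∀ τ ∈ Icc (0:ℝ) 1, |u k τ| ≤ C) →
      ∀ r ∈ Icc (0:ℝ) 1, |u k r - 1| ≤ A * C / (2 * k + 2) := by
    intro k C hC hb r hr
    rw [hu_eq k r hr, add_sub_cancel_left]
    have inner : ∀ s ∈ Ioc (0:ℝ) 1,
        |∫ τ in (0:ℝ)..s, τ ^ (2 * k + 1) * deriv f (v₀ τ) * u k τ|
          ≤ M * C * (s ^ (2 * k + 2) / (2 * k + 2)) := by
      intro s hs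
      have h1 := intervalIntegral.norm_integral_le_of_norm_le (μ := MeasureTheory.volume)
        (f := fun τ => τ ^ (2 * k + 1) * deriv f (v₀ τ) * u k τ)
        (g := fun τ => M * C * τ ^ (2 * k + 1)) hs.1.le
        (Eventually.of_forall fun τ hτ => by
          have hτ' : τ ∈ Icc (0:ℝ) 1 := ⟨hτ.1.le, hτ.2.trans hs.2⟩
          have hp : 0 ≤ τ ^ (2 * k + 1) := pow_nonneg hτ'.1 _
          rw [Real.norm_eq_abs, abs_mul, abs_mul, abs_of_nonneg hp]
          calc τ ^ (2 * k + 1) * |deriv f (v₀ τ)| * |u k τ|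
              ≤ τ ^ (2 * k + 1) * M * C := by
                gcongr
                · exact hM τ hτ'
                · exact hb τ hτ'
            _ = _ := by ring)
        ((by fun_prop : Continuous fun τ : ℝ => M * C * τ ^ (2 * k + 1)).intervalIntegrable _ _)
      rw [Real.norm_eq_abs, intervalIntegral.integral_const_mul, integral_pow] at h1
      refine h1.trans (le_of_eq ?_)
      push_cast
      rw [zero_pow (by omega), sub_zero]
      ring
    have h2 := intervalIntegral.norm_integral_le_of_norm_le_const (a := (0:ℝ)) (b := r)
      (C := A * C / (2 * k + 2))
      (f := fun s => (R ^ 2 / s ^ (2 * k + 1)) *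
        ∫ τ in (0:ℝ)..s, τ ^ (2 * k + 1) * deriv f (v₀ τ) * u k τ) (fun s hs => by
          rw [uIoc_of_le hr.1] at hs
          have hs' : s ∈ Ioc (0:ℝ) 1 := ⟨hs.1, hs.2.trans hr.2⟩
          have hs0 : 0 < s := hs.1
          rw [Real.norm_eq_abs, abs_mul, abs_of_nonneg (by positivity)]
          calc R ^ 2 / s ^ (2 * k + 1) *
              |∫ τ in (0:ℝ)..s, τ ^ (2 * k + 1) * deriv f (v₀ τ) * u k τ|
              ≤ R ^ 2 / s ^ (2 * k + 1) * (M * C * (s ^ (2 * k + 2) / (2 * k + 2))) := by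
                gcongr
                exact inner s hs'
            _ = A * C / (2 * k + 2) * s := by
                rw [hA]; field_simp; ring
            _ ≤ A * C / (2 * k + 2) * 1 := by
                gcongr
                exact hs'.2
            _ = _ := mul_one _)
    rw [Real.norm_eq_abs, sub_zero, abs_of_nonneg hr.1] at h2
    refine h2.trans (mul_le_of_le_one_right (by positivity) hr.2)
  have est : ∀ k : ℕ, A ≤ k + 1 → ∀ r ∈ Icc (0:ℝ) 1, |u k r - 1| ≤ A / (k + 1) := by
    intro k hk
    obtain ⟨x, hx, hmax⟩ := (isCompact_Icc (a := (0:ℝ)) (b := 1)).exists_isMaxOn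
      ⟨0, by simp⟩ (hu_cont k).abs
    have hmax' : ∀ τ ∈ Icc (0:ℝ) 1, |u k τ| ≤ |u k x| := fun τ hτ => hmax hτ
    have h1 := key k _ (abs_nonneg _) hmax' x hx
    have hk0 : (0:ℝ) < k + 1 := by positivity
    have h2 : A * |u k x| / (2 * k + 2) ≤ |u k x| / 2 := by
      rw [div_le_div_iff₀ (by positivity) (by positivity)]
      nlinarith [abs_nonneg (u k x)]
    have h3 : |u k x| ≤ 2 := by
      have : |u k x| ≤ |u k x - 1| + 1 := by
        have := abs_add_le (u k x - 1) 1
        simpa using this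
      linarith
    intro r hr
    refine (key k 2 (by norm_num) (fun τ hτ => (hmax' τ hτ).trans h3) r hr).trans (le_of_eq ?_)
    field_simp
  have main : ∀ᶠ k : ℕ in atTop,
      ‖(k:ℝ) * (deriv (u k) 1 - deriv (u (k + 1)) 1)‖ ≤ (A * (A + 1)) * (1 / ((k:ℝ) + 1)) := by
    obtain ⟨N, hN⟩ := exists_nat_ge A
    filter_upwards [eventually_ge_atTop N] with k hk
    have hNk : (N:ℝ) ≤ k := by exact_mod_cast hk
    have e1 := est k (by linarith)
    have e2 := est (k + 1) (by push_cast; linarith)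
    have hint : ∀ j : ℕ, IntervalIntegrable (fun τ => τ ^ (2 * j + 1) * deriv f (v₀ τ) * u j τ)
        MeasureTheory.volume 0 1 := by
      intro j
      apply ContinuousOn.intervalIntegrable
      rw [uIcc_of_le zero_le_one]
      exact (((continuous_pow _).continuousOn).mul hgc).mul (hu_cont j)
    rw [hu_done, hu_done, ← mul_sub, ← intervalIntegral.integral_sub (hint k) (hint (k + 1))]
    have h1 := intervalIntegral.norm_integral_le_of_norm_le (μ := MeasureTheory.volume)
        (f := fun τ => τ ^ (2 * k + 1) * deriv f (v₀ τ) * u k τ -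
          τ ^ (2 * (k + 1) + 1) * deriv f (v₀ τ) * u (k + 1) τ)
        (g := fun τ => (M * (2 * (A / (k + 1)) + 1)) * τ ^ (2 * k + 1) - M * τ ^ (2 * k + 3))
        (zero_le_one' ℝ)
        (Eventually.of_forall fun τ hτ => by
          have hτ' : τ ∈ Icc (0:ℝ) 1 := ⟨hτ.1.le, hτ.2⟩
          have hp : 0 ≤ τ ^ (2 * k + 1) := pow_nonneg hτ'.1 _
          have ht2 : τ ^ 2 ≤ 1 := pow_le_one₀ hτ'.1 hτ'.2
          have e3 : |u (k + 1) τ - 1| ≤ A / (k + 1) := by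
            refine (e2 τ hτ').trans ?_
            push_cast
            gcongr
            linarith
          have e4 : |(u k τ - 1) - τ ^ 2 * (u (k + 1) τ - 1) + (1 - τ ^ 2)|
              ≤ 2 * (A / (k + 1)) + (1 - τ ^ 2) := by
            have a1 := abs_le.1 (e1 τ hτ')
            have a2 : |τ ^ 2 * (u (k + 1) τ - 1)| ≤ A / (k + 1) := by
              rw [abs_mul, abs_of_nonneg (sq_nonneg τ)]
              exact (mul_le_of_le_one_left (abs_nonneg _) ht2).trans e3
            have a3 := abs_le.1 a2
            rw [abs_le]
            constructor <;> linarith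
          have : τ ^ (2 * k + 1) * deriv f (v₀ τ) * u k τ -
              τ ^ (2 * (k + 1) + 1) * deriv f (v₀ τ) * u (k + 1) τ
              = τ ^ (2 * k + 1) * deriv f (v₀ τ) *
                ((u k τ - 1) - τ ^ 2 * (u (k + 1) τ - 1) + (1 - τ ^ 2)) := by ring
          rw [this, Real.norm_eq_abs, abs_mul, abs_mul, abs_of_nonneg hp]
          calc _ ≤ τ ^ (2 * k + 1) * M * (2 * (A / (k + 1)) + (1 - τ ^ 2)) := by
                gcongr
                exact hM τ hτ'
            _ = _ := by ring)
        ((by fun_prop : Continuous fun τ : ℝ => (M * (2 * (A / (k + 1)) + 1)) * τ ^ (2 * k + 1)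
          - M * τ ^ (2 * k + 3)).intervalIntegrable _ _)
    rw [intervalIntegral.integral_sub
      ((by fun_prop : Continuous fun τ : ℝ =>
        (M * (2 * (A / (k + 1)) + 1)) * τ ^ (2 * k + 1)).intervalIntegrable _ _)
      ((by fun_prop : Continuous fun τ : ℝ => M * τ ^ (2 * k + 3)).intervalIntegrable _ _),
      intervalIntegral.integral_const_mul, intervalIntegral.integral_const_mul,
      integral_pow, integral_pow] at h1
    rw [norm_mul, norm_mul, Real.norm_of_nonneg (by positivity : (0:ℝ) ≤ k),
      Real.norm_of_nonneg (by positivity : (0:ℝ) ≤ R ^ 2)]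
    refine (mul_le_mul_of_nonneg_left (mul_le_mul_of_nonneg_left h1 (by positivity))
      (by positivity)).trans ?_
    push_cast
    rw [zero_pow (by omega), zero_pow (by omega)]
    simp only [one_pow, sub_zero]
    have hk0 : (0:ℝ) ≤ k := by positivity
    have hk1 : (k:ℝ) / (k + 1) ≤ 1 := by
      rw [div_le_one (by positivity)]; linarith
    have hk2 : (k:ℝ) / (k + 2) ≤ 1 := by
      rw [div_le_one (by positivity)]; linarith
    have : (k:ℝ) * (R ^ 2 * (M * (2 * (A / (k + 1)) + 1) * (1 / (2 * k + 1 + 1))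
        - M * (1 / (2 * k + 3 + 1))))
        = A * (A * ((k:ℝ) / (k + 1)) + 1 / 2 * (k / (k + 2))) * (1 / (k + 1)) := by
      have b1 : (2 * (k:ℝ) + 1 + 1) = 2 * (k + 1) := by ring
      have b2 : (2 * (k:ℝ) + 3 + 1) = 2 * (k + 2) := by ring
      have b3 : (k:ℝ) * (R ^ 2 * (M * (2 * (A / (k + 1)) + 1) * (1 / (2 * k + 1 + 1))
        - M * (1 / (2 * k + 3 + 1)))) = (k:ℝ) * (A * ((2 * (A / (k + 1)) + 1) * (1 / (2 * k + 1 + 1))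
        - (1 / (2 * k + 3 + 1)))) := by
        rw [hA]; ring
      rw [b3, b1, b2]
      field_simp
      ring
    rw [this]
    have : A * ((k:ℝ) / (k + 1)) ≤ A := mul_le_of_le_one_right hA0 hk1
    gcongr
    linarith
  refine squeeze_zero_norm' main ?_
  simpa using (tendsto_one_div_add_atTop_nhds_zero_nat (𝕜 := ℝ)).const_mul (A * (A + 1))
end

section
/- Let A ∈ (0, f(1)). Then there exists a natural number k₁ ≥ 2 such that for every integer k ≥ k₁ one has (A/2)·(u_k'(1)/u_k(1)) + A − f(1) < 0 (so that G_k is well defined), and 0 < G_k < G_{k+1}. -/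
open Set Filter intervalIntegral

lemma aux_inner (n : ℕ) (h : ℝ → ℝ) (B : ℝ) (s : ℝ) (hs : s ∈ Icc (0:ℝ) 1)
    (hB : ∀ t ∈ Icc (0:ℝ) 1, |h t| ≤ B) :
    |∫ τ in (0:ℝ)..s, τ ^ n * h τ| ≤ B * (s ^ (n+1) / (n+1)) := by
  have h1 : ‖∫ τ in (0:ℝ)..s, τ ^ n * h τ‖ ≤ ∫ τ in (0:ℝ)..s, B * τ ^ n := by
    apply intervalIntegral.norm_integral_le_of_norm_le hs.1
    · refine Eventually.of_forall fun t ht => ?_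
      have h0 : 0 ≤ t := ht.1.le
      rw [Real.norm_eq_abs, abs_mul, abs_of_nonneg (pow_nonneg h0 n), mul_comm]
      exact mul_le_mul_of_nonneg_right (hB t ⟨h0, ht.2.trans hs.2⟩) (pow_nonneg h0 n)
    · exact (by fun_prop : Continuous fun τ : ℝ => B * τ ^ n).intervalIntegrable _ _
  rw [Real.norm_eq_abs] at h1
  rw [intervalIntegral.integral_const_mul, integral_pow] at h1
  simpa using h1

lemma aux_outer (R : ℝ) (n : ℕ) (h : ℝ → ℝ) (B : ℝ) (hB0 : 0 ≤ B) (r : ℝ) (hr : r ∈ Icc (0:ℝ) 1)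
    (hB : ∀ t ∈ Icc (0:ℝ) 1, |h t| ≤ B) :
    |∫ s in (0:ℝ)..r, (R ^ 2 / s ^ n) * ∫ τ in (0:ℝ)..s, τ ^ n * h τ| ≤ R ^ 2 * B / (n+1) := by
  have hn : (0:ℝ) < n + 1 := by positivity
  have h1 : ‖∫ s in (0:ℝ)..r, (R ^ 2 / s ^ n) * ∫ τ in (0:ℝ)..s, τ ^ n * h τ‖
      ≤ (R ^ 2 * B / (n+1)) * |r - 0| := by
    apply intervalIntegral.norm_integral_le_of_norm_le_const
    intro s hs
    rw [uIoc_of_le hr.1] at hs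
    have hs0 : 0 < s := hs.1
    have hs1 : s ≤ 1 := hs.2.trans hr.2
    have h2 := aux_inner n h B s ⟨hs0.le, hs1⟩ hB
    rw [Real.norm_eq_abs, abs_mul, abs_of_nonneg (by positivity : 0 ≤ R ^ 2 / s ^ n)]
    calc _ ≤ R ^ 2 / s ^ n * (B * (s ^ (n+1) / (n+1))) :=
          mul_le_mul_of_nonneg_left h2 (by positivity)
      _ = (R ^ 2 * B / (n+1)) * s := by
          field_simp
          ring
      _ ≤ (R ^ 2 * B / (n+1)) * 1 := mul_le_mul_of_nonneg_left hs1 (by positivity)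
      _ = _ := mul_one _
  rw [Real.norm_eq_abs] at h1
  refine h1.trans ?_
  have : |r - 0| ≤ 1 := by rw [sub_zero, abs_of_nonneg hr.1]; exact hr.2
  calc _ ≤ (R ^ 2 * B / (n+1)) * 1 := mul_le_mul_of_nonneg_left this (by positivity)
    _ = _ := mul_one _

lemma aux_u (R M : ℝ) (hM : 0 ≤ M) (n : ℕ) (g u : ℝ → ℝ) (hg : ∀ t ∈ Icc (0:ℝ) 1, |g t| ≤ M)
    (hu : ContinuousOn u (Icc 0 1))
    (hn : 2 * (R ^ 2 * M) ≤ n + 1)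
    (heq : ∀ r ∈ Icc (0:ℝ) 1, u r = 1 + ∫ s in (0:ℝ)..r, (R ^ 2 / s ^ n) *
        ∫ τ in (0:ℝ)..s, τ ^ n * g τ * u τ) :
    ∀ r ∈ Icc (0:ℝ) 1, |u r - 1| ≤ 2 * (R ^ 2 * M) / (n+1) := by
  have hn0 : (0:ℝ) < n + 1 := by positivity
  obtain ⟨x, hx, hmax⟩ := isCompact_Icc.exists_isMaxOn (nonempty_Icc.2 zero_le_one) hu.abs
  have hS : ∀ t ∈ Icc (0:ℝ) 1, |u t| ≤ |u x| := fun t ht => hmax ht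
  have key : ∀ r ∈ Icc (0:ℝ) 1, |u r - 1| ≤ R ^ 2 * (M * |u x|) / (n+1) := by
    intro r hr
    have := aux_outer R n (fun t => g t * u t) (M * |u x|) (by positivity) r hr (by
      intro t ht
      rw [abs_mul]
      exact mul_le_mul (hg t ht) (hS t ht) (abs_nonneg _) hM)
    rw [heq r hr, add_sub_cancel_left]
    simpa only [mul_assoc] using this
  have hx2 : |u x| ≤ 2 := by
    have h1 := key x hx
    have h2 : R ^ 2 * (M * |u x|) / (n+1) ≤ |u x| / 2 := by
      rw [div_le_div_iff₀ hn0 two_pos]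
      nlinarith [mul_le_mul_of_nonneg_right hn (abs_nonneg (u x))]
    have h3 : |u x| ≤ |u x - 1| + 1 := by
      have := abs_add_le (u x - 1) 1
      simpa using this
    linarith
  intro r hr
  refine (key r hr).trans ?_
  apply div_le_div_of_nonneg_right _ hn0.le
  have : R ^ 2 * M * |u x| ≤ R ^ 2 * M * 2 := mul_le_mul_of_nonneg_left hx2 (by positivity)
  linarith

/-- peak estimate -/
lemma aux_peak (n : ℕ) (h : ℝ → ℝ) (hh : ContinuousOn h (Icc 0 1)) (c E K : ℝ)
    (hb : ∀ t ∈ Icc (0:ℝ) 1, |h t - c| ≤ E + K * (1 - t)) :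
    |(n+1) * (∫ τ in (0:ℝ)..1, τ ^ n * h τ) - c| ≤ E + K / (n+2) := by
  have hn0 : (0:ℝ) < n + 1 := by positivity
  have hn1 : (0:ℝ) < n + 2 := by positivity
  have i1 : IntervalIntegrable (fun τ : ℝ => τ ^ n * h τ) MeasureTheory.volume 0 1 := by
    apply ContinuousOn.intervalIntegrable
    rw [uIcc_of_le zero_le_one]
    fun_prop
  have i2 : IntervalIntegrable (fun τ : ℝ => τ ^ n * c) MeasureTheory.volume 0 1 :=
    (by fun_prop : Continuous fun τ : ℝ => τ ^ n * c).intervalIntegrable _ _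
  have e2 : ∫ τ in (0:ℝ)..1, τ ^ n * c = c / (n+1) := by
    rw [intervalIntegral.integral_mul_const, integral_pow]; simp; ring
  have h1 : ‖∫ τ in (0:ℝ)..1, (τ ^ n * h τ - τ ^ n * c)‖ ≤
      ∫ τ in (0:ℝ)..1, ((E + K) * τ ^ n - K * τ ^ (n+1)) := by
    apply intervalIntegral.norm_integral_le_of_norm_le zero_le_one
    · refine Eventually.of_forall fun t ht => ?_
      have h0 : 0 ≤ t := ht.1.le
      rw [← mul_sub, Real.norm_eq_abs, abs_mul, abs_of_nonneg (pow_nonneg h0 n)]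
      calc _ ≤ t ^ n * (E + K * (1 - t)) :=
            mul_le_mul_of_nonneg_left (hb t ⟨h0, ht.2⟩) (pow_nonneg h0 n)
        _ = _ := by ring
    · exact (by fun_prop : Continuous fun τ : ℝ =>
        (E + K) * τ ^ n - K * τ ^ (n+1)).intervalIntegrable _ _
  have e3 : ∫ τ in (0:ℝ)..1, ((E + K) * τ ^ n - K * τ ^ (n+1))
      = (E + K) / (n+1) - K / (n+2) := by
    rw [intervalIntegral.integral_sub, intervalIntegral.integral_const_mul,
      intervalIntegral.integral_const_mul, integral_pow, integral_pow]
    · simp; ring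
    · exact (by fun_prop : Continuous fun τ : ℝ => (E + K) * τ ^ n).intervalIntegrable _ _
    · exact (by fun_prop : Continuous fun τ : ℝ => K * τ ^ (n+1)).intervalIntegrable _ _
  rw [intervalIntegral.integral_sub i1 i2, e2, e3, Real.norm_eq_abs] at h1
  have h2 : (n+1) * (∫ τ in (0:ℝ)..1, τ ^ n * h τ) - c
      = (n+1) * ((∫ τ in (0:ℝ)..1, τ ^ n * h τ) - c / (n+1)) := by field_simp
  rw [h2, abs_mul, abs_of_pos hn0]
  calc _ ≤ ((n:ℝ)+1) * ((E + K) / (n+1) - K / (n+2)) := mul_le_mul_of_nonneg_left h1 hn0.le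
    _ = E + K / (n+2) := by field_simp; ring

lemma aux_final (R a c L : ℝ) (hR : 0 < R) (hc : 0 < c) (q : ℕ → ℝ)
    (hq : Tendsto (fun k : ℕ => (2 * (k:ℝ) + 2) * q k) atTop (nhds L)) :
    ∃ k₁ : ℕ, 2 ≤ k₁ ∧ ∀ k : ℕ, k₁ ≤ k →
      a * q k - c < 0 ∧
      0 < ((-(k:ℝ) ^ 3 + (k:ℝ)) / R ^ 3) / (a * q k - c) ∧
      ((-(k:ℝ) ^ 3 + (k:ℝ)) / R ^ 3) / (a * q k - c)
        < ((-((k:ℝ) + 1) ^ 3 + ((k:ℝ) + 1)) / R ^ 3) / (a * q (k+1) - c) := by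
  have t1 : Tendsto (fun k : ℕ => 1 / ((k:ℝ) + 1)) atTop (nhds 0) :=
    tendsto_one_div_add_atTop_nhds_zero_nat
  have hq0 : Tendsto q atTop (nhds 0) := by
    have := (hq.mul t1).mul_const (1/2)
    simp only [mul_zero, zero_mul] at this
    refine this.congr fun k => ?_
    have : (k:ℝ) + 1 ≠ 0 := by positivity
    field_simp
  have hq1 : Tendsto (fun k : ℕ => q (k+1)) atTop (nhds 0) := hq0.comp (tendsto_add_atTop_nat 1)
  have hp1 := hq.comp (tendsto_add_atTop_nat 1)
  have hd : Tendsto (fun k : ℕ => ((k:ℝ) - 1) * (a * (q k - q (k+1)))) atTop (nhds 0) := by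
    have := (((hq.sub hp1).mul_const (1/2)).add (hq1.mul_const 3)).sub (hq0.mul_const 2)
    have := this.const_mul a
    simp only [sub_self, zero_mul, add_zero, mul_zero] at this
    refine this.congr fun k => ?_
    simp only [Function.comp]
    push_cast
    ring
  have ha : Tendsto (fun k => a * q k) atTop (nhds 0) := by simpa using hq0.const_mul a
  have E1 := ha.eventually (gt_mem_nhds (half_pos hc))
  have E2 := hd.eventually (gt_mem_nhds (half_pos hc))
  obtain ⟨N, hN⟩ := eventually_atTop.1 (E1.and E2)
  refine ⟨max N 2, le_max_right _ _, fun k hk => ?_⟩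
  have hkN := (le_max_left _ _).trans hk
  have hk2 : (2:ℝ) ≤ k := by exact_mod_cast (le_max_right _ _).trans hk
  obtain ⟨h1, h2⟩ := hN k hkN
  obtain ⟨h3, -⟩ := hN (k+1) (by omega)
  have e1 : ((-(k:ℝ) ^ 3 + (k:ℝ)) / R ^ 3) / (a * q k - c)
      = (((k:ℝ) ^ 3 - k) / R ^ 3) / (c - a * q k) := by
    rw [← neg_div_neg_eq, ← neg_div]; ring_nf
  have e2 : ((-((k:ℝ) + 1) ^ 3 + ((k:ℝ) + 1)) / R ^ 3) / (a * q (k+1) - c)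
      = ((((k:ℝ) + 1) ^ 3 - (k + 1)) / R ^ 3) / (c - a * q (k+1)) := by
    rw [← neg_div_neg_eq, ← neg_div]; ring_nf
  have d1 : 0 < c - a * q k := by linarith
  have d2 : 0 < c - a * q (k+1) := by linarith
  have n1 : 0 < (k:ℝ) ^ 3 - k := by nlinarith [mul_pos (by linarith : (0:ℝ) < k) (by nlinarith : (0:ℝ) < (k:ℝ)^2 - 1)]
  rw [e1, e2]
  refine ⟨by linarith, by positivity, ?_⟩
  rw [div_lt_div_iff₀ d1 d2, div_mul_eq_mul_div, div_mul_eq_mul_div]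
  apply div_lt_div_of_pos_right _ (by positivity)
  have key : ((k:ℝ) - 1) * (c - a * q (k+1)) < (k + 2) * (c - a * q k) := by nlinarith
  have hkk : (0:ℝ) < k * (k + 1) := by positivity
  nlinarith [mul_lt_mul_of_pos_left key hkk]

/-- For `A ∈ (0, f(1))` there is `k₁ ≥ 2` such that for every `k ≥ k₁` the
denominator `(A/2)·(u_k'(1)/u_k(1)) + A − f(1)` is negative (so that
`G_k := ((−k³+k)/R³) / ((A/2)·(u_k'(1)/u_k(1)) + A − f(1))` is well defined) and
`0 < G_k < G_{k+1}`. -/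
theorem exists_k1_G_pos_strictMono
    (R : ℝ) (hR : 0 < R)
    (f : ℝ → ℝ) (hf : ContDiff ℝ (⊤ : ℕ∞) f) (hf0 : f 0 = 0)
    (hf' : ∀ x : ℝ, 0 ≤ x → 0 < deriv f x)
    (v₀ : ℝ → ℝ) (hv₀ : ContDiffOn ℝ (⊤ : ℕ∞) v₀ (Icc 0 1))
    (hv₀b : ∀ r ∈ Icc (0:ℝ) 1, 0 ≤ v₀ r ∧ v₀ r ≤ 1)
    (u : ℕ → ℝ → ℝ)
    (hu_cont : ∀ k : ℕ, ContinuousOn (u k) (Icc 0 1))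
    (hu_eq : ∀ k : ℕ, ∀ r ∈ Icc (0:ℝ) 1,
      u k r = 1 + ∫ s in (0:ℝ)..r, (R ^ 2 / s ^ (2 * k + 1)) *
        ∫ τ in (0:ℝ)..s, τ ^ (2 * k + 1) * deriv f (v₀ τ) * u k τ)
    (hu_uniq : ∀ k : ℕ, ∀ w : ℝ → ℝ,
      (ContinuousOn w (Icc 0 1) ∧ ∀ r ∈ Icc (0:ℝ) 1,
        w r = 1 + ∫ s in (0:ℝ)..r, (R ^ 2 / s ^ (2 * k + 1)) *
          ∫ τ in (0:ℝ)..s, τ ^ (2 * k + 1) * deriv f (v₀ τ) * w τ) →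
        EqOn w (u k) (Icc 0 1))
    (hu_smooth : ∀ k : ℕ, ContDiffOn ℝ (⊤ : ℕ∞) (u k) (Icc 0 1))
    (hu_ode : ∀ k : ℕ, ∀ r ∈ Ioc (0:ℝ) 1,
      deriv (deriv (u k)) r + ((2 * (k:ℝ) + 1) / r) * deriv (u k) r
        = R ^ 2 * deriv f (v₀ r) * u k r)
    (hu_zero : ∀ k : ℕ, u k 0 = 1) (hu_dzero : ∀ k : ℕ, deriv (u k) 0 = 0)
    (hu_done : ∀ k : ℕ, deriv (u k) 1
      = R ^ 2 * ∫ τ in (0:ℝ)..1, τ ^ (2 * k + 1) * deriv f (v₀ τ) * u k τ)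
    (A : ℝ) (hA : A ∈ Ioo 0 (f 1)) :
    ∃ k₁ : ℕ, 2 ≤ k₁ ∧ ∀ k : ℕ, k₁ ≤ k →
      (A / 2) * (deriv (u k) 1 / u k 1) + A - f 1 < 0 ∧
      0 < ((-(k:ℝ) ^ 3 + (k:ℝ)) / R ^ 3) /
            ((A / 2) * (deriv (u k) 1 / u k 1) + A - f 1) ∧
      ((-(k:ℝ) ^ 3 + (k:ℝ)) / R ^ 3) /
          ((A / 2) * (deriv (u k) 1 / u k 1) + A - f 1)
        < ((-((k:ℝ) + 1) ^ 3 + ((k:ℝ) + 1)) / R ^ 3) /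
            ((A / 2) * (deriv (u (k + 1)) 1 / u (k + 1) 1) + A - f 1) := by
  obtain ⟨hA0, hA1⟩ := hA
  have hgs : ContDiffOn ℝ 1 (fun t => deriv f (v₀ t)) (Icc 0 1) := by
    have h1 : ContDiff ℝ 1 (deriv f) := by
      exact (contDiff_infty_iff_deriv.1 hf).2.of_le (by exact_mod_cast (le_top : (1 : ℕ∞) ≤ ⊤))
    exact h1.comp_contDiffOn (hv₀.of_le (by exact_mod_cast (le_top : (1 : ℕ∞) ≤ ⊤)))
  set g : ℝ → ℝ := fun t => deriv f (v₀ t) with hg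
  obtain ⟨K, hK⟩ := hgs.exists_lipschitzOnWith one_ne_zero (convex_Icc 0 1) isCompact_Icc
  have hgc : ContinuousOn g (Icc 0 1) := hgs.continuousOn
  obtain ⟨M, hM⟩ := isCompact_Icc.exists_bound_of_continuousOn hgc
  simp only [Real.norm_eq_abs] at hM
  have h1mem : (1:ℝ) ∈ Icc (0:ℝ) 1 := ⟨zero_le_one, le_rfl⟩
  have hM0 : 0 ≤ M := (abs_nonneg _).trans (hM 1 h1mem)
  have t1 : Tendsto (fun k : ℕ => 1 / ((k:ℝ) + 1)) atTop (nhds 0) :=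
    tendsto_one_div_add_atTop_nhds_zero_nat
  have hev : ∀ᶠ k : ℕ in atTop, 2 * (R ^ 2 * M) ≤ ((2 * k + 1 : ℕ) : ℝ) + 1 := by
    obtain ⟨N, hN⟩ := exists_nat_ge (2 * (R ^ 2 * M))
    filter_upwards [eventually_ge_atTop N] with k hk
    have : (N:ℝ) ≤ k := by exact_mod_cast hk
    push_cast
    have : (0:ℝ) ≤ k := by positivity
    linarith
  have hub : ∀ᶠ k : ℕ in atTop, ∀ r ∈ Icc (0:ℝ) 1,
      |u k r - 1| ≤ (R ^ 2 * M) * (1 / ((k:ℝ) + 1)) := by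
    filter_upwards [hev] with k hk r hr
    refine (aux_u R M hM0 (2*k+1) g (u k) hM (hu_cont k) hk (hu_eq k) r hr).trans (le_of_eq ?_)
    push_cast
    have : (k:ℝ) + 1 ≠ 0 := by positivity
    field_simp
    ring
  have hu1 : Tendsto (fun k => u k 1) atTop (nhds 1) := by
    rw [tendsto_iff_dist_tendsto_zero]
    refine squeeze_zero' (Eventually.of_forall fun _ => dist_nonneg) ?_
      (by simpa using t1.const_mul (R ^ 2 * M))
    filter_upwards [hub] with k hk
    simpa [Real.dist_eq] using hk 1 h1mem
  have hI : Tendsto (fun k : ℕ => (2 * (k:ℝ) + 2) *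
      ∫ τ in (0:ℝ)..1, τ ^ (2 * k + 1) * deriv f (v₀ τ) * u k τ) atTop (nhds (g 1)) := by
    rw [tendsto_iff_dist_tendsto_zero]
    refine squeeze_zero' (g := fun k : ℕ => (M * (R ^ 2 * M) + K) * (1 / ((k:ℝ) + 1)))
      (Eventually.of_forall fun _ => dist_nonneg) ?_
      (by simpa using t1.const_mul (M * (R ^ 2 * M) + K))
    filter_upwards [hub] with k hk
    have hp := aux_peak (2*k+1) (fun t => g t * u k t) (hgc.mul (hu_cont k)) (g 1)
      (M * ((R ^ 2 * M) * (1 / ((k:ℝ) + 1)))) K (by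
        intro t ht
        have a1 : |g t * (u k t - 1)| ≤ M * ((R ^ 2 * M) * (1 / ((k:ℝ) + 1))) := by
          rw [abs_mul]
          exact mul_le_mul (hM t ht) (hk t ht) (abs_nonneg _) hM0
        have a2 : |g t - g 1| ≤ K * (1 - t) := by
          have := hK.dist_le_mul t ht 1 h1mem
          rw [Real.dist_eq, Real.dist_eq, abs_sub_comm t 1,
            abs_of_nonneg (by linarith [ht.2] : 0 ≤ 1 - t)] at this
          exact this
        calc |g t * u k t - g 1| = |g t * (u k t - 1) + (g t - g 1)| := by ring_nf
          _ ≤ _ := abs_add_le _ _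
          _ ≤ _ := add_le_add a1 a2)
    rw [Real.dist_eq]
    simp only [← mul_assoc] at hp ⊢
    have e : (((2 * k + 1 : ℕ) : ℝ) + 1) = 2 * (k:ℝ) + 2 := by push_cast; ring
    rw [e] at hp
    refine hp.trans ?_
    have hKK : (K:ℝ) / (((2 * k + 1 : ℕ) : ℝ) + 2) ≤ K * (1 / ((k:ℝ) + 1)) := by
      rw [mul_one_div]
      apply div_le_div_of_nonneg_left K.2 (by positivity)
      push_cast
      have : (0:ℝ) ≤ k := by positivity
      linarith
    rw [add_mul]
    linarith
  have hq : Tendsto (fun k : ℕ => (2 * (k:ℝ) + 2) * (deriv (u k) 1 / u k 1)) atTop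
      (nhds (R ^ 2 * g 1 / 1)) := by
    refine ((hI.const_mul (R ^ 2)).div hu1 one_ne_zero).congr fun k => ?_
    simp only [Pi.div_apply]
    rw [hu_done k]
    ring
  have := aux_final R (A / 2) (f 1 - A) _ hR (by linarith) _ hq
  simpa only [sub_sub_eq_add_sub] using this
end

section
/- Let A ∈ (0, f(1)), assume (A/2)·(u_0'(1)/u_0(1)) + A − f(1) ≠ 0, and let k₁ ≥ 2 be a natural number such that for all k ≥ k₁ one has (A/2)·(u_k'(1)/u_k(1)) + A − f(1) < 0. If G ∈ ℝ satisfies G > G_•, and m ≥ 2 is an integer with μ_m(G) = 0, then m > k₁ and G = G_m. -/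
open Set Filter intervalIntegral

/-- If `G > G_•` and the symbol `μ_m(G)` vanishes for some integer `m ≥ 2`, then
necessarily `m > k₁` and `G = G_m`.  Here
`μ_m(G) = −m³/R³ + m/R³ − G·((A/2)·(u_m'(1)/u_m(1)) + A − f(1))`,
`G_m = ((−m³+m)/R³)/((A/2)·(u_m'(1)/u_m(1)) + A − f(1))` and
`G_• = ((k₁³−k₁)/R³) / min{ |f(1) − A − (A/2)·(u_k'(1)/u_k(1))| : 0 ≤ k ≤ k₁,
  f(1) − A − (A/2)·(u_k'(1)/u_k(1)) ≠ 0 }`. -/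
theorem mu_eq_zero_implies_G_eq_G_m
    (R : ℝ) (hR : 0 < R)
    (f : ℝ → ℝ) (hf : ContDiff ℝ (⊤ : ℕ∞) f) (hf0 : f 0 = 0)
    (hf' : ∀ x : ℝ, 0 ≤ x → 0 < deriv f x)
    (v₀ : ℝ → ℝ) (hv₀ : ContDiffOn ℝ (⊤ : ℕ∞) v₀ (Icc 0 1))
    (hv₀b : ∀ r ∈ Icc (0:ℝ) 1, 0 ≤ v₀ r ∧ v₀ r ≤ 1)
    (u : ℕ → ℝ → ℝ)
    (hu_cont : ∀ k : ℕ, ContinuousOn (u k) (Icc 0 1))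
    (hu_eq : ∀ k : ℕ, ∀ r ∈ Icc (0:ℝ) 1,
      u k r = 1 + ∫ s in (0:ℝ)..r, (R ^ 2 / s ^ (2 * k + 1)) *
        ∫ τ in (0:ℝ)..s, τ ^ (2 * k + 1) * deriv f (v₀ τ) * u k τ)
    (hu_uniq : ∀ k : ℕ, ∀ w : ℝ → ℝ,
      (ContinuousOn w (Icc 0 1) ∧ ∀ r ∈ Icc (0:ℝ) 1,
        w r = 1 + ∫ s in (0:ℝ)..r, (R ^ 2 / s ^ (2 * k + 1)) *
          ∫ τ in (0:ℝ)..s, τ ^ (2 * k + 1) * deriv f (v₀ τ) * w τ) →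
        EqOn w (u k) (Icc 0 1))
    (hu_smooth : ∀ k : ℕ, ContDiffOn ℝ (⊤ : ℕ∞) (u k) (Icc 0 1))
    (hu_ode : ∀ k : ℕ, ∀ r ∈ Ioc (0:ℝ) 1,
      deriv (deriv (u k)) r + ((2 * (k:ℝ) + 1) / r) * deriv (u k) r
        = R ^ 2 * deriv f (v₀ r) * u k r)
    (hu_zero : ∀ k : ℕ, u k 0 = 1) (hu_dzero : ∀ k : ℕ, deriv (u k) 0 = 0)
    (hu_done : ∀ k : ℕ, deriv (u k) 1
      = R ^ 2 * ∫ τ in (0:ℝ)..1, τ ^ (2 * k + 1) * deriv f (v₀ τ) * u k τ)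
    (A : ℝ) (hA : A ∈ Ioo 0 (f 1))
    (h0 : (A / 2) * (deriv (u 0) 1 / u 0 1) + A - f 1 ≠ 0)
    (k₁ : ℕ) (hk₁2 : 2 ≤ k₁)
    (hk₁ : ∀ k : ℕ, k₁ ≤ k → (A / 2) * (deriv (u k) 1 / u k 1) + A - f 1 < 0)
    (G : ℝ)
    (hG : G > (((k₁:ℝ) ^ 3 - (k₁:ℝ)) / R ^ 3) /
        sInf {x : ℝ | ∃ k : ℕ, k ≤ k₁ ∧
          f 1 - A - (A / 2) * (deriv (u k) 1 / u k 1) ≠ 0 ∧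
          x = |f 1 - A - (A / 2) * (deriv (u k) 1 / u k 1)|})
    (m : ℕ) (hm : 2 ≤ m)
    (hμ : -(m:ℝ) ^ 3 / R ^ 3 + (m:ℝ) / R ^ 3
        - G * ((A / 2) * (deriv (u m) 1 / u m 1) + A - f 1) = 0) :
    k₁ < m ∧
    G = ((-(m:ℝ) ^ 3 + (m:ℝ)) / R ^ 3) /
          ((A / 2) * (deriv (u m) 1 / u m 1) + A - f 1) := by
  have hm' : (2:ℝ) ≤ m := by exact_mod_cast hm
  have hR3 : 0 < R ^ 3 := by positivity
  have hP : 0 < ((m:ℝ) ^ 3 - m) / R ^ 3 := by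
    apply div_pos _ hR3
    nlinarith [mul_pos (show (0:ℝ) < m by linarith) (show (0:ℝ) < (m:ℝ) ^ 2 - 1 by nlinarith)]
  have hmul : G * ((A / 2) * (deriv (u m) 1 / u m 1) + A - f 1)
      = -(((m:ℝ) ^ 3 - m) / R ^ 3) := by
    have e : -(m:ℝ) ^ 3 / R ^ 3 + (m:ℝ) / R ^ 3 = -(((m:ℝ) ^ 3 - m) / R ^ 3) := by ring
    linarith
  have hc : (A / 2) * (deriv (u m) 1 / u m 1) + A - f 1 ≠ 0 := by
    intro h
    rw [h, mul_zero] at hmul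
    linarith
  refine ⟨?_, ?_⟩
  · by_contra hlt
    have hle : m ≤ k₁ := not_lt.mp hlt
    set S : Set ℝ := {x : ℝ | ∃ k : ℕ, k ≤ k₁ ∧
          f 1 - A - (A / 2) * (deriv (u k) 1 / u k 1) ≠ 0 ∧
          x = |f 1 - A - (A / 2) * (deriv (u k) 1 / u k 1)|} with hS
    have hfin : S.Finite := by
      refine ((Set.finite_Iic k₁).image
        (fun k : ℕ => |f 1 - A - (A / 2) * (deriv (u k) 1 / u k 1)|)).subset ?_
      rintro x ⟨k, hk, -, rfl⟩
      exact ⟨k, hk, rfl⟩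
    have hmem : |f 1 - A - (A / 2) * (deriv (u m) 1 / u m 1)| ∈ S :=
      ⟨m, hle, fun h => hc (by linarith), rfl⟩
    have hpos : 0 < sInf S := by
      obtain ⟨k, -, hk, hx⟩ := Set.Nonempty.csInf_mem ⟨_, hmem⟩ hfin
      rw [hx]
      exact abs_pos.mpr hk
    have hinf : sInf S ≤ |f 1 - A - (A / 2) * (deriv (u m) 1 / u m 1)| :=
      csInf_le hfin.bddBelow hmem
    have hk : (m:ℝ) ≤ k₁ := by exact_mod_cast hle
    have hPk : ((m:ℝ) ^ 3 - m) / R ^ 3 ≤ ((k₁:ℝ) ^ 3 - k₁) / R ^ 3 := by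
      apply div_le_div_of_nonneg_right _ hR3.le
      nlinarith [mul_nonneg (sub_nonneg.mpr hk)
        (show (0:ℝ) ≤ (k₁:ℝ) ^ 2 + k₁ * m + (m:ℝ) ^ 2 - 1 by nlinarith)]
    rw [gt_iff_lt, div_lt_iff₀ hpos] at hG
    have hG0 : 0 < G := by
      by_contra hneg
      have := mul_nonneg (neg_nonneg.mpr (not_lt.mp hneg)) hpos.le
      linarith
    have h1 := mul_le_mul_of_nonneg_left hinf hG0.le
    have h2 : G * |f 1 - A - (A / 2) * (deriv (u m) 1 / u m 1)|
        = ((m:ℝ) ^ 3 - m) / R ^ 3 := by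
      have e : f 1 - A - (A / 2) * (deriv (u m) 1 / u m 1)
          = -((A / 2) * (deriv (u m) 1 / u m 1) + A - f 1) := by ring
      rw [e, abs_neg]
      nth_rewrite 1 [← abs_of_pos hG0]
      rw [← abs_mul, hmul, abs_neg, abs_of_pos hP]
    linarith
  · rw [eq_div_iff hc, hmul]
    ring
end
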